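/- arXiv:1905.03566 — 3 statements merged into one kernel-verified Lean document; each statement's English description precedes it below -/
import Mathlib

section
/- Let (μ_t)_{t≥0} be a compactly supported measure-valued probability solution of the kinetic herding equation with centered means ∫x dμ_t = ∫v dμ_t = 0. Then the following identities hold for all t: (i) dX/dt = 2 C(X,V); (ii) dV/dt = −2λ_w C(X,V) − λ_x C_φ(X,V) − λ_v V_φ; (iii) dM/dt = C_φ(X,V); (iv) d C(X,V)/dt = V − λ_w X − (λ_x/2) X_φ − (λ_v/2) C_φ(X,V). -/
open MeasureTheory Filter Set RealInnerProductSpace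

noncomputable section

abbrev Euc (d : ℕ) := EuclideanSpace ℝ (Fin d)
abbrev Phase (d : ℕ) := Euc d × Euc d

/-- The nonlocal herding force `Q(x,v,μ)`. -/
noncomputable def herdQ {d : ℕ} (lw lx lv : ℝ) (φ : ℝ → ℝ) (μ : Measure (Phase d))
    (x v : Euc d) : Euc d :=
  ∫ z, (lw • (z.1 - x) + (lx * φ ‖x - z.1‖) • (z.1 - x)
      + (lv * φ ‖x - z.1‖) • (z.2 - v)) ∂μ

/-- Measure-valued solution of the kinetic herding equation on the time set `S`:
(i) finiteness, (ii) weak continuity in time against functions vanishing at infinity,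
(iii) the weak formulation against compactly supported `C¹` test functions. -/
def IsMVSol {d : ℕ} (lw lx lv : ℝ) (φ : ℝ → ℝ) (S : Set ℝ)
    (μ : ℝ → Measure (Phase d)) : Prop :=
  (∀ t ∈ S, IsFiniteMeasure (μ t)) ∧
  (∀ g : ZeroAtInftyContinuousMap (Phase d) ℝ,
      ContinuousOn (fun t => ∫ z, g z ∂(μ t)) S) ∧
  (∀ g : Phase d × ℝ → ℝ, ContDiff ℝ 1 g → HasCompactSupport g →
    ∀ t ∈ S,
      (∫ z, g (z, t) ∂(μ t)) - (∫ z, g (z, 0) ∂(μ 0)) =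
      ∫ s in (0:ℝ)..t, (∫ z,
        (deriv (fun u => g (z, u)) s
          + (fderiv ℝ (fun y => g ((y, z.2), s)) z.1) z.2
          + (fderiv ℝ (fun w => g ((z.1, w), s)) z.2)
              (herdQ lw lx lv φ (μ s) z.1 z.2)) ∂(μ s)))

/-- Topological support of a measure. -/
def msupport {d : ℕ} (μ : Measure (Phase d)) : Set (Phase d) :=
  {z | ∀ U : Set (Phase d), IsOpen U → z ∈ U → 0 < μ U}

/-- A measure has compact support. -/
def MeasureCompactSupport {d : ℕ} (μ : Measure (Phase d)) : Prop :=
  ∃ K : Set (Phase d), IsCompact K ∧ μ Kᶜ = 0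

/-- Wasserstein-1 distance in duality formulation: supremum of `|∫ g dμ - ∫ g dν|` over
functions `g` with `sup |g| ≤ 1` and Lipschitz constant `≤ 1`. -/
noncomputable def W1 {d : ℕ} (μ ν : Measure (Phase d)) : ℝ :=
  sSup {r : ℝ | ∃ g : Phase d → ℝ, (∀ z, |g z| ≤ 1) ∧ LipschitzWith 1 g ∧
    r = |(∫ z, g z ∂μ) - ∫ z, g z ∂ν|}

/-- Position variance functional `X(t)` (centered solutions). -/
noncomputable def Xfun {d : ℕ} (μ : ℝ → Measure (Phase d)) (t : ℝ) : ℝ :=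
  ∫ z, ‖z.1‖ ^ 2 ∂(μ t)

/-- Velocity variance functional `V(t)` (centered solutions). -/
noncomputable def Vfun {d : ℕ} (μ : ℝ → Measure (Phase d)) (t : ℝ) : ℝ :=
  ∫ z, ‖z.2‖ ^ 2 ∂(μ t)

/-- Covariance functional `C(X,V)(t)`. -/
noncomputable def Cfun {d : ℕ} (μ : ℝ → Measure (Phase d)) (t : ℝ) : ℝ :=
  ∫ z, ⟪z.1, z.2⟫ ∂(μ t)

/-- Weighted position energy `X_φ(t)`. -/
noncomputable def Xphi {d : ℕ} (φ : ℝ → ℝ) (μ : ℝ → Measure (Phase d)) (t : ℝ) : ℝ :=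
  ∫ z, (∫ w, φ ‖z.1 - w.1‖ * ‖z.1 - w.1‖ ^ 2 ∂(μ t)) ∂(μ t)

/-- Weighted velocity energy `V_φ(t)`. -/
noncomputable def Vphi {d : ℕ} (φ : ℝ → ℝ) (μ : ℝ → Measure (Phase d)) (t : ℝ) : ℝ :=
  ∫ z, (∫ w, φ ‖z.1 - w.1‖ * ‖z.2 - w.2‖ ^ 2 ∂(μ t)) ∂(μ t)

/-- Weighted covariance `C_φ(X,V)(t)`. -/
noncomputable def Cphi {d : ℕ} (φ : ℝ → ℝ) (μ : ℝ → Measure (Phase d)) (t : ℝ) : ℝ :=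
  ∫ z, (∫ w, φ ‖z.1 - w.1‖ * ⟪z.1 - w.1, z.2 - w.2⟫ ∂(μ t)) ∂(μ t)

/-- The potential `Φ(r) = (1/2) ∫_0^{r²} φ(√s) ds`. -/
noncomputable def Phifun (φ : ℝ → ℝ) (r : ℝ) : ℝ :=
  (1 / 2) * ∫ s in (0:ℝ)..(r ^ 2), φ (Real.sqrt s)

/-- Auxiliary (potential) functional `M(t)`. -/
noncomputable def Mfun {d : ℕ} (φ : ℝ → ℝ) (μ : ℝ → Measure (Phase d)) (t : ℝ) : ℝ :=
  ∫ z, (∫ w, Phifun φ ‖z.1 - w.1‖ ∂(μ t)) ∂(μ t)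


section helpers
open Topology

lemma kh_ae_prod {E F : Type*} [NormedAddCommGroup E] [NormedAddCommGroup F]
    [MeasurableSpace E] [MeasurableSpace F] [OpensMeasurableSpace E] [OpensMeasurableSpace F]
    (ν : Measure E) (ρ : Measure F) [IsFiniteMeasure ν] [IsFiniteMeasure ρ] (N : ℝ)
    (h1 : ∀ᵐ z ∂ν, ‖z‖ ≤ N) (h2 : ∀ᵐ z ∂ρ, ‖z‖ ≤ N) :
    ∀ᵐ p ∂(ν.prod ρ), ‖p‖ ≤ N := by
  have e1 : ∀ᵐ p ∂(ν.prod ρ), ‖p.1‖ ≤ N :=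
    Measure.quasiMeasurePreserving_fst.ae h1
  have e2 : ∀ᵐ p ∂(ν.prod ρ), ‖p.2‖ ≤ N :=
    Measure.quasiMeasurePreserving_snd.ae h2
  filter_upwards [e1, e2] with p a b
  exact max_le a b

lemma kh_integrable {E F : Type*} [NormedAddCommGroup E] [NormedSpace ℝ E] [ProperSpace E]
    [MeasurableSpace E] [OpensMeasurableSpace E] [SecondCountableTopology E]
    [NormedAddCommGroup F]
    (ν : Measure E) [IsFiniteMeasure ν] (N : ℝ)
    (h1 : ∀ᵐ z ∂ν, ‖z‖ ≤ N) (h : E → F) (hh : Continuous h) : Integrable h ν := by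
  obtain ⟨C, hC⟩ := (isCompact_closedBall (0 : E) N).exists_bound_of_continuousOn hh.continuousOn
  refine Integrable.of_bound hh.aestronglyMeasurable C ?_
  filter_upwards [h1] with z hz
  exact hC z (by simpa using hz)

/-- bounded continuous truncation -/
lemma kh_trunc {E : Type*} [NormedAddCommGroup E] [NormedSpace ℝ E] [FiniteDimensional ℝ E]
    (N : ℝ) : ∃ χ : E → ℝ, ContDiff ℝ 1 χ ∧ HasCompactSupport χ ∧
      ∀ z, ‖z‖ ≤ N → ∀ᶠ y in 𝓝 z, χ y = 1 := by
  let b : ContDiffBump (0 : E) := ⟨|N| + 1, |N| + 2, by positivity, by linarith⟩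
  refine ⟨b, b.contDiff, b.hasCompactSupport, fun z hz => ?_⟩
  apply b.eventuallyEq_one_of_mem_ball
  simp only [mem_ball_zero_iff]
  have := le_abs_self N
  change ‖z‖ < |N| + 1
  linarith

variable {d : ℕ}

def khP (μ : ℝ → Measure (Phase d))
    (hprob : ∀ t ∈ Set.Ici (0:ℝ), IsProbabilityMeasure (μ t)) (t : ℝ) (ht : t ∈ Set.Ici (0:ℝ)) :
    ProbabilityMeasure (Phase d) := ⟨μ t, hprob t ht⟩

lemma kh_contP (S : Set ℝ) (hS : S ⊆ Set.Ici 0) (μ : ℝ → Measure (Phase d))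
    (hw : ∀ g : ZeroAtInftyContinuousMap (Phase d) ℝ,
      ContinuousOn (fun t => ∫ z, g z ∂(μ t)) (Set.Ici 0))
    (hprob : ∀ t ∈ Set.Ici (0:ℝ), IsProbabilityMeasure (μ t)) (N : ℝ)
    (hN : ∀ t ∈ S, ∀ᵐ z ∂(μ t), ‖z‖ ≤ N) :
    Continuous (fun t : S => khP μ hprob t (hS t.2)) := by
  rw [ProbabilityMeasure.continuous_iff_forall_continuous_integral]
  intro f
  obtain ⟨χ, hχ, hc, h1⟩ := kh_trunc (E := Phase d) N
  let g : ZeroAtInftyContinuousMap (Phase d) ℝ :=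
    ⟨⟨fun z => χ z * f z, hχ.continuous.mul f.continuous⟩, by
      have : HasCompactSupport (fun z => χ z * f z) := hc.mul_right
      exact this.is_zero_at_infty⟩
  have := (hw g).mono hS
  rw [continuousOn_iff_continuous_domRestrict] at this
  convert this using 2 with t
  simp only [Set.domRestrict_apply]
  apply integral_congr_ae
  filter_upwards [hN t t.2] with z hz
  change f z = χ z * f z
  rw [(h1 z hz).self_of_nhds, one_mul]

lemma kh_cont2 (S : Set ℝ) (hS : S ⊆ Set.Ici 0) (μ : ℝ → Measure (Phase d))
    (hw : ∀ g : ZeroAtInftyContinuousMap (Phase d) ℝ,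
      ContinuousOn (fun t => ∫ z, g z ∂(μ t)) (Set.Ici 0))
    (hprob : ∀ t ∈ Set.Ici (0:ℝ), IsProbabilityMeasure (μ t)) (N : ℝ)
    (hN : ∀ t ∈ S, ∀ᵐ z ∂(μ t), ‖z‖ ≤ N) (k : Phase d × Phase d → ℝ) (hk : Continuous k) :
    Continuous (fun p : S × S => ∫ z, (∫ w, k (z, w) ∂(μ p.2)) ∂(μ p.1)) := by
  have hP := kh_contP S hS μ hw hprob N hN
  have hPP : Continuous (fun p : S × S =>
      (khP μ hprob p.1 (hS p.1.2)).prod (khP μ hprob p.2 (hS p.2.2))) :=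
    ProbabilityMeasure.continuous_prod.comp
      ((hP.comp continuous_fst).prodMk (hP.comp continuous_snd))
  rw [ProbabilityMeasure.continuous_iff_forall_continuous_integral] at hPP
  obtain ⟨χ, hχ, hc, h1⟩ := kh_trunc (E := Phase d × Phase d) N
  have hsupp : HasCompactSupport (fun z => χ z * k z) := hc.mul_right
  have hcont : Continuous (fun z => χ z * k z) := hχ.continuous.mul hk
  obtain ⟨C, hC⟩ := hsupp.exists_bound_of_continuous hcont
  have := hPP (BoundedContinuousFunction.ofNormedAddCommGroup _ hcont C hC)
  convert this using 2 with p
  have := hprob p.1 (hS p.1.2)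
  have := hprob p.2 (hS p.2.2)
  have hpr := kh_ae_prod (μ p.1) (μ p.2) N (hN _ p.1.2) (hN _ p.2.2)
  rw [← integral_prod k (kh_integrable _ N hpr k hk)]
  simp only [ProbabilityMeasure.toMeasure_prod]
  apply integral_congr_ae
  filter_upwards [hpr] with z hz
  change k z = χ z * k z
  rw [(h1 z hz).self_of_nhds, one_mul]

lemma kh_cont1 (S : Set ℝ) (hS : S ⊆ Set.Ici 0) (μ : ℝ → Measure (Phase d))
    (hw : ∀ g : ZeroAtInftyContinuousMap (Phase d) ℝ,
      ContinuousOn (fun t => ∫ z, g z ∂(μ t)) (Set.Ici 0))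
    (hprob : ∀ t ∈ Set.Ici (0:ℝ), IsProbabilityMeasure (μ t)) (N : ℝ)
    (hN : ∀ t ∈ S, ∀ᵐ z ∂(μ t), ‖z‖ ≤ N) (k : Phase d → ℝ) (hk : Continuous k) :
    ContinuousOn (fun t => ∫ z, k z ∂(μ t)) S := by
  have := (kh_cont2 S hS μ hw hprob N hN (fun p => k p.1) (by fun_prop)).comp
    (continuous_id.prodMk continuous_id : Continuous (fun t : S => (t, t)))
  rw [continuousOn_iff_continuous_domRestrict]
  refine this.congr fun t => ?_
  have := hprob t (hS t.2)
  simp [Set.domRestrict]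

lemma kh_cont2diag (S : Set ℝ) (hS : S ⊆ Set.Ici 0) (μ : ℝ → Measure (Phase d))
    (hw : ∀ g : ZeroAtInftyContinuousMap (Phase d) ℝ,
      ContinuousOn (fun t => ∫ z, g z ∂(μ t)) (Set.Ici 0))
    (hprob : ∀ t ∈ Set.Ici (0:ℝ), IsProbabilityMeasure (μ t)) (N : ℝ)
    (hN : ∀ t ∈ S, ∀ᵐ z ∂(μ t), ‖z‖ ≤ N) (k : Phase d × Phase d → ℝ) (hk : Continuous k) :
    ContinuousOn (fun t => ∫ z, (∫ w, k (z, w) ∂(μ t)) ∂(μ t)) S := by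
  have := (kh_cont2 S hS μ hw hprob N hN k hk).comp
    (continuous_id.prodMk continuous_id : Continuous (fun t : S => (t, t)))
  rw [continuousOn_iff_continuous_domRestrict]
  exact this

lemma kh_deriv_ext (a b : ℝ) (hab : a < b) (f L : ℝ → ℝ) (hf : ContinuousOn f (Icc a b))
    (hL : ContinuousOn L (Icc a b)) (hd : ∀ t ∈ Ioo a b, HasDerivAt f (L t) t) :
    ∀ t ∈ Icc a b, HasDerivWithinAt f (L t) (Icc a b) t := by
  intro t ht
  have hcl : closure (Ioo a b) = Icc a b := closure_Ioo hab.ne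
  rw [hasDerivWithinAt_iff_hasFDerivWithinAt, ← hcl]
  apply hasFDerivWithinAt_closure_of_tendsto_fderiv
  · exact fun t ht => (hd t ht).differentiableAt.differentiableWithinAt
  · exact convex_Ioo a b
  · exact isOpen_Ioo
  · rw [hcl]
    exact fun y hy => (hf y hy).mono Ioo_subset_Icc_self
  · have h1 : Tendsto L (𝓝[Ioo a b] t) (𝓝 (L t)) := (hL t ht).mono Ioo_subset_Icc_self
    have h2 : Tendsto (fun x => ContinuousLinearMap.toSpanSingleton ℝ (L x)) (𝓝[Ioo a b] t)
        (𝓝 (ContinuousLinearMap.toSpanSingleton ℝ (L t))) := by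
      have : Continuous (fun x : ℝ => ContinuousLinearMap.toSpanSingleton ℝ x) :=
        (ContinuousLinearMap.toSpanSingletonCLE (𝕜 := ℝ) (E := ℝ)).continuous
      exact (this.tendsto _).comp h1
    refine h2.congr' ?_
    filter_upwards [self_mem_nhdsWithin] with x hx
    exact ((hd x hx).hasFDerivAt.fderiv).symm

/-- interaction kernel -/
def khq (lw lx lv : ℝ) (φ : ℝ → ℝ) (z w : Phase d) : Euc d :=
  lw • (w.1 - z.1) + (lx * φ ‖z.1 - w.1‖) • (w.1 - z.1) + (lv * φ ‖z.1 - w.1‖) • (w.2 - z.2)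

lemma khq_cont (lw lx lv : ℝ) (φ : ℝ → ℝ) (hφ : Continuous φ) :
    Continuous (fun p : Phase d × Phase d => khq lw lx lv φ p.1 p.2) := by
  unfold khq
  fun_prop

/-- generator kernel -/
def khL (lw lx lv : ℝ) (φ : ℝ → ℝ) (h : Phase d → ℝ) (p : Phase d × Phase d) : ℝ :=
  fderiv ℝ h p.1 (p.1.2, khq lw lx lv φ p.1 p.2)

lemma khL_cont (lw lx lv : ℝ) (φ : ℝ → ℝ) (hφ : Continuous φ) (h : Phase d → ℝ)
    (hh : ContDiff ℝ 1 h) : Continuous (khL lw lx lv φ h) := by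
  unfold khL
  have h1 := hh.continuous_fderiv (by norm_num)
  have h2 := khq_cont (d := d) lw lx lv φ hφ
  fun_prop

lemma khL_int (lw lx lv : ℝ) (φ : ℝ → ℝ) (hφ : Continuous φ) (h : Phase d → ℝ)
    (ν : Measure (Phase d)) [IsProbabilityMeasure ν] (N : ℝ)
    (hN : ∀ᵐ z ∂ν, ‖z‖ ≤ N) (z : Phase d) :
    ∫ w, khL lw lx lv φ h (z, w) ∂ν = fderiv ℝ h z (z.2, herdQ lw lx lv φ ν z.1 z.2) := by
  unfold khL
  have h2 : Continuous (fun w : Phase d => khq lw lx lv φ z w) := by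
    unfold khq
    fun_prop
  have hi := kh_integrable ν N hN _ h2
  have hi2 : Integrable (fun w : Phase d => (z.2, khq lw lx lv φ z w)) ν :=
    kh_integrable ν N hN _ (continuous_const.prodMk h2)
  have h3 := ContinuousLinearMap.integral_comp_comm (fderiv ℝ h z) hi2
  simp only at h3 ⊢
  rw [h3, integral_pair (integrable_const _) hi]
  simp only [integral_const, probReal_univ, one_smul]
  rfl

lemma kh_weak_deriv (lw lx lv : ℝ) (φ : ℝ → ℝ) (hφ : Continuous φ) (a b : ℝ) (ha : 0 ≤ a)
    (μ : ℝ → Measure (Phase d)) (hsol : IsMVSol lw lx lv φ (Set.Ici 0) μ)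
    (hprob : ∀ t ∈ Set.Ici (0:ℝ), IsProbabilityMeasure (μ t)) (N : ℝ)
    (hN : ∀ t ∈ Icc a b, ∀ᵐ z ∂(μ t), ‖z‖ ≤ N) (h : Phase d → ℝ) (hh : ContDiff ℝ 1 h)
    (t₀ : ℝ) (ht₀ : t₀ ∈ Ioo a b) :
    HasDerivAt (fun t => ∫ z, h z ∂(μ t))
      (∫ z, (∫ w, khL lw lx lv φ h (z, w) ∂(μ t₀)) ∂(μ t₀)) t₀ := by
  obtain ⟨-, hw, hweak⟩ := hsol
  have hS : Icc a b ⊆ Ici (0:ℝ) := fun t ht => ha.trans ht.1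
  set A : ℝ → ℝ := fun t => ∫ z, h z ∂(μ t) with hA
  set L : ℝ → ℝ := fun t => ∫ z, (∫ w, khL lw lx lv φ h (z, w) ∂(μ t)) ∂(μ t) with hL
  have hAc : ContinuousOn A (Icc a b) := kh_cont1 _ hS μ hw hprob N hN h hh.continuous
  have hLc : ContinuousOn L (Icc a b) :=
    kh_cont2diag _ hS μ hw hprob N hN _ (khL_cont lw lx lv φ hφ h hh)
  obtain ⟨χ, hχ, hc, h1⟩ := kh_trunc (E := Phase d) N
  obtain ⟨r, hr, hrs⟩ := Metric.isOpen_iff.1 isOpen_Ioo t₀ ht₀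
  let η : ContDiffBump t₀ := ⟨r / 3, r / 2, by positivity, by linarith⟩
  have hts : tsupport η ⊆ Ioo a b := by
    rw [η.tsupport_eq]
    refine (Metric.closedBall_subset_ball ?_).trans hrs
    change r / 2 < r
    linarith
  have hη1 : ContDiff ℝ 1 η := η.contDiff
  have hηc : Continuous η := hη1.continuous
  have hηd : Continuous (deriv η) := hη1.continuous_deriv (by norm_num)
  have hout : ∀ s, s ∉ Ioo a b → ∀ᶠ u in 𝓝 s, η u = 0 := fun s hs =>
    notMem_tsupport_iff_eventuallyEq.1 (fun hmem => hs (hts hmem))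
  have hout' : ∀ s, s ∉ Ioo a b → ∀ᶠ u in 𝓝 s, deriv η u = 0 := fun s hs => by
    filter_upwards [(hout s hs).eventually_nhds] with u hu
    have : (η : ℝ → ℝ) =ᶠ[𝓝 u] fun _ => 0 := hu
    rw [this.deriv_eq]; simp
  let G : ℝ → ℝ := fun s => deriv η s * A s + η s * L s
  have hG : Continuous G := by
    rw [continuous_iff_continuousAt]
    intro s
    by_cases hs : s ∈ Ioo a b
    · have hn : Icc a b ∈ 𝓝 s := Icc_mem_nhds hs.1 hs.2
      exact (hηd.continuousAt.mul (hAc.continuousAt hn)).add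
        (hηc.continuousAt.mul (hLc.continuousAt hn))
    · have : G =ᶠ[𝓝 s] fun _ => 0 := by
        filter_upwards [hout s hs, hout' s hs] with u e1 e2
        simp [G, e1, e2]
      exact continuousAt_const.congr this.symm
  let g : Phase d × ℝ → ℝ := fun p => η p.2 * (χ p.1 * h p.1)
  have hg1 : ContDiff ℝ 1 g := by
    have : ContDiff ℝ 1 (η : ℝ → ℝ) := hη1
    exact (this.comp contDiff_snd).mul ((hχ.comp contDiff_fst).mul (hh.comp contDiff_fst))
  have hgc : HasCompactSupport g := by
    refine HasCompactSupport.intro (K := tsupport χ ×ˢ tsupport η)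
      (hc.isCompact.prod η.hasCompactSupport.isCompact) ?_
    intro p hp
    by_cases h2 : p.2 ∈ tsupport η
    · have h3 : p.1 ∉ tsupport χ := fun h3 => hp ⟨h3, h2⟩
      simp [g, image_eq_zero_of_notMem_tsupport h3]
    · simp [g, image_eq_zero_of_notMem_tsupport h2]
  have key := hweak g hg1 hgc
  -- the integrand
  have hint : ∀ s ∈ Ici (0:ℝ), (∫ z,
        (deriv (fun u => g (z, u)) s
          + (fderiv ℝ (fun y => g ((y, z.2), s)) z.1) z.2
          + (fderiv ℝ (fun w => g ((z.1, w), s)) z.2)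
              (herdQ lw lx lv φ (μ s) z.1 z.2)) ∂(μ s)) = G s := by
    intro s hs0
    have hdd : ∀ z : Phase d, deriv (fun u => g (z, u)) s = deriv η s * (χ z * h z) := by
      intro z
      exact ((hη1.differentiable (by norm_num) s).hasDerivAt.mul_const (χ z * h z)).deriv
    have hχh : Differentiable ℝ (fun z => χ z * h z) :=
      (hχ.mul hh).differentiable (by norm_num)
    have hd1 : ∀ z : Phase d, (fderiv ℝ (fun y => g ((y, z.2), s)) z.1) z.2 =
        η s * fderiv ℝ (fun z => χ z * h z) z (z.2, 0) := by
      intro z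
      have e1 : HasFDerivAt (fun y : Euc d => (y, z.2))
          (ContinuousLinearMap.inl ℝ (Euc d) (Euc d)) z.1 := hasFDerivAt_prodMk_left _ _
      have e2 := ((hχh z).hasFDerivAt.comp z.1 e1).const_mul (η s)
      have e3 : fderiv ℝ (fun y => g ((y, z.2), s)) z.1 = _ := e2.fderiv
      rw [e3]
      simp
    have hd2 : ∀ (z : Phase d) (q : Euc d), (fderiv ℝ (fun w => g ((z.1, w), s)) z.2) q =
        η s * fderiv ℝ (fun z => χ z * h z) z (0, q) := by
      intro z q
      have e1 : HasFDerivAt (fun y : Euc d => (z.1, y))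
          (ContinuousLinearMap.inr ℝ (Euc d) (Euc d)) z.2 := hasFDerivAt_prodMk_right _ _
      have e2 := ((hχh z).hasFDerivAt.comp z.2 e1).const_mul (η s)
      have e3 : fderiv ℝ (fun w => g ((z.1, w), s)) z.2 = _ := e2.fderiv
      rw [e3]
      simp
    simp only [hdd, hd1, hd2]
    by_cases hs : s ∈ Ioo a b
    · have hsI := Ioo_subset_Icc_self hs
      have := hprob s hs0
      have hNs := hN s hsI
      have e0 : ∀ᵐ z ∂(μ s), deriv η s * (χ z * h z)
          + η s * fderiv ℝ (fun z => χ z * h z) z (z.2, 0)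
          + η s * fderiv ℝ (fun z => χ z * h z) z (0, herdQ lw lx lv φ (μ s) z.1 z.2)
          = deriv η s * h z + η s * ∫ w, khL lw lx lv φ h (z, w) ∂(μ s) := by
        filter_upwards [hNs] with z hz
        have e1 : (fun z => χ z * h z) =ᶠ[𝓝 z] h := by
          filter_upwards [h1 z hz] with y hy
          rw [hy, one_mul]
        rw [khL_int lw lx lv φ hφ h (μ s) N hNs z, e1.fderiv_eq,
          (h1 z hz).self_of_nhds, one_mul, add_assoc, ← mul_add, ← map_add]
        simp
      rw [integral_congr_ae e0, integral_add, integral_const_mul, integral_const_mul]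
      · exact (kh_integrable _ N hNs h hh.continuous).const_mul _
      · refine Integrable.const_mul ?_ _
        exact (kh_integrable _ N (kh_ae_prod _ _ N hNs hNs) _
          (khL_cont lw lx lv φ hφ h hh)).integral_prod_left
    · have e1 := (hout s hs).self_of_nhds
      have e2 := (hout' s hs).self_of_nhds
      simp [G, e1, e2]
  have h00 : (0:ℝ) ∉ Ioo a b := fun h0 => absurd h0.1 (not_lt.2 ha)
  have e0 := (hout 0 h00).self_of_nhds
  have hη_one : ∀ᶠ t in 𝓝 t₀, η t = 1 := by
    have := η.eventuallyEq_one
    exact this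
  have hFTC : HasDerivAt (fun t => ∫ s in (0:ℝ)..t, G s) (G t₀) t₀ :=
    intervalIntegral.integral_hasDerivAt_right (hG.intervalIntegrable _ _)
      (hG.stronglyMeasurableAtFilter _ _) hG.continuousAt
  have hGt : G t₀ = L t₀ := by
    have : deriv η t₀ = 0 := by
      have : (η : ℝ → ℝ) =ᶠ[𝓝 t₀] fun _ => 1 := hη_one
      rw [this.deriv_eq]; simp
    simp [G, this, hη_one.self_of_nhds]
  rw [hGt] at hFTC
  refine hFTC.congr_of_eventuallyEq ?_
  filter_upwards [hη_one, Ioo_mem_nhds ht₀.1 ht₀.2] with t e1 ht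
  have ht0 : t ∈ Ici (0:ℝ) := hS (Ioo_subset_Icc_self ht)
  have k1 := key t ht0
  have k2 : ∫ z, g (z, t) ∂(μ t) = A t := by
    apply integral_congr_ae
    filter_upwards [hN t (Ioo_subset_Icc_self ht)] with z hz
    simp [g, e1, (h1 z hz).self_of_nhds]
  have k3 : ∫ z, g (z, 0) ∂(μ 0) = 0 := by simp [g, e0]
  rw [k2, k3, sub_zero] at k1
  rw [k1]
  apply intervalIntegral.integral_congr
  intro s hs
  rw [uIcc_of_le ht0] at hs
  exact hint s hs.1

lemma kh_weak_deriv' (lw lx lv : ℝ) (φ : ℝ → ℝ) (hφ : Continuous φ) (a b : ℝ) (ha : 0 ≤ a)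
    (hab : a < b)
    (μ : ℝ → Measure (Phase d)) (hsol : IsMVSol lw lx lv φ (Set.Ici 0) μ)
    (hprob : ∀ t ∈ Set.Ici (0:ℝ), IsProbabilityMeasure (μ t)) (N : ℝ)
    (hN : ∀ t ∈ Icc a b, ∀ᵐ z ∂(μ t), ‖z‖ ≤ N) (h : Phase d → ℝ) (hh : ContDiff ℝ 1 h) :
    ∀ t ∈ Icc a b, HasDerivWithinAt (fun t => ∫ z, h z ∂(μ t))
      (∫ z, (∫ w, khL lw lx lv φ h (z, w) ∂(μ t)) ∂(μ t)) (Icc a b) t := by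
  have hS : Icc a b ⊆ Ici (0:ℝ) := fun t ht => ha.trans ht.1
  exact kh_deriv_ext a b hab _ _ (kh_cont1 _ hS μ hsol.2.1 hprob N hN h hh.continuous)
    (kh_cont2diag _ hS μ hsol.2.1 hprob N hN _ (khL_cont lw lx lv φ hφ h hh))
    (fun t ht => kh_weak_deriv lw lx lv φ hφ a b ha μ hsol hprob N hN h hh t ht)

def khH (z : Phase d) : ℝ := ‖z.1‖ ^ 2 + ‖z.2‖ ^ 2

lemma khH_nonneg (z : Phase d) : 0 ≤ khH z := by unfold khH; positivity

lemma khH_contDiff : ContDiff ℝ 1 (khH (d := d)) := by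
  unfold khH
  exact ((contDiff_fst).norm_sq ℝ).add ((contDiff_snd).norm_sq ℝ)

lemma khH_fderiv (z u : Phase d) :
    fderiv ℝ (khH (d := d)) z u = 2 * ⟪z.1, u.1⟫ + 2 * ⟪z.2, u.2⟫ := by
  have h1 : HasFDerivAt (fun z : Phase d => ‖z.1‖ ^ 2) _ z :=
    (hasFDerivAt_fst (𝕜 := ℝ) (p := z)).norm_sq
  have h2 : HasFDerivAt (fun z : Phase d => ‖z.2‖ ^ 2) _ z :=
    (hasFDerivAt_snd (𝕜 := ℝ) (p := z)).norm_sq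
  have h3 : HasFDerivAt (khH (d := d)) _ z := h1.add h2
  rw [h3.fderiv]
  simp

lemma khHp_fderiv (p : ℕ) (z u : Phase d) :
    fderiv ℝ (fun z => khH (d := d) z ^ (p + 1)) z u =
      (p + 1) * khH z ^ p * (2 * ⟪z.1, u.1⟫ + 2 * ⟪z.2, u.2⟫) := by
  have h3 := (khH_contDiff (d := d)).differentiable (by norm_num) z
  rw [← khH_fderiv, (h3.hasFDerivAt.pow (p + 1)).fderiv]
  simp

lemma khq_bound (lw lx lv : ℝ) (hlw : 0 < lw) (hlx : 0 < lx) (hlv : 0 < lv)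
    (φ : ℝ → ℝ) (φM : ℝ) (hφ : ∀ r, 0 ≤ φ r ∧ φ r ≤ φM) (z w : Phase d) :
    |⟪z.1, z.2⟫ + ⟪z.2, khq lw lx lv φ z w⟫| ≤
      (1 + 2 * lw + 2 * (lx * φM) + 2 * (lv * φM)) * (khH z + khH w) := by
  unfold khq khH
  obtain ⟨p0, p1⟩ := hφ ‖z.1 - w.1‖
  generalize φ ‖z.1 - w.1‖ = c at p0 p1
  have hi : ∀ a b : Euc d, |⟪a, b⟫| ≤ ‖a‖ ^ 2 + ‖b‖ ^ 2 := fun a b => by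
    have := abs_real_inner_le_norm a b
    nlinarith [sq_nonneg (‖a‖ - ‖b‖), sq_nonneg (‖a‖), sq_nonneg (‖b‖)]
  have a1 := hi z.1 z.2
  have a2 := hi z.2 w.1
  have a3 := hi z.2 w.2
  have a4 := hi z.2 z.1
  have a5 : ⟪z.2, z.2⟫ = ‖z.2‖ ^ 2 := real_inner_self_eq_norm_sq _
  simp only [inner_add_right, inner_smul_right, inner_sub_right, a5]
  set S := ‖z.1‖ ^ 2 + ‖z.2‖ ^ 2 + (‖w.1‖ ^ 2 + ‖w.2‖ ^ 2) with hS
  have n1 := sq_nonneg ‖z.1‖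
  have n2 := sq_nonneg ‖z.2‖
  have n3 := sq_nonneg ‖w.1‖
  have n4 := sq_nonneg ‖w.2‖
  have hS0 : 0 ≤ S := by positivity
  have b1 : |⟪z.1, z.2⟫| ≤ S := by linarith
  have b2 : |⟪z.2, w.1⟫ - ⟪z.2, z.1⟫| ≤ 2 * S := (abs_sub _ _).trans (by linarith)
  have b3 : |⟪z.2, w.2⟫ - ‖z.2‖ ^ 2| ≤ 2 * S :=
    (abs_sub _ _).trans (by rw [abs_of_nonneg n2]; linarith)
  have hM0 : 0 ≤ φM := p0.trans p1
  have c1 : |lw * (⟪z.2, w.1⟫ - ⟪z.2, z.1⟫)| ≤ lw * (2 * S) := by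
    rw [abs_mul, abs_of_pos hlw]; gcongr
  have c2 : |lx * c * (⟪z.2, w.1⟫ - ⟪z.2, z.1⟫)| ≤ lx * φM * (2 * S) := by
    rw [abs_mul, abs_of_nonneg (by positivity)]; gcongr
  have c3 : |lv * c * (⟪z.2, w.2⟫ - ‖z.2‖ ^ 2)| ≤ lv * φM * (2 * S) := by
    rw [abs_mul, abs_of_nonneg (by positivity)]; gcongr
  rw [abs_le] at *
  constructor <;> nlinarith

def khC (lw lx lv φM : ℝ) : ℝ := 8 * (1 + 2 * lw + 2 * (lx * φM) + 2 * (lv * φM))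

lemma khL_bound (lw lx lv : ℝ) (hlw : 0 < lw) (hlx : 0 < lx) (hlv : 0 < lv)
    (φ : ℝ → ℝ) (φM : ℝ) (hφM : 0 < φM) (hφ : ∀ r, 0 ≤ φ r ∧ φ r ≤ φM) (p : ℕ)
    (z w : Phase d) :
    |khL lw lx lv φ (fun z => khH (d := d) z ^ (p + 1)) (z, w)| ≤
      (p + 1) * khC lw lx lv φM / 2 * (khH z ^ (p + 1) + khH w ^ (p + 1)) := by
  unfold khL khC
  rw [khHp_fderiv]
  have h1 := khq_bound lw lx lv hlw hlx hlv φ φM hφ z w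
  set C := (1 + 2 * lw + 2 * (lx * φM) + 2 * (lv * φM)) with hC
  have hC0 : 0 ≤ C := by positivity
  have hz := khH_nonneg z
  have hw := khH_nonneg w
  have h2 : khH z ^ p * khH w ≤ khH z ^ (p + 1) + khH w ^ (p + 1) := by
    rcases le_total (khH z) (khH w) with h | h
    · have : khH z ^ p * khH w ≤ khH w ^ p * khH w := by gcongr
      have := pow_nonneg hz (p + 1)
      rw [pow_succ (khH w)]; linarith
    · have : khH z ^ p * khH w ≤ khH z ^ p * khH z := by gcongr
      have := pow_nonneg hw (p + 1)
      rw [pow_succ (khH z)]; linarith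
  have h3 : |2 * ⟪z.1, z.2⟫ + 2 * ⟪z.2, khq lw lx lv φ z w⟫| ≤ 2 * (C * (khH z + khH w)) := by
    rw [← mul_add, abs_mul, abs_two]; gcongr
  simp only
  rw [abs_mul, abs_of_nonneg (by positivity)]
  calc _ ≤ ((p:ℝ) + 1) * khH z ^ p * (2 * (C * (khH z + khH w))) := by gcongr
    _ = 2 * (((p:ℝ) + 1) * C) * (khH z ^ (p + 1) + khH z ^ p * khH w) := by ring
    _ ≤ 2 * (((p:ℝ) + 1) * C) * (khH z ^ (p + 1) + (khH z ^ (p + 1) + khH w ^ (p + 1))) := by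
        gcongr
    _ ≤ 2 * (((p:ℝ) + 1) * C) * (2 * (khH z ^ (p + 1) + khH w ^ (p + 1))) := by
        gcongr
        have := pow_nonneg hw (p + 1)
        linarith
    _ = _ := by ring

lemma kh_gronwall (a b c : ℝ) (f f' : ℝ → ℝ)
    (hf : ∀ t ∈ Icc a b, HasDerivWithinAt f (f' t) (Icc a b) t)
    (hb : ∀ t ∈ Icc a b, |f' t| ≤ c * f t) :
    ∀ s ∈ Icc a b, ∀ t ∈ Icc a b, f t ≤ f s * Real.exp (c * |t - s|) := by
  have hd : ∀ k : ℝ, ∀ t ∈ Icc a b, HasDerivWithinAt (fun t => f t * Real.exp (k * t))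
      (f' t * Real.exp (k * t) + f t * (Real.exp (k * t) * k)) (Icc a b) t := by
    intro k t ht
    have : HasDerivAt (fun t : ℝ => Real.exp (k * t)) (Real.exp (k * t) * k) t := by
      have := ((hasDerivAt_id t).const_mul k).exp
      simpa using this
    exact (hf t ht).mul this.hasDerivWithinAt
  have hanti : AntitoneOn (fun t => f t * Real.exp (-c * t)) (Icc a b) := by
    refine antitoneOn_of_hasDerivWithinAt_nonpos (convex_Icc a b)
      (fun t ht => (hd _ t ht).continuousWithinAt)
      (fun t ht => (hd _ t (interior_subset ht)).mono interior_subset) ?_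
    intro t ht
    have := (abs_le.1 (hb t (interior_subset ht))).2
    have e := Real.exp_pos (-c * t)
    nlinarith
  have hmono : MonotoneOn (fun t => f t * Real.exp (c * t)) (Icc a b) := by
    refine monotoneOn_of_hasDerivWithinAt_nonneg (convex_Icc a b)
      (fun t ht => (hd _ t ht).continuousWithinAt)
      (fun t ht => (hd _ t (interior_subset ht)).mono interior_subset) ?_
    intro t ht
    have := (abs_le.1 (hb t (interior_subset ht))).1
    have e := Real.exp_pos (c * t)
    nlinarith
  intro s hs t ht
  rcases le_total s t with h | h
  · have h1 := hanti hs ht h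
    simp only at h1
    rw [abs_of_nonneg (by linarith)]
    have h2 := mul_le_mul_of_nonneg_right h1 (Real.exp_pos (c * t)).le
    rw [mul_assoc, mul_assoc, ← Real.exp_add, ← Real.exp_add] at h2
    have e1 : -c * t + c * t = 0 := by ring
    have e2 : -c * s + c * t = c * (t - s) := by ring
    rwa [e1, e2, Real.exp_zero, mul_one] at h2
  · have h1 := hmono ht hs h
    simp only at h1
    rw [abs_of_nonpos (by linarith)]
    have h2 := mul_le_mul_of_nonneg_right h1 (Real.exp_pos (-c * t)).le
    rw [mul_assoc, mul_assoc, ← Real.exp_add, ← Real.exp_add] at h2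
    have e1 : c * t + -c * t = 0 := by ring
    have e2 : c * s + -c * t = c * -(t - s) := by ring
    rwa [e1, e2, Real.exp_zero, mul_one] at h2

/-- propagation of supports -/
lemma kh_prop (lw lx lv : ℝ) (hlw : 0 < lw) (hlx : 0 < lx) (hlv : 0 < lv)
    (φ : ℝ → ℝ) (hφc : Continuous φ) (φM : ℝ) (hφM : 0 < φM) (hφ : ∀ r, 0 ≤ φ r ∧ φ r ≤ φM)
    (a b : ℝ) (ha : 0 ≤ a) (hab : a < b)
    (μ : ℝ → Measure (Phase d)) (hsol : IsMVSol lw lx lv φ (Set.Ici 0) μ)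
    (hprob : ∀ t ∈ Set.Ici (0:ℝ), IsProbabilityMeasure (μ t)) (N : ℝ)
    (hN : ∀ t ∈ Icc a b, ∀ᵐ z ∂(μ t), ‖z‖ ≤ N) (n : ℝ) (hn : 0 ≤ n)
    (s : ℝ) (hs : s ∈ Icc a b) (hsn : ∀ᵐ z ∂(μ s), khH z ≤ n) (t : ℝ) (ht : t ∈ Icc a b) :
    ∀ᵐ z ∂(μ t), khH z ≤ n * Real.exp (khC lw lx lv φM * |t - s|) := by
  set K := khC lw lx lv φM with hK
  have hS : Icc a b ⊆ Ici (0:ℝ) := fun t ht => ha.trans ht.1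
  have hHp : ∀ p : ℕ, ContDiff ℝ 1 (fun z => khH (d := d) z ^ (p + 1)) :=
    fun p => khH_contDiff.pow _
  have hint : ∀ p : ℕ, ∀ t ∈ Icc a b, Integrable (fun z => khH (d := d) z ^ (p + 1)) (μ t) := by
    intro p t ht
    have := hprob t (hS ht)
    exact kh_integrable _ N (hN t ht) _ (hHp p).continuous
  have hm : ∀ p : ℕ, ∫ z, khH z ^ (p + 1) ∂(μ t) ≤
      (n * Real.exp (K * |t - s|)) ^ (p + 1) := by
    intro p
    have h1 := kh_weak_deriv' lw lx lv φ hφc a b ha hab μ hsol hprob N hN _ (hHp p)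
    have h2 := kh_gronwall a b ((p + 1) * K) _ _ h1 ?_ s hs t ht
    · refine h2.trans ?_
      have := hprob s (hS hs)
      have h3 : ∫ z, khH z ^ (p + 1) ∂(μ s) ≤ ∫ z, n ^ (p + 1) ∂(μ s) := by
        apply integral_mono_ae (hint p s hs) (integrable_const _)
        filter_upwards [hsn] with z hz
        exact pow_le_pow_left₀ (khH_nonneg z) hz _
      simp only [integral_const, probReal_univ, one_smul] at h3
      rw [mul_pow, ← Real.exp_nat_mul]
      have e : ((p:ℝ) + 1) * K * |t - s| = ((p + 1 : ℕ) : ℝ) * (K * |t - s|) := by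
        push_cast; ring
      rw [e]
      gcongr
    · intro u hu
      have := hprob u (hS hu)
      have hi := hint p u hu
      have hz : ∀ z : Phase d, |∫ w, khL lw lx lv φ (fun z => khH z ^ (p + 1)) (z, w) ∂(μ u)| ≤
          (p + 1) * K / 2 * (khH z ^ (p + 1) + ∫ w, khH w ^ (p + 1) ∂(μ u)) := by
        intro z
        have e := norm_integral_le_of_norm_le
          (f := fun w => khL lw lx lv φ (fun z => khH z ^ (p + 1)) (z, w))
          (((integrable_const (khH z ^ (p + 1))).add hi).const_mul (((p:ℝ) + 1) * K / 2))
          (Eventually.of_forall fun w => khL_bound lw lx lv hlw hlx hlv φ φM hφM hφ p z w)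
        refine e.trans_eq ?_
        rw [integral_const_mul]
        congr 1
        rw [integral_add' (integrable_const _) hi]
        simp
      have e := norm_integral_le_of_norm_le
          (f := fun z => ∫ w, khL lw lx lv φ (fun z => khH z ^ (p + 1)) (z, w) ∂(μ u))
          ((hi.add (integrable_const (∫ w, khH w ^ (p + 1) ∂(μ u)))).const_mul (((p:ℝ) + 1) * K / 2))
          (Eventually.of_forall hz)
      refine e.trans_eq ?_
      rw [integral_const_mul, integral_add' hi (integrable_const _)]
      simp only [integral_const, probReal_univ, one_smul]
      ring
  set ρ := n * Real.exp (K * |t - s|) with hρ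
  have hρ0 : 0 ≤ ρ := by positivity
  have := hprob t (hS ht)
  have hr : ∀ r, ρ < r → (μ t) {z | r ≤ khH z} = 0 := by
    intro r hr
    have hr0 : 0 < r := hρ0.trans_lt hr
    have h1 : ∀ p : ℕ, (μ t).real {z | r ≤ khH z} ≤ (ρ / r) ^ (p + 1) := by
      intro p
      have h2 := mul_meas_ge_le_integral_of_nonneg
        (Eventually.of_forall fun z => pow_nonneg (khH_nonneg z) (p + 1)) (hint p t ht) (r ^ (p + 1))
      have h3 : {z : Phase d | r ^ (p + 1) ≤ khH z ^ (p + 1)} = {z | r ≤ khH z} := by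
        ext z
        exact pow_le_pow_iff_left₀ hr0.le (khH_nonneg z) (by omega)
      rw [h3] at h2
      rw [div_pow, le_div_iff₀ (by positivity), mul_comm]
      exact h2.trans (hm p)
    have h4 : Tendsto (fun p : ℕ => (ρ / r) ^ (p + 1)) atTop (𝓝 0) :=
      (tendsto_pow_atTop_nhds_zero_of_lt_one (by positivity) ((div_lt_one hr0).2 hr)).comp
        (tendsto_add_atTop_nat 1)
    have h5 := ge_of_tendsto' h4 h1
    have h6 : (μ t).real {z | r ≤ khH z} = 0 := le_antisymm h5 measureReal_nonneg
    rwa [measureReal_eq_zero_iff] at h6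
  have h7 : ∀ k : ℕ, ∀ᵐ z ∂(μ t), khH z < ρ + 1 / ((k:ℝ) + 1) := by
    intro k
    have := hr (ρ + 1 / ((k:ℝ) + 1)) (by have : (0:ℝ) < 1 / ((k:ℝ) + 1) := by positivity
                                         linarith)
    rw [ae_iff]
    simpa using this
  filter_upwards [ae_all_iff.2 h7] with z hz
  have : Tendsto (fun k : ℕ => ρ + 1 / ((k:ℝ) + 1)) atTop (𝓝 (ρ + 0)) :=
    tendsto_const_nhds.add tendsto_one_div_add_atTop_nhds_zero_nat
  rw [add_zero] at this
  exact ge_of_tendsto' this fun k => (hz k).le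

def khBd (μ : ℝ → Measure (Phase d)) (t n : ℝ) : Prop := ∀ᵐ z ∂(μ t), khH z ≤ n

lemma khBd.mono {μ : ℝ → Measure (Phase d)} {t n m : ℝ} (h : khBd μ t n) (hnm : n ≤ m) :
    khBd μ t m := by
  filter_upwards [h] with z hz using hz.trans hnm

lemma khBd.norm {μ : ℝ → Measure (Phase d)} {t n : ℝ} (h : khBd μ t n) :
    ∀ᵐ z ∂(μ t), ‖z‖ ≤ n + 1 := by
  filter_upwards [h] with z hz
  unfold khH at hz
  rw [Prod.norm_def]
  apply max_le <;> nlinarith [sq_nonneg (‖z.1‖ - 1), sq_nonneg (‖z.2‖ - 1), sq_nonneg ‖z.1‖,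
    sq_nonneg ‖z.2‖]

lemma khBd_of_cpt {μ : ℝ → Measure (Phase d)} {t : ℝ} (h : MeasureCompactSupport (μ t)) :
    ∃ n : ℕ, khBd μ t n := by
  obtain ⟨K, hK, h0⟩ := h
  obtain ⟨C, hC⟩ := hK.exists_bound_of_continuousOn
    (khH_contDiff (d := d)).continuous.continuousOn
  obtain ⟨n, hn⟩ := exists_nat_ge C
  refine ⟨n, ?_⟩
  have : ∀ᵐ z ∂(μ t), z ∈ K := by
    rw [ae_iff]; exact h0
  filter_upwards [this] with z hz
  exact ((le_abs_self _).trans (hC z hz)).trans hn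

lemma khBd_closed (μ : ℝ → Measure (Phase d))
    (hw : ∀ g : ZeroAtInftyContinuousMap (Phase d) ℝ,
      ContinuousOn (fun t => ∫ z, g z ∂(μ t)) (Set.Ici 0))
    (hprob : ∀ t ∈ Set.Ici (0:ℝ), IsProbabilityMeasure (μ t))
    (hcpt : ∀ t ∈ Set.Ici (0:ℝ), MeasureCompactSupport (μ t)) (n : ℝ) :
    IsClosed {t : ℝ | t ∈ Ici (0:ℝ) ∧ khBd μ t n} := by
  rw [isClosed_iff_clusterPt]
  intro t hcl
  rw [← mem_closure_iff_clusterPt] at hcl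
  have ht0 : t ∈ Ici (0:ℝ) := closure_minimal (fun s hs => hs.1) isClosed_Ici hcl
  refine ⟨ht0, ?_⟩
  have := hprob t ht0
  obtain ⟨m, hm⟩ := khBd_of_cpt (hcpt t ht0)
  obtain ⟨χ, hχ, hc, h1⟩ := kh_trunc (E := Phase d) (m + 1)
  have hHc : Continuous (khH (d := d)) := khH_contDiff.continuous
  let g : ZeroAtInftyContinuousMap (Phase d) ℝ :=
    ⟨⟨fun z => χ z * max (khH z - n) 0, hχ.continuous.mul (by fun_prop)⟩, by
      have : HasCompactSupport (fun z => χ z * max (khH z - n) 0) := hc.mul_right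
      exact this.is_zero_at_infty⟩
  have hg : ∀ s ∈ {t : ℝ | t ∈ Ici (0:ℝ) ∧ khBd μ t n}, ∫ z, g z ∂(μ s) = 0 := by
    intro s hs
    rw [integral_eq_zero_of_ae]
    filter_upwards [hs.2] with z hz
    change χ z * max (khH z - n) 0 = 0
    rw [max_eq_right (by linarith), mul_zero]
  have hgt : ∫ z, g z ∂(μ t) = 0 := by
    have hcw : ContinuousWithinAt (fun t => ∫ z, g z ∂(μ t))
        {t : ℝ | t ∈ Ici (0:ℝ) ∧ khBd μ t n} t := (hw g t ht0).mono (fun s hs => hs.1)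
    have := hcw.mem_closure (t := {(0:ℝ)}) hcl (fun s hs => hg s hs)
    simpa using this
  have h2 : ∫ z, max (khH z - n) 0 ∂(μ t) = 0 := by
    refine Eq.trans ?_ hgt
    apply integral_congr_ae
    filter_upwards [hm.norm] with z hz
    change max (khH z - n) 0 = χ z * max (khH z - n) 0
    rw [(h1 z hz).self_of_nhds, one_mul]
  rw [integral_eq_zero_iff_of_nonneg (f := fun z => max (khH z - n) 0) (fun z => le_max_right _ _)
    (kh_integrable _ _ hm.norm _ (by fun_prop))] at h2
  filter_upwards [h2] with z hz
  have := le_max_left (khH z - n) 0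
  simp only [Pi.zero_apply] at hz
  linarith

def khU (μ : ℝ → Measure (Phase d)) : Set ℝ :=
  {t | ∃ n : ℝ, ∀ᶠ s in 𝓝 t, s ∈ Ici (0:ℝ) → khBd μ s n}

lemma khU_open (μ : ℝ → Measure (Phase d)) : IsOpen (khU μ) := by
  rw [isOpen_iff_eventually]
  rintro t ⟨n, hn⟩
  filter_upwards [hn.eventually_nhds] with s hs
  exact ⟨n, hs⟩

lemma khU_bdd (μ : ℝ → Measure (Phase d)) (a b : ℝ) (h : Icc a b ⊆ khU μ) :
    ∃ n : ℝ, ∀ s ∈ Icc a b, s ∈ Ici (0:ℝ) → khBd μ s n := by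
  refine isCompact_Icc.induction_on (p := fun S => ∃ n : ℝ, ∀ s ∈ S, s ∈ Ici (0:ℝ) → khBd μ s n)
    ⟨0, by simp⟩ ?_ ?_ ?_
  · rintro s t hst ⟨n, hn⟩
    exact ⟨n, fun u hu => hn u (hst hu)⟩
  · rintro s t ⟨n, hn⟩ ⟨m, hm⟩
    refine ⟨max n m, fun u hu h0 => ?_⟩
    rcases hu with hu | hu
    · exact (hn u hu h0).mono (le_max_left _ _)
    · exact (hm u hu h0).mono (le_max_right _ _)
  · intro t ht
    obtain ⟨n, hn⟩ := h ht
    exact ⟨_, mem_nhdsWithin_of_mem_nhds hn, n, fun s hs => hs⟩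

lemma kh_uniform (lw lx lv : ℝ) (hlw : 0 < lw) (hlx : 0 < lx) (hlv : 0 < lv)
    (φ : ℝ → ℝ) (hφc : Continuous φ) (φM : ℝ) (hφM : 0 < φM) (hφ : ∀ r, 0 ≤ φ r ∧ φ r ≤ φM)
    (μ : ℝ → Measure (Phase d)) (hsol : IsMVSol lw lx lv φ (Set.Ici 0) μ)
    (hprob : ∀ t ∈ Set.Ici (0:ℝ), IsProbabilityMeasure (μ t))
    (hcpt : ∀ t ∈ Set.Ici (0:ℝ), MeasureCompactSupport (μ t)) (T : ℝ) :
    ∃ N : ℝ, ∀ t ∈ Icc 0 T, ∀ᵐ z ∂(μ t), ‖z‖ ≤ N := by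
  set K := khC lw lx lv φM with hK
  have hK0 : 0 ≤ K := by rw [hK]; unfold khC; positivity
  -- propagation
  have prop : ∀ a b N n s t : ℝ, 0 ≤ a → a < b → (∀ u ∈ Icc a b, khBd μ u N) → 0 ≤ n →
      s ∈ Icc a b → t ∈ Icc a b → khBd μ s n → khBd μ t (n * Real.exp (K * (b - a))) := by
    intro a b N n s t ha hab hN hn hs ht hsn
    have h1 : khBd μ t _ := kh_prop lw lx lv hlw hlx hlv φ hφc φM hφM hφ a b ha hab μ hsol hprob
      (N + 1) (fun u hu => (hN u hu).norm) n hn s hs hsn t ht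
    refine h1.mono ?_
    gcongr
    rw [abs_le]
    constructor <;> linarith [hs.1, hs.2, ht.1, ht.2]
  -- bridges
  have bridge1 : ∀ a b n : ℝ, 0 ≤ a → a < b → Ioc a b ⊆ khU μ → 0 ≤ n → khBd μ a n →
      khBd μ b (n * Real.exp (K * (b - a))) := by
    intro a b n ha hab hU hn han
    obtain ⟨m, hm⟩ := khBd_of_cpt (hcpt b (ha.trans hab.le))
    have hall : ∀ u ∈ Icc a b, khBd μ u (max n (m * Real.exp (K * (b - a)))) := by
      intro u hu
      rcases eq_or_lt_of_le hu.1 with h | h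
      · rw [← h]; exact han.mono (le_max_left _ _)
      have h1 : (m:ℝ) * Real.exp (K * (b - u)) ≤ m * Real.exp (K * (b - a)) := by
        gcongr
      refine khBd.mono ?_ (h1.trans (le_max_right _ _))
      rcases eq_or_lt_of_le hu.2 with h' | h'
      · rw [h']; simpa using hm
      · obtain ⟨N, hN⟩ := khU_bdd μ u b (fun v hv => hU ⟨h.trans_le hv.1, hv.2⟩)
        have hu0 : 0 ≤ u := ha.trans hu.1
        exact prop u b N m b u hu0 h' (fun v hv => hN v hv (hu0.trans hv.1)) m.cast_nonneg
          ⟨h'.le, le_rfl⟩ ⟨le_rfl, h'.le⟩ hm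
    exact prop a b _ n a b ha hab hall hn ⟨le_rfl, hab.le⟩ ⟨hab.le, le_rfl⟩ han
  have bridge2 : ∀ a b n : ℝ, 0 ≤ a → a < b → Ico a b ⊆ khU μ → 0 ≤ n → khBd μ b n →
      khBd μ a (n * Real.exp (K * (b - a))) := by
    intro a b n ha hab hU hn han
    obtain ⟨m, hm⟩ := khBd_of_cpt (hcpt a ha)
    have hall : ∀ u ∈ Icc a b, khBd μ u (max n (m * Real.exp (K * (b - a)))) := by
      intro u hu
      rcases eq_or_lt_of_le hu.2 with h | h
      · rw [h]; exact han.mono (le_max_left _ _)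
      have h1 : (m:ℝ) * Real.exp (K * (u - a)) ≤ m * Real.exp (K * (b - a)) := by
        gcongr
      refine khBd.mono ?_ (h1.trans (le_max_right _ _))
      rcases eq_or_lt_of_le hu.1 with h' | h'
      · rw [← h']; simpa using hm
      · obtain ⟨N, hN⟩ := khU_bdd μ a u (fun v hv => hU ⟨hv.1, hv.2.trans_lt h⟩)
        exact prop a u N m a u ha h' (fun v hv => hN v hv (ha.trans hv.1)) m.cast_nonneg
          ⟨le_rfl, h'.le⟩ ⟨h'.le, le_rfl⟩ hm
    exact prop a b _ n b a ha hab hall hn ⟨hab.le, le_rfl⟩ ⟨le_rfl, hab.le⟩ han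
  -- Baire
  have hF : Ici (0:ℝ) ⊆ khU μ := by
    by_contra hne
    set F : Set ℝ := Ici (0:ℝ) \ khU μ with hFdef
    have hFc : IsClosed F := isClosed_Ici.sdiff (khU_open μ)
    have hFne : F.Nonempty := by
      obtain ⟨x, hx, hx'⟩ := Set.not_subset.1 hne
      exact ⟨x, hx, hx'⟩
    have : Nonempty F := hFne.to_subtype
    have : CompleteSpace F := hFc.completeSpace_coe
    obtain ⟨n, ⟨t₀, ht₀F⟩, hint⟩ := nonempty_interior_of_iUnion_of_closed
      (f := fun n : ℕ => {t : F | (t : ℝ) ∈ {t : ℝ | t ∈ Ici (0:ℝ) ∧ khBd μ t n}})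
      (fun n => (khBd_closed μ hsol.2.1 hprob hcpt n).preimage continuous_subtype_val)
      (by
        rw [Set.eq_univ_iff_forall]
        intro t
        obtain ⟨m, hm⟩ := khBd_of_cpt (hcpt t t.2.1)
        exact Set.mem_iUnion.2 ⟨m, t.2.1, hm⟩)
    rw [mem_interior_iff_mem_nhds, Metric.mem_nhds_iff] at hint
    obtain ⟨δ, hδ, hball⟩ := hint
    have hnear : ∀ s ∈ F, |s - t₀| < δ → khBd μ s n := by
      intro s hs hsd
      have hmem : (⟨s, hs⟩ : F) ∈ Metric.ball (⟨t₀, ht₀F⟩ : F) δ := by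
        simpa [Real.dist_eq, Subtype.dist_eq] using hsd
      exact (hball hmem).2
    apply ht₀F.2
    refine ⟨n * Real.exp (K * δ), ?_⟩
    filter_upwards [Metric.ball_mem_nhds t₀ hδ] with s hs hs0
    rw [Metric.mem_ball, Real.dist_eq] at hs
    have hn0 : (0:ℝ) ≤ n := n.cast_nonneg
    by_cases hsF : s ∈ F
    · refine (hnear s hsF hs).mono ?_
      have : 1 ≤ Real.exp (K * δ) := Real.one_le_exp (by positivity)
      nlinarith
    rw [abs_lt] at hs
    rcases lt_trichotomy s t₀ with h | h | h
    · have hcomp : IsCompact (F ∩ Icc s t₀) := isCompact_Icc.inter_left hFc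
      obtain ⟨b, ⟨hbF, hb⟩, hbl⟩ := hcomp.exists_isLeast ⟨t₀, ht₀F, h.le, le_rfl⟩
      have hsb : s < b := lt_of_le_of_ne hb.1 (fun e => hsF (e ▸ hbF))
      refine (bridge2 s b n hs0 hsb ?_ hn0 (hnear b hbF ?_)).mono ?_
      · intro u hu
        by_contra hnu
        exact absurd (hbl ⟨⟨le_trans (mem_Ici.1 hs0) hu.1, hnu⟩, hu.1, hu.2.le.trans hb.2⟩)
          (not_le.2 hu.2)
      · rw [abs_lt]; constructor <;> linarith [hb.2]
      · gcongr
        linarith [hb.2]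
    · exact absurd (h ▸ ht₀F) hsF
    · have hcomp : IsCompact (F ∩ Icc t₀ s) := isCompact_Icc.inter_left hFc
      obtain ⟨a, ⟨haF, ha⟩, hal⟩ := hcomp.exists_isGreatest ⟨t₀, ht₀F, le_rfl, h.le⟩
      have hsb : a < s := lt_of_le_of_ne ha.2 (fun e => hsF (e ▸ haF))
      refine (bridge1 a s n haF.1 hsb ?_ hn0 (hnear a haF ?_)).mono ?_
      · intro u hu
        by_contra hnu
        exact absurd (hal ⟨⟨le_trans (mem_Ici.1 haF.1) hu.1.le, hnu⟩, ha.1.trans hu.1.le, hu.2⟩)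
          (not_le.2 hu.1)
      · rw [abs_lt]; constructor <;> linarith [ha.1]
      · gcongr
        linarith [ha.1]
  obtain ⟨N, hN⟩ := khU_bdd μ 0 T (fun t ht => hF ht.1)
  exact ⟨N + 1, fun t ht => (hN t ht ht.1).norm⟩

end helpers

section helpers2
open Topology
variable {d : ℕ}

lemma kh_param (k : Phase d × Phase d → ℝ) (hk : ContDiff ℝ 1 k) (ν : Measure (Phase d))
    [IsProbabilityMeasure ν] (N : ℝ) (hN : ∀ᵐ z ∂ν, ‖z‖ ≤ N) :
    ContDiff ℝ 1 (fun z => ∫ w, k (z, w) ∂ν) ∧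
    ∀ z u, fderiv ℝ (fun z => ∫ w, k (z, w) ∂ν) z u = ∫ w, fderiv ℝ k (z, w) (u, 0) ∂ν := by
  have hfk := hk.continuous_fderiv (by norm_num)
  let k' : Phase d → Phase d → (Phase d →L[ℝ] ℝ) := fun z w =>
    (fderiv ℝ k (z, w)).comp (ContinuousLinearMap.inl ℝ (Phase d) (Phase d))
  have hk'c : Continuous k'.uncurry := by
    have h1 : Continuous (fun p : Phase d × Phase d => fderiv ℝ k p) := hfk
    exact h1.clm_comp continuous_const
  have hk'z : ∀ z, Continuous (k' z) := fun z =>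
    hk'c.comp (continuous_const.prodMk continuous_id : Continuous fun w : Phase d => (z, w))
  have hkz : ∀ z, Continuous (fun w => k (z, w)) := fun z =>
    hk.continuous.comp (continuous_const.prodMk continuous_id : Continuous fun w : Phase d => (z, w))
  have hd : ∀ z, HasFDerivAt (fun z => ∫ w, k (z, w) ∂ν) (∫ w, k' z w ∂ν) z := by
    intro z
    obtain ⟨C, hC⟩ := ((isCompact_closedBall z 1).prod
      (isCompact_closedBall (0 : Phase d) N)).exists_bound_of_continuousOn hk'c.continuousOn
    refine hasFDerivAt_integral_of_dominated_of_fderiv_le (s := Metric.closedBall z 1)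
      (bound := fun _ => C) (F' := k') (Metric.closedBall_mem_nhds z one_pos)
      (Eventually.of_forall fun x => (hkz x).aestronglyMeasurable)
      (kh_integrable ν N hN _ (hkz z)) (hk'z z).aestronglyMeasurable ?_ (integrable_const _) ?_
    · filter_upwards [hN] with w hw x hx
      exact hC (x, w) ⟨hx, by simpa using hw⟩
    · refine Eventually.of_forall fun w x _ => ?_
      exact ((hk.differentiable (by norm_num) (x, w)).hasFDerivAt).comp x
        (hasFDerivAt_prodMk_left x w)
  have hc : Continuous (fun z => ∫ w, k' z w ∂ν) := by
    have h1 := continuous_parametric_integral_of_continuous (μ := ν) hk'c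
      (isCompact_closedBall (0 : Phase d) N)
    have h2 : ν.restrict (Metric.closedBall (0 : Phase d) N) = ν := by
      apply Measure.restrict_eq_self_of_ae_mem
      filter_upwards [hN] with w hw
      simpa using hw
    rwa [h2] at h1
  refine ⟨contDiff_one_iff_hasFDerivAt.2 ⟨_, hc, hd⟩, fun z u => ?_⟩
  rw [(hd z).fderiv, ContinuousLinearMap.integral_apply (kh_integrable ν N hN _ (hk'z z))]
  simp [k']

lemma kh_diag (S : Set ℝ) (hS : Convex ℝ S) (D E : ℝ → ℝ → ℝ)
    (hsymm : ∀ s ∈ S, ∀ t ∈ S, D s t = D t s)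
    (hD : ∀ s ∈ S, ∀ t ∈ S, HasDerivWithinAt (D s) (E s t) S t)
    (hE : Continuous (fun p : S × S => E p.1 p.2)) (t₀ : ℝ) (ht₀ : t₀ ∈ S) :
    HasDerivWithinAt (fun t => D t t) (2 * E t₀ t₀) S t₀ := by
  rw [hasDerivWithinAt_iff_isLittleO, Asymptotics.isLittleO_iff]
  intro c hc
  have h1 := Metric.continuousAt_iff.1 (hE.continuousAt (x := (⟨t₀, ht₀⟩, ⟨t₀, ht₀⟩)))
    (c / 2) (by positivity)
  obtain ⟨δ, hδ, h1⟩ := h1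
  have h2 : ∀ s ∈ S, ∀ t ∈ S, |s - t₀| < δ → |t - t₀| < δ → ‖E s t - E t₀ t₀‖ ≤ c / 2 := by
    intro s hs t ht h3 h4
    have := @h1 (⟨s, hs⟩, ⟨t, ht⟩) (by
      rw [Prod.dist_eq]
      exact max_lt h3 h4)
    exact this.le
  filter_upwards [mem_nhdsWithin_of_mem_nhds (Metric.ball_mem_nhds t₀ hδ), self_mem_nhdsWithin]
    with t ht htS
  have key : ∀ s ∈ S, |s - t₀| < δ → ‖(D s t - t * E t₀ t₀) - (D s t₀ - t₀ * E t₀ t₀)‖ ≤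
      c / 2 * ‖t - t₀‖ := by
    intro s hs hsd
    refine Convex.norm_image_sub_le_of_norm_hasDerivWithin_le
      (f := fun u => D s u - u * E t₀ t₀) (f' := fun u => E s u - E t₀ t₀)
      (s := S ∩ Metric.ball t₀ δ) ?_ ?_ (hS.inter (convex_ball _ _))
      ⟨ht₀, Metric.mem_ball_self hδ⟩ ⟨htS, ht⟩
    · intro u hu
      have := ((hasDerivAt_id u).mul_const (E t₀ t₀)).hasDerivWithinAt
        (s := S ∩ Metric.ball t₀ δ)
      have := ((hD s hs u hu.1).mono inter_subset_left).sub this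
      rw [one_mul] at this
      exact this
    · intro u hu
      exact h2 s hs u hu.1 hsd hu.2
  have k1 := key t htS ht
  have k2 := key t₀ ht₀ (by simpa using hδ)
  have e : D t t - D t₀ t₀ - (t - t₀) • (2 * E t₀ t₀) =
      ((D t t - t * E t₀ t₀) - (D t t₀ - t₀ * E t₀ t₀)) +
      ((D t₀ t - t * E t₀ t₀) - (D t₀ t₀ - t₀ * E t₀ t₀)) := by
    rw [hsymm t₀ ht₀ t htS, smul_eq_mul]; ring
  rw [e]
  refine (norm_add_le _ _).trans ?_
  linarith

/-- primitive -/
def khF (φ : ℝ → ℝ) (q : ℝ) : ℝ := (1 / 2) * ∫ s in (0:ℝ)..q, φ (Real.sqrt s)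

lemma khF_deriv (φ : ℝ → ℝ) (hφ : Continuous φ) (q : ℝ) :
    HasDerivAt (khF φ) (1 / 2 * φ (Real.sqrt q)) q := by
  have hc : Continuous (fun s => φ (Real.sqrt s)) := hφ.comp Real.continuous_sqrt
  exact (intervalIntegral.integral_hasDerivAt_right (hc.intervalIntegrable _ _)
      (hc.stronglyMeasurableAtFilter _ _) hc.continuousAt).const_mul _

lemma khF_contDiff (φ : ℝ → ℝ) (hφ : Continuous φ) : ContDiff ℝ 1 (khF φ) := by
  rw [contDiff_one_iff_deriv]
  refine ⟨fun q => (khF_deriv φ hφ q).differentiableAt, ?_⟩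
  have : deriv (khF φ) = fun q => 1 / 2 * φ (Real.sqrt q) := funext fun q => (khF_deriv φ hφ q).deriv
  rw [this]
  have hc : Continuous (fun s => φ (Real.sqrt s)) := hφ.comp Real.continuous_sqrt
  exact continuous_const.mul hc

def khk (φ : ℝ → ℝ) (p : Phase d × Phase d) : ℝ := Phifun φ ‖p.1.1 - p.2.1‖

lemma khk_contDiff (φ : ℝ → ℝ) (hφ : Continuous φ) : ContDiff ℝ 1 (khk (d := d) φ) := by
  have h1 : ContDiff ℝ 1 (fun p : Phase d × Phase d => p.1.1 - p.2.1) := by fun_prop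
  exact (khF_contDiff φ hφ).comp (h1.norm_sq ℝ)

lemma khk_fderiv (φ : ℝ → ℝ) (hφ : Continuous φ) (p : Phase d × Phase d) (u : Phase d) :
    fderiv ℝ (khk (d := d) φ) p (u, 0) = φ ‖p.1.1 - p.2.1‖ * ⟪p.1.1 - p.2.1, u.1⟫ := by
  have h1 : HasFDerivAt (fun p : Phase d × Phase d => p.1.1 - p.2.1)
      ((ContinuousLinearMap.fst ℝ (Euc d) (Euc d)).comp
        (ContinuousLinearMap.fst ℝ (Phase d) (Phase d)) -
      (ContinuousLinearMap.fst ℝ (Euc d) (Euc d)).comp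
        (ContinuousLinearMap.snd ℝ (Phase d) (Phase d))) p :=
    ContinuousLinearMap.hasFDerivAt
      ((ContinuousLinearMap.fst ℝ (Euc d) (Euc d)).comp
        (ContinuousLinearMap.fst ℝ (Phase d) (Phase d)) -
      (ContinuousLinearMap.fst ℝ (Euc d) (Euc d)).comp
        (ContinuousLinearMap.snd ℝ (Phase d) (Phase d)))
  have h2 := (khF_deriv φ hφ (‖p.1.1 - p.2.1‖ ^ 2)).comp_hasFDerivAt p h1.norm_sq
  have h3 : HasFDerivAt (khk (d := d) φ) _ p := h2
  rw [h3.fderiv, Real.sqrt_sq (norm_nonneg _)]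
  simp [inner_sub_left]
  ring

lemma kh_sym (ν : Measure (Phase d)) [IsProbabilityMeasure ν] (N : ℝ) (hN : ∀ᵐ z ∂ν, ‖z‖ ≤ N)
    (k : Phase d × Phase d → ℝ) (hk : Continuous k) :
    2 * ∫ z, (∫ w, k (z, w) ∂ν) ∂ν = ∫ z, (∫ w, (k (z, w) + k (w, z)) ∂ν) ∂ν := by
  have hN2 := kh_ae_prod ν ν N hN hN
  have i1 := kh_integrable (ν.prod ν) N hN2 k hk
  have i2 := kh_integrable (ν.prod ν) N hN2 (fun p => k p.swap) (hk.comp continuous_swap)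
  have e1 := integral_prod k i1
  have e2 := integral_prod _ i2
  have e3 := integral_prod _ (i1.add i2)
  rw [integral_add' i1 i2, integral_prod_swap] at e3
  simp only [Pi.add_apply, Prod.swap_prod_mk] at e3
  rw [← e3, e1]
  ring

lemma kh_center (ν : Measure (Phase d)) [IsProbabilityMeasure ν] (N : ℝ) (hN : ∀ᵐ z ∂ν, ‖z‖ ≤ N)
    (a b : Phase d → Euc d) (ha : Continuous a) (hb : Continuous b)
    (ha0 : ∫ z, a z ∂ν = 0) (hb0 : ∫ z, b z ∂ν = 0) :
    ∫ z, (∫ w, ⟪a z - a w, b z - b w⟫ ∂ν) ∂ν = 2 * ∫ z, ⟪a z, b z⟫ ∂ν := by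
  have ia := kh_integrable ν N hN a ha
  have ib := kh_integrable ν N hN b hb
  have iab := kh_integrable ν N hN (fun z => ⟪a z, b z⟫) (by fun_prop)
  have h1 : ∀ z, ∫ w, ⟪a z - a w, b z - b w⟫ ∂ν = ⟪a z, b z⟫ + ∫ w, ⟪a w, b w⟫ ∂ν := by
    intro z
    have e1 : ∫ w, ⟪a z, b w⟫ ∂ν = 0 := by rw [integral_inner ib, hb0, inner_zero_right]
    have e2 : ∫ w, ⟪a w, b z⟫ ∂ν = 0 := by
      simp_rw [fun w => real_inner_comm (b z) (a w)]
      rw [integral_inner ia, ha0, inner_zero_right]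
    have j1 := kh_integrable ν N hN (fun w => ⟪a z, b w⟫) (by fun_prop)
    have j2 := kh_integrable ν N hN (fun w => ⟪a w, b z⟫) (by fun_prop)
    have e3 : ∀ w, ⟪a z - a w, b z - b w⟫ =
        (⟪a z, b z⟫ + ⟪a w, b w⟫) - (⟪a z, b w⟫ + ⟪a w, b z⟫) := by
      intro w
      simp only [inner_sub_left, inner_sub_right]; ring
    simp_rw [e3]
    have i3 : Integrable (fun w => ⟪a z, b z⟫ + ⟪a w, b w⟫) ν := (integrable_const _).add iab
    have i4 : Integrable (fun w => ⟪a z, b w⟫ + ⟪a w, b z⟫) ν := j1.add j2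
    rw [integral_sub i3 i4, integral_add (integrable_const _) iab,
      integral_add j1 j2, e1, e2]
    simp
  simp_rw [h1]
  rw [integral_add iab (integrable_const _)]
  simp
  ring

lemma kh_lin (ν : Measure (Phase d)) [IsProbabilityMeasure ν] (N : ℝ) (hN : ∀ᵐ z ∂ν, ‖z‖ ≤ N)
    (k₁ k₂ k₃ k₄ : Phase d × Phase d → ℝ) (h₁ : Continuous k₁) (h₂ : Continuous k₂)
    (h₃ : Continuous k₃) (h₄ : Continuous k₄) (a b c e : ℝ) :
    ∫ z, (∫ w, (a * k₁ (z, w) + b * k₂ (z, w) + c * k₃ (z, w) + e * k₄ (z, w)) ∂ν) ∂ν =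
      a * (∫ z, (∫ w, k₁ (z, w) ∂ν) ∂ν) + b * (∫ z, (∫ w, k₂ (z, w) ∂ν) ∂ν)
      + c * (∫ z, (∫ w, k₃ (z, w) ∂ν) ∂ν) + e * (∫ z, (∫ w, k₄ (z, w) ∂ν) ∂ν) := by
  have hN2 := kh_ae_prod ν ν N hN hN
  have I : ∀ k : Phase d × Phase d → ℝ, Continuous k → Integrable k (ν.prod ν) := fun k hk =>
    kh_integrable (ν.prod ν) N hN2 k hk
  have P : ∀ k : Phase d × Phase d → ℝ, Continuous k →
      ∫ z, (∫ w, k (z, w) ∂ν) ∂ν = ∫ p, k p ∂(ν.prod ν) := fun k hk =>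
    (integral_prod k (I k hk)).symm
  rw [P k₁ h₁, P k₂ h₂, P k₃ h₃, P k₄ h₄,
    P (fun p => a * k₁ p + b * k₂ p + c * k₃ p + e * k₄ p) (by fun_prop),
    integral_add (I (fun p => a * k₁ p + b * k₂ p + c * k₃ p) (by fun_prop))
      (I (fun p => e * k₄ p) (by fun_prop)),
    integral_add (I (fun p => a * k₁ p + b * k₂ p) (by fun_prop))
      (I (fun p => c * k₃ p) (by fun_prop)),
    integral_add (I (fun p => a * k₁ p) (by fun_prop)) (I (fun p => b * k₂ p) (by fun_prop))]
  simp only [integral_const_mul]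

lemma khL_X (lw lx lv : ℝ) (φ : ℝ → ℝ) (p : Phase d × Phase d) :
    khL lw lx lv φ (fun z : Phase d => ‖z.1‖ ^ 2) p = 2 * ⟪p.1.1, p.1.2⟫ := by
  have h : HasFDerivAt (fun z : Phase d => ‖z.1‖ ^ 2) _ p.1 :=
    (hasFDerivAt_fst (𝕜 := ℝ) (E := Euc d) (F := Euc d) (p := p.1)).norm_sq
  unfold khL
  rw [h.fderiv]
  simp

lemma khL_V (lw lx lv : ℝ) (φ : ℝ → ℝ) (p : Phase d × Phase d) :
    khL lw lx lv φ (fun z : Phase d => ‖z.2‖ ^ 2) p = 2 * ⟪p.1.2, khq lw lx lv φ p.1 p.2⟫ := by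
  have h : HasFDerivAt (fun z : Phase d => ‖z.2‖ ^ 2) _ p.1 :=
    (hasFDerivAt_snd (𝕜 := ℝ) (E := Euc d) (F := Euc d) (p := p.1)).norm_sq
  unfold khL
  rw [h.fderiv]
  simp

lemma khL_C (lw lx lv : ℝ) (φ : ℝ → ℝ) (p : Phase d × Phase d) :
    khL lw lx lv φ (fun z : Phase d => ⟪z.1, z.2⟫) p =
      ‖p.1.2‖ ^ 2 + ⟪p.1.1, khq lw lx lv φ p.1 p.2⟫ := by
  have h := (hasFDerivAt_fst (𝕜 := ℝ) (E := Euc d) (F := Euc d) (p := p.1)).inner ℝ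
    (hasFDerivAt_snd (𝕜 := ℝ) (E := Euc d) (F := Euc d) (p := p.1))
  unfold khL
  rw [h.fderiv]
  simp
  ring

lemma kh_symV (lw lx lv : ℝ) (φ : ℝ → ℝ) (z w : Phase d) :
    2 * ⟪z.2, khq lw lx lv φ z w⟫ + 2 * ⟪w.2, khq lw lx lv φ w z⟫ =
    (-2 * lw) * ⟪z.1 - w.1, z.2 - w.2⟫ + (-2 * lx) * (φ ‖z.1 - w.1‖ * ⟪z.1 - w.1, z.2 - w.2⟫)
      + (-2 * lv) * (φ ‖z.1 - w.1‖ * ‖z.2 - w.2‖ ^ 2) + 0 * 0 := by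
  unfold khq
  rw [norm_sub_rev w.1 z.1, ← real_inner_self_eq_norm_sq (z.2 - w.2)]
  simp only [inner_add_right, inner_smul_right, inner_sub_right, inner_sub_left]
  rw [real_inner_comm z.1 z.2, real_inner_comm w.1 z.2, real_inner_comm z.1 w.2,
    real_inner_comm w.1 w.2, real_inner_comm w.2 z.2]
  ring

lemma kh_symC (lw lx lv : ℝ) (φ : ℝ → ℝ) (z w : Phase d) :
    (‖z.2‖ ^ 2 + ⟪z.1, khq lw lx lv φ z w⟫) + (‖w.2‖ ^ 2 + ⟪w.1, khq lw lx lv φ w z⟫) =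
    1 * ((‖z.2‖ ^ 2 + ‖w.2‖ ^ 2)) + (-lw) * ⟪z.1 - w.1, z.1 - w.1⟫
      + (-lx) * (φ ‖z.1 - w.1‖ * ‖z.1 - w.1‖ ^ 2)
      + (-lv) * (φ ‖z.1 - w.1‖ * ⟪z.1 - w.1, z.2 - w.2⟫) := by
  unfold khq
  rw [norm_sub_rev w.1 z.1, ← real_inner_self_eq_norm_sq (z.1 - w.1)]
  simp only [inner_add_right, inner_smul_right, inner_sub_right, inner_sub_left]
  rw [real_inner_comm w.1 z.1]
  ring

lemma kh_main (lw lx lv : ℝ) (φ : ℝ → ℝ) (hφ : Continuous φ) (T : ℝ) (hT : 0 < T)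
    (μ : ℝ → Measure (Phase d)) (hsol : IsMVSol lw lx lv φ (Set.Ici 0) μ)
    (hprob : ∀ t ∈ Set.Ici (0:ℝ), IsProbabilityMeasure (μ t)) (N : ℝ)
    (hN : ∀ t ∈ Icc 0 T, ∀ᵐ z ∂(μ t), ‖z‖ ≤ N)
    (hcent : ∀ t ∈ Set.Ici (0:ℝ), (∫ z, z.1 ∂(μ t)) = 0 ∧ (∫ z, z.2 ∂(μ t)) = 0)
    (t : ℝ) (ht : t ∈ Icc 0 T) :
      HasDerivWithinAt (Xfun μ) (2 * Cfun μ t) (Icc 0 T) t ∧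
      HasDerivWithinAt (Vfun μ)
        (-2 * lw * Cfun μ t - lx * Cphi φ μ t - lv * Vphi φ μ t) (Icc 0 T) t ∧
      HasDerivWithinAt (Cfun μ)
        (Vfun μ t - lw * Xfun μ t - lx / 2 * Xphi φ μ t - lv / 2 * Cphi φ μ t)
        (Icc 0 T) t := by
  have := hprob t ht.1
  have hNt := hN t ht
  obtain ⟨c1, c2⟩ := hcent t ht.1
  have W := fun h hh => kh_weak_deriv' lw lx lv φ hφ 0 T le_rfl hT μ hsol hprob N hN h hh t ht
  have hq := khq_cont (d := d) lw lx lv φ hφ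
  refine ⟨?_, ?_, ?_⟩
  · have w := W (fun z => ‖z.1‖ ^ 2) (contDiff_fst.norm_sq ℝ)
    simp only [khL_X] at w
    refine w.congr_deriv ?_
    simp [Cfun, integral_const_mul]
  · have w := W (fun z => ‖z.2‖ ^ 2) (contDiff_snd.norm_sq ℝ)
    simp only [khL_V] at w
    refine w.congr_deriv ?_
    have e := kh_sym (μ t) N hNt (fun p => 2 * ⟪p.1.2, khq lw lx lv φ p.1 p.2⟫) (by fun_prop)
    simp only [kh_symV] at e
    have l := kh_lin (μ t) N hNt (fun p => ⟪p.1.1 - p.2.1, p.1.2 - p.2.2⟫)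
      (fun p => φ ‖p.1.1 - p.2.1‖ * ⟪p.1.1 - p.2.1, p.1.2 - p.2.2⟫)
      (fun p => φ ‖p.1.1 - p.2.1‖ * ‖p.1.2 - p.2.2‖ ^ 2) (fun _ => 0)
      (by fun_prop) (by fun_prop) (by fun_prop) (by fun_prop) (-2 * lw) (-2 * lx) (-2 * lv) 0
    have c := kh_center (μ t) N hNt (fun z => z.1) (fun z => z.2) (by fun_prop) (by fun_prop) c1 c2
    simp only at l c
    rw [c] at l
    rw [l] at e
    unfold Cfun Cphi Vphi
    linarith
  · have w := W (fun z => ⟪z.1, z.2⟫) (contDiff_fst.inner ℝ contDiff_snd)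
    simp only [khL_C] at w
    refine w.congr_deriv ?_
    have e := kh_sym (μ t) N hNt (fun p => ‖p.1.2‖ ^ 2 + ⟪p.1.1, khq lw lx lv φ p.1 p.2⟫)
      (by fun_prop)
    simp only [kh_symC] at e
    have l := kh_lin (μ t) N hNt (fun p => ‖p.1.2‖ ^ 2 + ‖p.2.2‖ ^ 2)
      (fun p => ⟪p.1.1 - p.2.1, p.1.1 - p.2.1⟫)
      (fun p => φ ‖p.1.1 - p.2.1‖ * ‖p.1.1 - p.2.1‖ ^ 2)
      (fun p => φ ‖p.1.1 - p.2.1‖ * ⟪p.1.1 - p.2.1, p.1.2 - p.2.2⟫)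
      (by fun_prop) (by fun_prop) (by fun_prop) (by fun_prop) 1 (-lw) (-lx) (-lv)
    have c := kh_center (μ t) N hNt (fun z => z.1) (fun z => z.1) (by fun_prop) (by fun_prop) c1 c1
    have v := kh_sym (μ t) N hNt (fun p => ‖p.1.2‖ ^ 2) (by fun_prop)
    simp only at l c v
    simp only [integral_const, probReal_univ, one_smul] at v
    rw [c, ← v] at l
    rw [l] at e
    simp only [real_inner_self_eq_norm_sq] at e
    unfold Cphi Vfun Xphi Xfun
    linarith

lemma kh_M (lw lx lv : ℝ) (φ : ℝ → ℝ) (hφ : Continuous φ) (T : ℝ) (hT : 0 < T)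
    (μ : ℝ → Measure (Phase d)) (hsol : IsMVSol lw lx lv φ (Set.Ici 0) μ)
    (hprob : ∀ t ∈ Set.Ici (0:ℝ), IsProbabilityMeasure (μ t)) (N : ℝ)
    (hN : ∀ t ∈ Icc 0 T, ∀ᵐ z ∂(μ t), ‖z‖ ≤ N)
    (t : ℝ) (ht : t ∈ Icc 0 T) :
    HasDerivWithinAt (Mfun φ μ) (Cphi φ μ t) (Icc 0 T) t := by
  have hS : Icc 0 T ⊆ Ici (0:ℝ) := fun t ht => ht.1
  have hkc : Continuous (fun p : Phase d × Phase d => φ ‖p.1.1 - p.2.1‖ * ⟪p.1.1 - p.2.1, p.1.2⟫) :=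
    by fun_prop
  have key := kh_diag (Icc 0 T) (convex_Icc 0 T)
    (fun s t => ∫ z, (∫ w, khk φ (z, w) ∂(μ s)) ∂(μ t))
    (fun s t => ∫ z, (∫ w, φ ‖z.1 - w.1‖ * ⟪z.1 - w.1, z.2⟫ ∂(μ s)) ∂(μ t)) ?_ ?_ ?_ t ht
  · have := hprob t ht.1
    have e := kh_sym (μ t) N (hN t ht) _ hkc
    have e2 : ∀ z w : Phase d, φ ‖z.1 - w.1‖ * ⟪z.1 - w.1, z.2⟫ + φ ‖w.1 - z.1‖ * ⟪w.1 - z.1, w.2⟫ =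
        φ ‖z.1 - w.1‖ * ⟪z.1 - w.1, z.2 - w.2⟫ := by
      intro z w
      rw [norm_sub_rev w.1 z.1]
      simp only [inner_sub_left, inner_sub_right]
      ring
    simp only [e2] at e
    rw [e] at key
    exact key
  · intro s hs u hu
    have := hprob s hs.1
    have := hprob u hu.1
    have i := kh_integrable ((μ u).prod (μ s)) N (kh_ae_prod _ _ N (hN u hu) (hN s hs))
      (khk φ) (khk_contDiff φ hφ).continuous
    have := integral_integral_swap (f := fun z w => khk φ (z, w)) i
    refine this.trans ?_
    have e : ∀ z w : Phase d, khk φ (z, w) = khk φ (w, z) := by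
      intro z w
      simp only [khk]
      rw [norm_sub_rev]
    refine integral_congr_ae (Eventually.of_forall fun z => ?_)
    exact integral_congr_ae (Eventually.of_forall fun w => e _ _)
  · intro s hs u hu
    have := hprob s hs.1
    have := hprob u hu.1
    obtain ⟨hc, hf⟩ := kh_param (khk φ) (khk_contDiff φ hφ) (μ s) N (hN s hs)
    have W := kh_weak_deriv' lw lx lv φ hφ 0 T le_rfl hT μ hsol hprob N hN _ hc u hu
    unfold khL at W
    simp only [hf, khk_fderiv φ hφ] at W
    simpa using W
  · exact (kh_cont2 (Icc 0 T) hS μ hsol.2.1 hprob N hN _ hkc).comp continuous_swap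

end helpers2

/-- derivative identities for the functionals `X`, `V`, `M`, `C(X,V)`
along a centered compactly supported measure-valued probability solution. -/
theorem kinetic_herding_functional_derivatives
    {d : ℕ} (hd : 1 ≤ d) (lw lx lv : ℝ) (hlw : 0 < lw) (hlx : 0 < lx) (hlv : 0 < lv)
    (φ : ℝ → ℝ) (Kφ : NNReal) (hLip : LipschitzWith Kφ φ)
    (φM : ℝ) (hφM : 0 < φM) (hφ : ∀ r, 0 ≤ φ r ∧ φ r ≤ φM)
    (μ : ℝ → Measure (Phase d))
    (hsol : IsMVSol lw lx lv φ (Set.Ici 0) μ)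
    (hprob : ∀ t ∈ Set.Ici (0:ℝ), IsProbabilityMeasure (μ t))
    (hcpt : ∀ t ∈ Set.Ici (0:ℝ), MeasureCompactSupport (μ t))
    (hcent : ∀ t ∈ Set.Ici (0:ℝ), (∫ z, z.1 ∂(μ t)) = 0 ∧ (∫ z, z.2 ∂(μ t)) = 0) :
    ∀ t ∈ Set.Ici (0:ℝ),
      HasDerivWithinAt (Xfun μ) (2 * Cfun μ t) (Set.Ici 0) t ∧
      HasDerivWithinAt (Vfun μ)
        (-2 * lw * Cfun μ t - lx * Cphi φ μ t - lv * Vphi φ μ t) (Set.Ici 0) t ∧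
      HasDerivWithinAt (Mfun φ μ) (Cphi φ μ t) (Set.Ici 0) t ∧
      HasDerivWithinAt (Cfun μ)
        (Vfun μ t - lw * Xfun μ t - lx / 2 * Xphi φ μ t - lv / 2 * Cphi φ μ t)
        (Set.Ici 0) t := by
  intro t ht
  have ht0 : (0:ℝ) ≤ t := ht
  obtain ⟨N, hN⟩ := kh_uniform lw lx lv hlw hlx hlv φ hLip.continuous φM hφM hφ μ hsol hprob hcpt
    (t + 1)
  have hT : 0 < t + 1 := by linarith
  have htT : t ∈ Set.Icc 0 (t + 1) := ⟨ht0, by linarith⟩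
  have hmem : Set.Icc 0 (t + 1) ∈ nhdsWithin t (Set.Ici 0) := by
    have : Set.Icc 0 (t + 1) = Set.Ici 0 ∩ Set.Iic (t + 1) := rfl
    rw [this]
    exact inter_mem self_mem_nhdsWithin (mem_nhdsWithin_of_mem_nhds (Iic_mem_nhds (by linarith)))
  obtain ⟨h1, h2, h4⟩ := kh_main lw lx lv φ hLip.continuous (t + 1) hT μ hsol hprob N hN hcent t htT
  have h3 := kh_M lw lx lv φ hLip.continuous (t + 1) hT μ hsol hprob N hN t htT
  exact ⟨h1.mono_of_mem_nhdsWithin hmem, h2.mono_of_mem_nhdsWithin hmem,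
    h3.mono_of_mem_nhdsWithin hmem, h4.mono_of_mem_nhdsWithin hmem⟩
end
end

section
/- (Barbalat's Lemma) Let L : [0,∞) → ℝ be differentiable. If L(t) converges to a finite limit as t → ∞ and the derivative L' is uniformly continuous on [0,∞), then L'(t) → 0 as t → ∞. -/
open Filter Set

/-- Barbalat's Lemma: if a differentiable function `L : [0,∞) → ℝ` has a
finite limit at infinity and its derivative `L'` is uniformly continuous on `[0,∞)`,
then `L'(t) → 0` as `t → ∞`. -/
theorem barbalat (L L' : ℝ → ℝ)
    (hdiff : ∀ t ∈ Set.Ici (0:ℝ), HasDerivWithinAt L (L' t) (Set.Ici 0) t)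
    (hlim : ∃ l : ℝ, Tendsto L atTop (nhds l))
    (hUC : UniformContinuousOn L' (Set.Ici 0)) :
    Tendsto L' atTop (nhds 0) := by
  obtain ⟨l, hl⟩ := hlim
  rw [Metric.tendsto_atTop] at hl ⊢
  rw [Metric.uniformContinuousOn_iff] at hUC
  intro ε hε
  obtain ⟨δ, hδ, hU⟩ := hUC (ε / 2) (by positivity)
  obtain ⟨N, hN⟩ := hl (ε * δ / 8) (by positivity)
  refine ⟨max N 0, fun t ht => ?_⟩
  have htN : N ≤ t := le_trans (le_max_left _ _) ht
  have ht0 : 0 ≤ t := le_trans (le_max_right _ _) ht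
  have hlt : t < t + δ / 2 := by linarith
  obtain ⟨c, hc, hcs⟩ := exists_hasDerivAt_eq_slope L L' hlt
    (fun x hx => ((hdiff x (le_trans ht0 hx.1)).continuousWithinAt).mono
      (fun y hy => le_trans ht0 hy.1))
    (fun x hx => (hdiff x (le_trans ht0 hx.1.le)).hasDerivAt
      (Ici_mem_nhds (lt_of_le_of_lt ht0 hx.1)))
  have h1 := hN t htN
  have h2 := hN (t + δ / 2) (by linarith)
  have h3 := hU t ht0 c (le_trans ht0 hc.1.le) (by
    rw [Real.dist_eq, abs_lt]
    constructor <;> linarith [hc.1, hc.2])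
  have h4 : L' c * (δ / 2) = L (t + δ / 2) - L t := by
    rw [hcs, add_sub_cancel_left, div_mul_cancel₀ _ (by positivity)]
  rw [Real.dist_eq, abs_lt] at h1 h2 h3 ⊢
  have h5 : L' c < ε / 2 := by
    by_contra h
    nlinarith [mul_le_mul_of_nonneg_right (not_lt.mp h) hδ.le]
  have h6 : -(ε / 2) < L' c := by
    by_contra h
    nlinarith [mul_le_mul_of_nonneg_right (not_lt.mp h) hδ.le]
  constructor <;> linarith [h3.1, h3.2]
end

section
/- Let (μ_t)_{t≥0} be a compactly supported measure-valued probability solution of the kinetic herding equation with centered means, and let E(t) = λ_w X(t) + V(t) + λ_x M(t) be the herding energy. Then dE/dt = −λ_v V_φ(t) ≤ 0 for all t ≥ 0; in particular E is nonincreasing and converges to a finite limit E^∞ ≥ 0 as t → ∞. -/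
open MeasureTheory Filter Set RealInnerProductSpace

noncomputable section

namespace Herd

open Topology

/-- carried by a compact set -/
def Cpt {Ω : Type*} [TopologicalSpace Ω] [MeasurableSpace Ω] (ν : Measure Ω) : Prop :=
  ∃ K : Set Ω, IsCompact K ∧ ν Kᶜ = 0

lemma Cpt.integrable {Ω : Type*} [TopologicalSpace Ω] [MeasurableSpace Ω] [T2Space Ω]
    [OpensMeasurableSpace Ω] [SecondCountableTopology Ω]
    {G : Type*} [NormedAddCommGroup G]
    {ν : Measure Ω} [IsFiniteMeasure ν] (h : Cpt ν) {F : Ω → G} (hF : Continuous F) :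
    Integrable F ν := by
  obtain ⟨K, hK, h0⟩ := h
  have h1 : IntegrableOn F K ν := hF.continuousOn.integrableOn_compact' hK hK.isClosed.measurableSet
  have h2 : ν.restrict K = ν := by
    apply Measure.restrict_eq_self_of_ae_mem
    exact h0
  rwa [IntegrableOn, h2] at h1

lemma Cpt.prod {Ω Ω' : Type*} [TopologicalSpace Ω] [MeasurableSpace Ω]
    [TopologicalSpace Ω'] [MeasurableSpace Ω']
    {ν : Measure Ω} {ν' : Measure Ω'} [SFinite ν] [SFinite ν'] (h : Cpt ν) (h' : Cpt ν') :
    Cpt (ν.prod ν') := by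
  obtain ⟨K, hK, h0⟩ := h
  obtain ⟨L, hL, h1⟩ := h'
  refine ⟨K ×ˢ L, hK.prod hL, ?_⟩
  rw [Set.compl_prod_eq_union]
  refine measure_union_null ?_ ?_
  · rw [Measure.prod_prod, h0, zero_mul]
  · rw [Measure.prod_prod, h1, mul_zero]

/-- convergence of unbounded integrands with bounded second moment -/
lemma tendsto_unif {Ω ι : Type*} [TopologicalSpace Ω] [MeasurableSpace Ω] [T2Space Ω]
    [OpensMeasurableSpace Ω] [SecondCountableTopology Ω]
    {l : Filter ι} (ν : ι → ProbabilityMeasure Ω) (ν0 : ProbabilityMeasure Ω)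
    (hν : Tendsto ν l (𝓝 ν0)) (hc : ∀ i, Cpt (ν i : Measure Ω)) (hc0 : Cpt (ν0 : Measure Ω))
    (F : Ω → ℝ) (hF : Continuous F) (B : ℝ)
    (hB : ∀ᶠ i in l, ∫ z, F z ^ 2 ∂(ν i : Measure Ω) ≤ B) (hB0 : ∫ z, F z ^ 2 ∂(ν0 : Measure Ω) ≤ B) :
    Tendsto (fun i => ∫ z, F z ∂(ν i : Measure Ω)) l (𝓝 (∫ z, F z ∂(ν0 : Measure Ω))) := by
  have hBn : 0 ≤ B := le_trans (integral_nonneg fun _ => sq_nonneg _) hB0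
  rw [Metric.tendsto_nhds]
  intro ε hε
  set R : ℝ := 4 * (B + 1) / ε with hR
  have hRp : 0 < R := by positivity
  have key : ∀ ν' : ProbabilityMeasure Ω, Cpt (ν' : Measure Ω) →
      ∫ z, F z ^ 2 ∂(ν' : Measure Ω) ≤ B →
      |∫ z, F z ∂(ν' : Measure Ω) - ∫ z, max (-R) (min R (F z)) ∂(ν' : Measure Ω)| ≤ ε / 4 := by
    intro ν' h1 h2
    rw [← integral_sub (h1.integrable hF) (h1.integrable (by fun_prop))]
    have hpt : ∀ z, |F z - max (-R) (min R (F z))| ≤ F z ^ 2 / R := by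
      intro z
      rw [le_div_iff₀ hRp]
      rcases le_total (F z) R with h | h
      · rw [min_eq_right h]
        rcases le_total (-R) (F z) with h' | h'
        · rw [max_eq_right h']; simp; positivity
        · rw [max_eq_left h', abs_of_nonpos (by linarith)]; nlinarith
      · rw [min_eq_left h, max_eq_right (by linarith), abs_of_nonneg (by linarith)]
        nlinarith
    calc |∫ z, (F z - max (-R) (min R (F z))) ∂(ν' : Measure Ω)|
        ≤ ∫ z, |F z - max (-R) (min R (F z))| ∂(ν' : Measure Ω) := abs_integral_le_integral_abs
      _ ≤ ∫ z, F z ^ 2 / R ∂(ν' : Measure Ω) :=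
          integral_mono (h1.integrable (by fun_prop)) (h1.integrable (by fun_prop)) hpt
      _ = (∫ z, F z ^ 2 ∂(ν' : Measure Ω)) / R := integral_div _ _
      _ ≤ B / R := by gcongr
      _ ≤ ε / 4 := by
          rw [hR, div_div_eq_mul_div, div_le_iff₀ (by positivity)]
          nlinarith
  let G : BoundedContinuousFunction Ω ℝ := BoundedContinuousFunction.ofNormedAddCommGroup
    (fun z => max (-R) (min R (F z))) (by fun_prop) R (by
      intro z
      rw [Real.norm_eq_abs, abs_le]
      exact ⟨le_max_left _ _, max_le (by linarith) (min_le_left _ _)⟩)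
  have h1 := (ProbabilityMeasure.tendsto_iff_forall_integral_tendsto.1 hν) G
  rw [Metric.tendsto_nhds] at h1
  filter_upwards [h1 (ε / 4) (by positivity), hB] with i hi hBi
  have a := key (ν i) (hc i) hBi
  have b := key ν0 hc0 hB0
  rw [Real.dist_eq] at hi ⊢
  have hi' : |∫ z, max (-R) (min R (F z)) ∂(ν i : Measure Ω)
     - ∫ z, max (-R) (min R (F z)) ∂(ν0 : Measure Ω)| < ε / 4 := hi
  rw [abs_le] at a b
  rw [abs_lt] at hi' ⊢
  constructor <;> linarith

variable {d : ℕ}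

def J (z : Phase d) : ℝ := 1 + ‖z.1‖ ^ 2 + ‖z.2‖ ^ 2

lemma J_ge (z : Phase d) : 1 ≤ J z := by unfold J; nlinarith [sq_nonneg ‖z.1‖, sq_nonneg ‖z.2‖]

lemma J_contDiff : ContDiff ℝ 1 (J : Phase d → ℝ) := by
  unfold J
  exact (contDiff_const.add (contDiff_fst.norm_sq ℝ)).add (contDiff_snd.norm_sq ℝ)

@[fun_prop]
lemma J_cont : Continuous (J : Phase d → ℝ) := J_contDiff.continuous

lemma norm_sq_le_J (z : Phase d) : ‖z‖ ^ 2 ≤ J z := by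
  unfold J
  rcases max_choice ‖z.1‖ ‖z.2‖ with h | h <;> rw [Prod.norm_def, h] <;>
    nlinarith [sq_nonneg ‖z.1‖, sq_nonneg ‖z.2‖]

def mm (x : ℝ) : ℝ := (max 0 x) ^ 2

lemma mm_hasDeriv (x : ℝ) : HasDerivAt mm (2 * max 0 x) x := by
  rcases lt_trichotomy x 0 with h | h | h
  · rw [max_eq_left h.le, mul_zero]
    refine (hasDerivAt_const x (0:ℝ)).congr_of_eventuallyEq ?_
    filter_upwards [Iio_mem_nhds h] with y hy
    simp [mm, max_eq_left (le_of_lt (Set.mem_Iio.1 hy))]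
  · subst h
    simp only [max_self, mul_zero]
    rw [hasDerivAt_iff_isLittleO_nhds_zero]
    have : (fun h : ℝ => mm (0 + h) - mm 0 - h • (0:ℝ)) =O[𝓝 0] fun h => h ^ 2 := by
      apply Asymptotics.IsBigO.of_bound 1
      filter_upwards with h
      simp only [mm, zero_add, max_self, smul_zero, sub_zero, one_mul, ne_eq, OfNat.ofNat_ne_zero,
        not_false_eq_true, zero_pow, norm_pow]
      gcongr
      rw [Real.norm_eq_abs, Real.norm_eq_abs, abs_of_nonneg (le_max_left _ _)]
      exact max_le (abs_nonneg _) (le_abs_self _)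
    refine this.trans_isLittleO ?_
    have := Asymptotics.isLittleO_pow_pow (𝕜 := ℝ) (m := 1) (n := 2) (by norm_num)
    simpa using this
  · rw [max_eq_right h.le]
    have : HasDerivAt (fun y : ℝ => y ^ 2) (2 * x) x := by
      simpa using hasDerivAt_pow 2 x
    refine this.congr_of_eventuallyEq ?_
    filter_upwards [Ioi_mem_nhds h] with y hy
    simp [mm, max_eq_right (le_of_lt (Set.mem_Ioi.1 hy))]

lemma mm_contDiff : ContDiff ℝ 1 mm := by
  rw [contDiff_one_iff_deriv]
  refine ⟨fun x => (mm_hasDeriv x).differentiableAt, ?_⟩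
  have : deriv mm = fun x => 2 * max 0 x := funext fun x => (mm_hasDeriv x).deriv
  rw [this]; fun_prop

/-- cutoff -/
def cut (R : ℝ) (z : Phase d) : ℝ := mm (1 - J z / R)

lemma cut_contDiff (R : ℝ) : ContDiff ℝ 1 (cut R : Phase d → ℝ) :=
  mm_contDiff.comp (contDiff_const.sub (J_contDiff.div_const R))

@[fun_prop]
lemma cut_cont (R : ℝ) : Continuous (cut R : Phase d → ℝ) := (cut_contDiff R).continuous

lemma cut_zero {R : ℝ} (hR : 0 < R) {z : Phase d} (h : R ≤ J z) : cut R z = 0 := by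
  have : 1 - J z / R ≤ 0 := by
    rw [sub_nonpos, le_div_iff₀ hR]; linarith
  simp [cut, mm, max_eq_left this]

lemma cut_nonneg (R : ℝ) (z : Phase d) : 0 ≤ cut R z := sq_nonneg _

lemma cut_le_one {R : ℝ} (hR : 0 < R) (z : Phase d) : cut R z ≤ 1 := by
  have h0 : 0 ≤ J z / R := div_nonneg (by linarith [J_ge z]) hR.le
  unfold cut mm
  apply pow_le_one₀ (le_max_left _ _)
  exact max_le zero_le_one (by linarith)

lemma one_sub_cut_le {R : ℝ} (hR : 0 < R) (z : Phase d) : 1 - cut R z ≤ 2 * J z / R := by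
  unfold cut mm
  have h : 2 * J z / R = 2 * (J z / R) := by ring
  rw [h]
  rcases le_total 0 (1 - J z / R) with h | h
  · rw [max_eq_right h]; nlinarith [sq_nonneg (J z / R)]
  · rw [max_eq_left h]; norm_num; linarith

lemma cut_compact {R : ℝ} (hR : 0 < R) : HasCompactSupport (cut R : Phase d → ℝ) := by
  refine HasCompactSupport.intro (isCompact_closedBall (0 : Phase d) (R + 1)) ?_
  intro z hz
  apply cut_zero hR
  have : R + 1 < ‖z‖ := by simpa using hz
  have := norm_sq_le_J z
  nlinarith

lemma mul_cut_compact {R : ℝ} (hR : 0 < R) (f : Phase d → ℝ) :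
    HasCompactSupport (fun z => f z * cut R z) := (cut_compact hR).mul_left

lemma cut_tendsto (z : Phase d) : Tendsto (fun n : ℕ => cut ((n:ℝ) + 1) z) atTop (𝓝 1) := by
  have h1 : Tendsto (fun n : ℕ => 1 - 2 * J z / ((n:ℝ) + 1)) atTop (𝓝 (1 - 0)) := by
    refine tendsto_const_nhds.sub ?_
    refine Tendsto.div_atTop tendsto_const_nhds ?_
    exact tendsto_atTop_add_const_right _ _ tendsto_natCast_atTop_atTop
  rw [sub_zero] at h1
  refine tendsto_of_tendsto_of_tendsto_of_le_of_le h1 tendsto_const_nhds ?_ ?_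
  · intro n
    have := one_sub_cut_le (R := (n:ℝ)+1) (by positivity) z
    simp only; linarith
  · intro n
    exact cut_le_one (by positivity) z

end Herd

namespace Herd

open Topology

variable {d : ℕ}

/-- velocity field kernel on phase space -/
def bq (lw lx lv : ℝ) (φ : ℝ → ℝ) (p : Phase d × Phase d) : Phase d :=
  (p.1.2, lw • (p.2.1 - p.1.1) + (lx * φ ‖p.1.1 - p.2.1‖) • (p.2.1 - p.1.1)
      + (lv * φ ‖p.1.1 - p.2.1‖) • (p.2.2 - p.1.2))

structure Good (lw lx lv : ℝ) (φ : ℝ → ℝ) (φM : ℝ) (μ : ℝ → Measure (Phase d)) : Prop where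
  hlw : 0 < lw
  hlx : 0 < lx
  hlv : 0 < lv
  hφc : Continuous φ
  hφM : 0 < φM
  hφ : ∀ r, 0 ≤ φ r ∧ φ r ≤ φM
  prob : ∀ t, IsProbabilityMeasure (μ t)
  cpt : ∀ t, Cpt (μ t)
  neg : ∀ t ≤ 0, μ t = μ 0
  cont : ∀ g : ZeroAtInftyContinuousMap (Phase d) ℝ, Continuous (fun t => ∫ z, g z ∂(μ t))
  weak : ∀ g : Phase d × ℝ → ℝ, ContDiff ℝ 1 g → HasCompactSupport g →
    ∀ t : ℝ, 0 ≤ t →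
      (∫ z, g (z, t) ∂(μ t)) - (∫ z, g (z, 0) ∂(μ 0)) =
      ∫ s in (0:ℝ)..t, (∫ z,
        (deriv (fun u => g (z, u)) s
          + (fderiv ℝ (fun y => g ((y, z.2), s)) z.1) z.2
          + (fderiv ℝ (fun w => g ((z.1, w), s)) z.2)
              (herdQ lw lx lv φ (μ s) z.1 z.2)) ∂(μ s))

def Zf (μ : ℝ → Measure (Phase d)) (t : ℝ) : ℝ := ∫ z, J z ^ 2 ∂(μ t)

def LB (μ : ℝ → Measure (Phase d)) (t : ℝ) : Prop := ∃ B, ∀ᶠ s in 𝓝 t, Zf μ s ≤ B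

def kf (lw lx lv : ℝ) (φ : ℝ → ℝ) (f : Phase d → ℝ) (p : Phase d × Phase d) : ℝ :=
  fderiv ℝ f p.1 (bq lw lx lv φ p)

section
variable {lw lx lv : ℝ} {φ : ℝ → ℝ} {φM : ℝ} {μ : ℝ → Measure (Phase d)}

lemma Good.int (h : Good lw lx lv φ φM μ) {G : Type*} [NormedAddCommGroup G] (t : ℝ)
    {F : Phase d → G} (hF : Continuous F) : Integrable F (μ t) :=
  have := h.prob t; (h.cpt t).integrable hF

lemma Good.int2 (h : Good lw lx lv φ φM μ) {G : Type*} [NormedAddCommGroup G] (r t : ℝ)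
    {F : Phase d × Phase d → G} (hF : Continuous F) : Integrable F ((μ r).prod (μ t)) :=
  have := h.prob t; have := h.prob r; ((h.cpt r).prod (h.cpt t)).integrable hF

lemma Good.cont_cc (h : Good lw lx lv φ φM μ) {f : Phase d → ℝ} (hf : Continuous f)
    (hs : HasCompactSupport f) : Continuous (fun t => ∫ z, f z ∂(μ t)) := by
  let g : ZeroAtInftyContinuousMap (Phase d) ℝ := ⟨⟨f, hf⟩, hs.is_zero_at_infty⟩
  exact h.cont g

def pm (h : Good lw lx lv φ φM μ) (t : ℝ) : ProbabilityMeasure (Phase d) := ⟨μ t, h.prob t⟩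

lemma pm_cont (h : Good lw lx lv φ φM μ) : Continuous (pm h) := by
  rw [continuous_iff_continuousAt]
  intro t0
  rw [ContinuousAt, ProbabilityMeasure.tendsto_iff_forall_integral_tendsto]
  intro f
  change Tendsto (fun t => ∫ z, f z ∂(μ t)) (𝓝 t0) (𝓝 (∫ z, f z ∂(μ t0)))
  have hfb : ∀ z, |f z| ≤ ‖f‖ := fun z => f.norm_coe_le_norm z
  have hN : 0 ≤ ‖f‖ := norm_nonneg f
  have key : ∀ R > 0, ∀ t, |∫ z, f z ∂(μ t) - ∫ z, f z * cut R z ∂(μ t)| ≤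
      ‖f‖ * (1 - ∫ z, cut R z ∂(μ t)) := by
    intro R hR t
    have := h.prob t
    have e1 : (1:ℝ) = ∫ z, (1:ℝ) ∂(μ t) := by simp
    rw [e1, ← integral_sub (h.int t (by fun_prop)) (h.int t (by fun_prop)),
      ← integral_sub (h.int t (by fun_prop)) (h.int t (by fun_prop)), ← integral_const_mul]
    refine abs_integral_le_integral_abs.trans
      (integral_mono (h.int t (by fun_prop)) (h.int t (by fun_prop)) ?_)
    intro z
    have : f z - f z * cut R z = f z * (1 - cut R z) := by ring
    simp only
    rw [this, abs_mul, abs_of_nonneg (by linarith [cut_le_one hR z] : 0 ≤ 1 - cut R z)]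
    exact mul_le_mul_of_nonneg_right (hfb z) (by linarith [cut_le_one hR z])
  rw [Metric.tendsto_nhds]
  intro ε hε
  set δ := ε / (8 * (‖f‖ + 1)) with hδ
  have hδp : 0 < δ := by positivity
  have hfd : ‖f‖ * (2 * δ) ≤ ε / 4 := by
    have h1 : (‖f‖ + 1) * (2 * δ) = ε / 4 := by rw [hδ]; field_simp; norm_num
    nlinarith
  set A := ∫ z, J z ∂(μ t0) with hA
  have hA0 : 0 ≤ A := integral_nonneg fun z => by have := J_ge z; simp only [Pi.zero_apply]; linarith
  set R := 2 * (A + 1) / δ with hRd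
  have hR : 0 < R := by positivity
  have hc0 : 1 - ∫ z, cut R z ∂(μ t0) ≤ δ := by
    have := h.prob t0
    have e1 : (1:ℝ) = ∫ z, (1:ℝ) ∂(μ t0) := by simp
    rw [e1, ← integral_sub (h.int t0 (by fun_prop)) (h.int t0 (by fun_prop))]
    calc ∫ z, (1 - cut R z) ∂(μ t0) ≤ ∫ z, 2 / R * J z ∂(μ t0) := by
          refine integral_mono (h.int t0 (by fun_prop)) (h.int t0 (by fun_prop)) ?_
          intro z
          have := one_sub_cut_le hR z
          simp only
          calc _ ≤ _ := this
            _ = _ := by ring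
      _ = 2 / R * A := integral_const_mul _ _
      _ ≤ δ := by
        rw [hRd]
        have : 2 / (2 * (A + 1) / δ) * A = δ * (A / (A + 1)) := by field_simp
        rw [this]
        have : A / (A + 1) ≤ 1 := by rw [div_le_one (by positivity)]; linarith
        nlinarith
  have ct1 := (h.cont_cc (cut_cont R) (cut_compact hR)).tendsto t0
  have ct2 := (h.cont_cc (f := fun z => f z * cut R z) (by fun_prop)
    (mul_cut_compact hR f)).tendsto t0
  rw [Metric.tendsto_nhds] at ct1 ct2
  filter_upwards [ct1 δ hδp, ct2 (ε/4) (by positivity)] with t h1 h2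
  have k1 := key R hR t
  have k2 := key R hR t0
  rw [Real.dist_eq] at h1 h2 ⊢
  rw [abs_lt] at h1 h2 ⊢
  rw [abs_le] at k1 k2
  have b1 : ‖f‖ * (1 - ∫ z, cut R z ∂(μ t)) ≤ ‖f‖ * (2 * δ) := by
    apply mul_le_mul_of_nonneg_left _ hN; linarith
  have b2 : ‖f‖ * (1 - ∫ z, cut R z ∂(μ t0)) ≤ ‖f‖ * (2 * δ) := by
    apply mul_le_mul_of_nonneg_left _ hN; linarith
  constructor <;> linarith

lemma Good.int_fst (h : Good lw lx lv φ φM μ) (r t : ℝ) (f : Phase d → ℝ) :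
    ∫ p, f p.1 ∂((μ r).prod (μ t)) = ∫ z, f z ∂(μ r) := by
  have := h.prob t; have := h.prob r
  simpa using integral_fun_fst (μ := μ r) (ν := μ t) f

lemma Good.int_snd (h : Good lw lx lv φ φM μ) (r t : ℝ) (f : Phase d → ℝ) :
    ∫ p, f p.2 ∂((μ r).prod (μ t)) = ∫ z, f z ∂(μ t) := by
  have := h.prob t; have := h.prob r
  simpa using integral_fun_snd (μ := μ r) (ν := μ t) f

lemma Good.sq_int (h : Good lw lx lv φ φM μ) (r t : ℝ) :
    ∫ p, (J p.1 + J p.2) ^ 2 ∂((μ r).prod (μ t)) ≤ 2 * (Zf μ r + Zf μ t) := by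
  have e : ∫ p : Phase d × Phase d, 2 * (J p.1 ^ 2 + J p.2 ^ 2) ∂((μ r).prod (μ t))
      = 2 * (Zf μ r + Zf μ t) := by
    rw [integral_const_mul, integral_add (h.int2 r t (by fun_prop)) (h.int2 r t (by fun_prop)),
      h.int_fst r t (fun z => J z ^ 2), h.int_snd r t (fun z => J z ^ 2)]
    rfl
  rw [← e]
  refine integral_mono (h.int2 r t (by fun_prop)) (h.int2 r t (by fun_prop)) ?_
  intro p
  simp only
  nlinarith [sq_nonneg (J p.1 - J p.2)]

lemma Good.tendsto2 (h : Good lw lx lv φ φM μ) {ι : Type*} {l : Filter ι} {r t : ι → ℝ}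
    {r0 t0 : ℝ} (hr : Tendsto r l (𝓝 r0)) (ht : Tendsto t l (𝓝 t0)) {B : ℝ}
    (hB1 : ∀ᶠ i in l, Zf μ (r i) ≤ B) (hB2 : ∀ᶠ i in l, Zf μ (t i) ≤ B)
    {K : Phase d × Phase d → ℝ} (hK : Continuous K) {c : ℝ}
    (hc : ∀ p, |K p| ≤ c * (J p.1 + J p.2)) :
    Tendsto (fun i => ∫ p, K p ∂((μ (r i)).prod (μ (t i)))) l
      (𝓝 (∫ p, K p ∂((μ r0).prod (μ t0)))) := by
  have hbd : ∀ r t, ∫ p, K p ^ 2 ∂((μ r).prod (μ t)) ≤ c ^ 2 * (2 * (Zf μ r + Zf μ t)) := by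
    intro r t
    refine le_trans ?_ (mul_le_mul_of_nonneg_left (h.sq_int r t) (sq_nonneg c))
    rw [← integral_const_mul]
    refine integral_mono (h.int2 r t (by fun_prop)) (h.int2 r t (by fun_prop)) ?_
    intro p
    simp only
    rw [← mul_pow, ← sq_abs]
    exact pow_le_pow_left₀ (abs_nonneg _) (hc p) 2
  let ν : ι → ProbabilityMeasure (Phase d × Phase d) := fun i => (pm h (r i)).prod (pm h (t i))
  have hν : Tendsto ν l (𝓝 ((pm h r0).prod (pm h t0))) := by
    have c1 := ((pm_cont h).tendsto r0).comp hr
    have c2 := ((pm_cont h).tendsto t0).comp ht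
    exact (ProbabilityMeasure.continuous_prod.tendsto (pm h r0, pm h t0)).comp (c1.prodMk_nhds c2)
  have hcp : ∀ r t, Cpt ((μ r).prod (μ t)) := fun r t => by
    have := h.prob t; have := h.prob r
    exact (h.cpt r).prod (h.cpt t)
  refine tendsto_unif ν ((pm h r0).prod (pm h t0)) hν (fun i => hcp _ _) (hcp _ _) K hK
    (max (c ^ 2 * (2 * (B + B))) (c ^ 2 * (2 * (Zf μ r0 + Zf μ t0)))) ?_ ?_
  · filter_upwards [hB1, hB2] with i h1 h2
    refine (hbd (r i) (t i)).trans (le_trans ?_ (le_max_left _ _))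
    gcongr
  · exact (hbd r0 t0).trans (le_max_right _ _)

lemma Good.bq_cont (h : Good lw lx lv φ φM μ) :
    Continuous (bq lw lx lv φ : Phase d × Phase d → Phase d) := by
  have := h.hφc
  unfold bq
  fun_prop

lemma Good.bq_le (h : Good lw lx lv φ φM μ) (p : Phase d × Phase d) :
    ‖bq lw lx lv φ p‖ ≤ (1 + lw + lx * φM + lv * φM) * (‖p.1‖ + ‖p.2‖) := by
  obtain ⟨z, w⟩ := p
  have h1 := norm_fst_le z
  have h2 := norm_snd_le z
  have h3 := norm_fst_le w
  have h4 := norm_snd_le w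
  have := h.hlw; have := h.hlx; have := h.hlv; have := h.hφM
  have e1 : ‖w.1 - z.1‖ ≤ ‖z‖ + ‖w‖ := (norm_sub_le _ _).trans (by linarith)
  have e2 : ‖w.2 - z.2‖ ≤ ‖z‖ + ‖w‖ := (norm_sub_le _ _).trans (by linarith)
  have f0 := (h.hφ ‖z.1 - w.1‖).1
  have f1 := (h.hφ ‖z.1 - w.1‖).2
  have hn : 0 ≤ ‖z‖ + ‖w‖ := by positivity
  unfold bq
  rw [norm_prod_le_iff]
  constructor
  · simp only
    have : 0 ≤ (lw + lx * φM + lv * φM) * (‖z‖ + ‖w‖) := by positivity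
    nlinarith [norm_nonneg w]
  · simp only
    refine (norm_add₃_le).trans ?_
    rw [norm_smul, norm_smul, norm_smul, Real.norm_of_nonneg h.hlw.le,
      Real.norm_of_nonneg (by positivity), Real.norm_of_nonneg (by positivity)]
    have a1 : lw * ‖w.1 - z.1‖ ≤ lw * (‖z‖ + ‖w‖) := by gcongr
    have a2 : lx * φ ‖z.1 - w.1‖ * ‖w.1 - z.1‖ ≤ lx * φM * (‖z‖ + ‖w‖) := by gcongr
    have a3 : lv * φ ‖z.1 - w.1‖ * ‖w.2 - z.2‖ ≤ lv * φM * (‖z‖ + ‖w‖) := by gcongr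
    linarith

lemma Good.kf_cont (h : Good lw lx lv φ φM μ) {f : Phase d → ℝ} (hf : ContDiff ℝ 1 f) :
    Continuous (kf lw lx lv φ f) := by
  unfold kf
  exact ((hf.continuous_fderiv (by norm_num)).comp continuous_fst).clm_apply h.bq_cont

lemma arith1 {a b A B : ℝ} (_ : 0 ≤ a) (_ : 0 ≤ b) (h1 : 1 ≤ A) (h2 : 1 ≤ B)
    (haA : a ^ 2 ≤ A) (hbB : b ^ 2 ≤ B) : (1 + a) * (a + b) ≤ 3 * (A + B) := by
  nlinarith [sq_nonneg (a - b), sq_nonneg (a - 1), sq_nonneg (b - 1)]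

lemma Good.kf_le (h : Good lw lx lv φ φM μ) {f : Phase d → ℝ} {c : ℝ}
    (hc : ∀ z, ‖fderiv ℝ f z‖ ≤ c * (1 + ‖z‖)) :
    ∀ p, |kf lw lx lv φ f p| ≤
      (c * (1 + lw + lx * φM + lv * φM) * 3) * (J p.1 + J p.2) := by
  intro p
  have := h.hlw; have := h.hlx; have := h.hlv; have := h.hφM
  have hc0 : 0 ≤ c := by
    have := (norm_nonneg _).trans (hc 0)
    simpa using this
  unfold kf
  rw [← Real.norm_eq_abs]
  refine (ContinuousLinearMap.le_opNorm _ _).trans ?_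
  calc _ ≤ (c * (1 + ‖p.1‖)) * ((1 + lw + lx * φM + lv * φM) * (‖p.1‖ + ‖p.2‖)) :=
        mul_le_mul (hc _) (h.bq_le p) (norm_nonneg _) (by positivity)
    _ = (c * (1 + lw + lx * φM + lv * φM)) * ((1 + ‖p.1‖) * (‖p.1‖ + ‖p.2‖)) := by ring
    _ ≤ (c * (1 + lw + lx * φM + lv * φM)) * (3 * (J p.1 + J p.2)) := by
        refine mul_le_mul_of_nonneg_left ?_ (by positivity)
        exact arith1 (norm_nonneg _) (norm_nonneg _) (J_ge _) (J_ge _) (norm_sq_le_J _)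
          (norm_sq_le_J _)
    _ = _ := by ring

/-- The weak formulation integrand for product test functions. -/
lemma Good.integrand (h : Good lw lx lv φ φM μ) {f : Phase d → ℝ} (hf : ContDiff ℝ 1 f)
    {χ : ℝ → ℝ} (hχ : ContDiff ℝ 1 χ) (s : ℝ) :
    (∫ z, (deriv (fun u => (fun q : Phase d × ℝ => χ q.2 * f q.1) (z, u)) s
          + (fderiv ℝ (fun y => (fun q : Phase d × ℝ => χ q.2 * f q.1) ((y, z.2), s)) z.1) z.2
          + (fderiv ℝ (fun w => (fun q : Phase d × ℝ => χ q.2 * f q.1) ((z.1, w), s)) z.2)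
              (herdQ lw lx lv φ (μ s) z.1 z.2)) ∂(μ s)) =
    deriv χ s * ∫ z, f z ∂(μ s) + χ s * ∫ p, kf lw lx lv φ f p ∂((μ s).prod (μ s)) := by
  have := h.prob s
  have hk := h.int2 s s (h.kf_cont hf)
  rw [integral_prod _ hk, ← integral_const_mul, ← integral_const_mul, ← integral_add
    ((h.int s hf.continuous).const_mul _) (hk.integral_prod_left.const_mul _)]
  congr 1
  ext z
  have hd : HasFDerivAt f (fderiv ℝ f z) z := (hf.differentiable (by norm_num) z).hasFDerivAt
  have hdχ : DifferentiableAt ℝ χ s := hχ.differentiable (by norm_num) s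
  have e1 : deriv (fun u => χ u * f z) s = deriv χ s * f z := deriv_mul_const hdχ _
  have e2 : HasFDerivAt (fun y => χ s * f (y, z.2))
      (χ s • (fderiv ℝ f z).comp (ContinuousLinearMap.inl ℝ (Euc d) (Euc d))) z.1 := by
    have : HasFDerivAt (fun y : Euc d => (y, z.2)) (ContinuousLinearMap.inl ℝ (Euc d) (Euc d)) z.1 :=
      hasFDerivAt_prodMk_left _ _
    exact (HasFDerivAt.comp z.1 (g := f) (f := fun y : Euc d => (y, z.2)) hd this).const_mul (χ s)
  have e3 : HasFDerivAt (fun y => χ s * f (z.1, y))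
      (χ s • (fderiv ℝ f z).comp (ContinuousLinearMap.inr ℝ (Euc d) (Euc d))) z.2 := by
    have : HasFDerivAt (fun y : Euc d => (z.1, y)) (ContinuousLinearMap.inr ℝ (Euc d) (Euc d)) z.2 :=
      hasFDerivAt_prodMk_right _ _
    exact (HasFDerivAt.comp z.2 (g := f) (f := fun y : Euc d => (z.1, y)) hd this).const_mul (χ s)
  simp only
  rw [e1, e2.fderiv, e3.fderiv, add_assoc]
  congr 1
  simp only [_root_.smul_apply, ContinuousLinearMap.comp_apply, smul_eq_mul]
  rw [← mul_add, ← map_add]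
  congr 1
  have hz : Continuous fun w : Phase d => bq lw lx lv φ (z, w) :=
    h.bq_cont.comp (by fun_prop)
  have := (fderiv ℝ f z).integral_comp_comm (h.int s hz)
  unfold kf
  rw [this]
  congr 1
  have i1 := h.int s (continuous_fst.comp hz)
  have i2 := h.int s (continuous_snd.comp hz)
  have : ∫ w, bq lw lx lv φ (z, w) ∂(μ s) =
     (∫ w, (bq lw lx lv φ (z, w)).1 ∂(μ s), ∫ w, (bq lw lx lv φ (z, w)).2 ∂(μ s)) :=
    integral_pair i1 i2
  rw [this]
  ext1
  · simp [bq]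
  · simp [bq, herdQ]

lemma LB.open_nhds {t0 : ℝ} (h : LB μ t0) (ht : 0 < t0) :
    ∃ ε > 0, ∃ B, ∀ s ∈ Metric.ball t0 ε, Zf μ s ≤ B ∧ 0 < s := by
  obtain ⟨B, hB⟩ := h
  obtain ⟨ε, hε, hh⟩ := Metric.eventually_nhds_iff_ball.1 (hB.and (lt_mem_nhds ht))
  exact ⟨ε, hε, B, hh⟩

lemma Good.hasDeriv_cc (h : Good lw lx lv φ φM μ) {f : Phase d → ℝ} (hf : ContDiff ℝ 1 f)
    (hs : HasCompactSupport f) {t0 : ℝ} (ht0 : 0 < t0) (hL : LB μ t0) :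
    HasDerivAt (fun t => ∫ z, f z ∂(μ t)) (∫ p, kf lw lx lv φ f p ∂((μ t0).prod (μ t0))) t0 := by
  obtain ⟨ε, hε, B, hB⟩ := hL.open_nhds ht0
  let χ : ContDiffBump t0 := ⟨ε / 3, ε / 2, by positivity, by linarith⟩
  have hχ : ContDiff ℝ 1 χ := χ.contDiff
  have hts : tsupport χ ⊆ Metric.ball t0 ε := by
    rw [χ.tsupport_eq]
    exact Metric.closedBall_subset_ball (by simp only [χ]; linarith)
  set L : ℝ → ℝ := fun s => ∫ p, kf lw lx lv φ f p ∂((μ s).prod (μ s)) with hLdef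
  set A : ℝ → ℝ := fun s => ∫ z, f z ∂(μ s) with hA
  have hAc : Continuous A := h.cont_cc hf.continuous hs
  obtain ⟨c, hc⟩ := (hs.fderiv (𝕜 := ℝ)).exists_bound_of_continuous
    (hf.continuous_fderiv (by norm_num))
  have hcp : 0 ≤ c := (norm_nonneg _).trans (hc 0)
  have hkb := h.kf_le (f := f) (c := c) (fun z => (hc z).trans (by nlinarith [norm_nonneg z]))
  have hLc : ContinuousOn L (Metric.ball t0 ε) := by
    intro s hs'
    apply ContinuousAt.continuousWithinAt
    have he : ∀ᶠ i in 𝓝 s, Zf μ i ≤ B := by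
      filter_upwards [Metric.isOpen_ball.mem_nhds hs'] with i hi using (hB i hi).1
    exact h.tendsto2 tendsto_id tendsto_id he he (h.kf_cont hf) hkb
  set G : ℝ → ℝ := fun s => deriv χ s * A s + χ s * L s with hG
  have hGc : Continuous G := by
    apply Continuous.add
    · exact (hχ.continuous_deriv (by norm_num)).mul hAc
    · apply ContinuousOn.continuous_of_tsupport_subset (s := Metric.ball t0 ε)
      · exact hχ.continuous.continuousOn.mul hLc
      · exact Metric.isOpen_ball
      · exact (tsupport_mul_subset_left).trans hts
  have hw : ∀ t, 0 ≤ t → χ t * A t - χ 0 * A 0 = ∫ s in (0:ℝ)..t, G s := by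
    intro t ht
    have := h.weak (fun q : Phase d × ℝ => χ q.2 * f q.1)
      ((hχ.comp contDiff_snd).mul (hf.comp contDiff_fst)) ?_ t ht
    · simp_rw [h.integrand hf hχ] at this
      simp only [integral_const_mul] at this
      exact this
    · refine HasCompactSupport.intro (K := tsupport f ×ˢ tsupport χ)
        (hs.isCompact.prod χ.hasCompactSupport.isCompact) ?_
      rintro ⟨z, u⟩ hz
      simp only [Set.mem_prod, not_and_or] at hz
      rcases hz with hz | hz
      · simp [image_eq_zero_of_notMem_tsupport hz]
      · simp [image_eq_zero_of_notMem_tsupport hz]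
  have hone : ∀ᶠ t in 𝓝 t0, χ t = 1 := χ.eventuallyEq_one
  have hFTC : HasDerivAt (fun t => χ 0 * A 0 + ∫ s in (0:ℝ)..t, G s) (G t0) t0 :=
    (intervalIntegral.integral_hasDerivAt_right (hGc.intervalIntegrable _ _)
      (hGc.stronglyMeasurableAtFilter _ _) hGc.continuousAt).const_add _
  have hG0 : G t0 = L t0 := by
    have h1 : χ t0 = 1 := hone.self_of_nhds
    have h2 : deriv χ t0 = 0 := by
      have : (χ : ℝ → ℝ) =ᶠ[𝓝 t0] fun _ => 1 := hone
      rw [this.deriv_eq]; simp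
    simp [hG, h1, h2]
  rw [hG0] at hFTC
  refine hFTC.congr_of_eventuallyEq ?_
  filter_upwards [hone, lt_mem_nhds ht0] with t h1 h2
  have := hw t h2.le
  rw [h1, one_mul] at this
  change A t = _
  linarith

end
end Herd

namespace Herd

open Topology

variable {d : ℕ}

lemma J_fderiv_apply (z b : Phase d) :
    fderiv ℝ J z b = 2 * ⟪z.1, b.1⟫ + 2 * ⟪z.2, b.2⟫ := by
  have h1 : HasFDerivAt (fun z : Phase d => ‖z.1‖ ^ 2)
      (2 • (innerSL ℝ z.1).comp (ContinuousLinearMap.fst ℝ (Euc d) (Euc d))) z :=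
    (hasFDerivAt_fst (p := z)).norm_sq
  have h2 : HasFDerivAt (fun z : Phase d => ‖z.2‖ ^ 2)
      (2 • (innerSL ℝ z.2).comp (ContinuousLinearMap.snd ℝ (Euc d) (Euc d))) z :=
    (hasFDerivAt_snd (p := z)).norm_sq
  have h3 : HasFDerivAt (J : Phase d → ℝ) _ z := (h1.const_add 1).add h2
  rw [h3.fderiv]
  simp

lemma J_fderiv_le (z : Phase d) : ‖fderiv ℝ J z‖ ≤ 4 * ‖z‖ := by
  refine ContinuousLinearMap.opNorm_le_bound _ (by positivity) ?_
  intro b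
  rw [J_fderiv_apply, Real.norm_eq_abs]
  have a1 := abs_real_inner_le_norm z.1 b.1
  have a2 := abs_real_inner_le_norm z.2 b.2
  have b1 : ‖z.1‖ * ‖b.1‖ ≤ ‖z‖ * ‖b‖ := by
    gcongr; exacts [norm_fst_le z, norm_fst_le b]
  have b2 : ‖z.2‖ * ‖b.2‖ ≤ ‖z‖ * ‖b‖ := by
    gcongr; exacts [norm_snd_le z, norm_snd_le b]
  rw [abs_le] at *
  constructor <;> linarith

lemma J_hasFDeriv (z : Phase d) : HasFDerivAt J (fderiv ℝ J z) z :=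
  (J_contDiff.differentiable (by norm_num) z).hasFDerivAt

lemma cut_hasFDeriv (R : ℝ) (z : Phase d) :
    HasFDerivAt (cut R) ((2 * max 0 (1 - J z / R) * (-(1 / R))) • fderiv ℝ J z) z := by
  have h1 : HasDerivAt (fun y : ℝ => mm (1 - y / R)) (2 * max 0 (1 - J z / R) * (-(1 / R))) (J z) := by
    have := ((hasDerivAt_id (J z)).div_const R).const_sub 1
    exact (mm_hasDeriv (1 - J z / R)).comp (J z) this
  exact h1.comp_hasFDerivAt z (J_hasFDeriv z)

lemma cut_fderiv_le {R : ℝ} (hR : 0 < R) (z : Phase d) : ‖fderiv ℝ (cut R) z‖ ≤ 8 * ‖z‖ / R := by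
  rw [(cut_hasFDeriv R z).fderiv, norm_smul, Real.norm_eq_abs]
  have hm : max 0 (1 - J z / R) ≤ 1 := by
    have : 0 ≤ J z / R := div_nonneg (by linarith [J_ge z]) hR.le
    exact max_le zero_le_one (by linarith)
  have hm0 : 0 ≤ max 0 (1 - J z / R) := le_max_left _ _
  have : |2 * max 0 (1 - J z / R) * (-(1 / R))| ≤ 2 / R := by
    rw [abs_mul, abs_neg, abs_of_nonneg (by positivity), abs_of_nonneg (by positivity),
      mul_one_div]
    gcongr; linarith
  calc _ ≤ 2 / R * (4 * ‖z‖) := mul_le_mul this (J_fderiv_le z) (norm_nonneg _) (by positivity)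
    _ = _ := by ring

def hz (n : ℕ) (z : Phase d) : ℝ := J z ^ 2 * cut ((n:ℝ) + 1) z

lemma hz_contDiff (n : ℕ) : ContDiff ℝ 1 (hz n : Phase d → ℝ) :=
  (J_contDiff.pow 2).mul (cut_contDiff _)

lemma hz_compact (n : ℕ) : HasCompactSupport (hz n : Phase d → ℝ) :=
  mul_cut_compact (by positivity) _

lemma hz_le (n : ℕ) (z : Phase d) : hz n z ≤ J z ^ 2 := by
  have := cut_le_one (R := (n:ℝ) + 1) (by positivity) z
  unfold hz
  nlinarith [sq_nonneg (J z)]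

lemma hz_fderiv_le (n : ℕ) (z : Phase d) : ‖fderiv ℝ (hz n) z‖ ≤ 8 * J z * ‖z‖ := by
  set R : ℝ := (n:ℝ) + 1 with hR
  have hRp : 0 < R := by positivity
  set m : ℝ := max 0 (1 - J z / R) with hm
  have hJ := J_ge z
  have h2 : HasFDerivAt (fun z : Phase d => J z ^ 2) ((2 * J z) • fderiv ℝ J z) z := by
    have h0 : HasDerivAt (fun y : ℝ => y ^ 2) (2 * J z) (J z) := by
      simpa using hasDerivAt_pow 2 (J z)
    exact h0.comp_hasFDerivAt z (J_hasFDeriv z)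
  have h3 := h2.mul (cut_hasFDeriv R z)
  have h4 : HasFDerivAt (hz n) ((2 * J z * m * (m - J z / R)) • fderiv ℝ J z) z := by
    refine HasFDerivAt.congr_fderiv (f := hz n) h3 ?_
    rw [smul_smul, smul_smul, ← add_smul]
    congr 1
    simp only [cut, mm, ← hm]
    ring
  rw [h4.fderiv, norm_smul, Real.norm_eq_abs]
  have hq : 0 ≤ J z / R := by positivity
  have : |2 * J z * m * (m - J z / R)| ≤ 2 * J z := by
    rcases le_total 0 (1 - J z / R) with h | h
    · rw [max_eq_right h] at hm
      rw [abs_mul, abs_of_nonneg (by positivity)]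
      have a1 : |m - J z / R| ≤ 1 := by rw [abs_le]; constructor <;> linarith
      have a2 : m ≤ 1 := by linarith
      have a3 : 0 ≤ m := by linarith
      calc 2 * J z * m * |m - J z / R| ≤ 2 * J z * 1 * 1 := by gcongr
        _ = _ := by ring
    · rw [max_eq_left h] at hm
      rw [hm]; simp; linarith
  calc _ ≤ 2 * J z * (4 * ‖z‖) := mul_le_mul this (J_fderiv_le z) (norm_nonneg _) (by positivity)
    _ = _ := by ring

section
variable {lw lx lv : ℝ} {φ : ℝ → ℝ} {φM : ℝ} {μ : ℝ → Measure (Phase d)}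

lemma Good.khz_le (h : Good lw lx lv φ φM μ) (n : ℕ) (t : ℝ) :
    |∫ p, kf lw lx lv φ (hz n) p ∂((μ t).prod (μ t))| ≤
      (96 * (1 + lw + lx * φM + lv * φM)) * Zf μ t := by
  have := h.hlw; have := h.hlx; have := h.hlv; have := h.hφM
  set c0 := 1 + lw + lx * φM + lv * φM with hc0
  have hc0p : 0 < c0 := by positivity
  have hpt : ∀ p : Phase d × Phase d, |kf lw lx lv φ (hz n) p| ≤ (24 * c0) * (J p.1 + J p.2) ^ 2 := by
    intro p
    have j1 := J_ge p.1
    have j2 := J_ge p.2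
    unfold kf
    rw [← Real.norm_eq_abs]
    refine (ContinuousLinearMap.le_opNorm _ _).trans ?_
    calc _ ≤ (8 * J p.1 * ‖p.1‖) * (c0 * (‖p.1‖ + ‖p.2‖)) :=
          mul_le_mul (hz_fderiv_le n _) (h.bq_le p) (norm_nonneg _) (by positivity)
      _ ≤ (8 * J p.1 * (1 + ‖p.1‖)) * (c0 * (‖p.1‖ + ‖p.2‖)) := by gcongr; linarith
      _ = (8 * J p.1 * c0) * ((1 + ‖p.1‖) * (‖p.1‖ + ‖p.2‖)) := by ring
      _ ≤ (8 * J p.1 * c0) * (3 * (J p.1 + J p.2)) := by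
          refine mul_le_mul_of_nonneg_left ?_ (by positivity)
          exact arith1 (norm_nonneg _) (norm_nonneg _) j1 j2 (norm_sq_le_J _) (norm_sq_le_J _)
      _ ≤ (8 * (J p.1 + J p.2) * c0) * (3 * (J p.1 + J p.2)) := by gcongr; linarith
      _ = _ := by ring
  refine abs_integral_le_integral_abs.trans ?_
  calc _ ≤ ∫ p : Phase d × Phase d, (24 * c0) * (J p.1 + J p.2) ^ 2 ∂((μ t).prod (μ t)) :=
        integral_mono (h.int2 t t (h.kf_cont (hz_contDiff n)).abs) (h.int2 t t (by fun_prop)) hpt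
    _ = (24 * c0) * ∫ p : Phase d × Phase d, (J p.1 + J p.2) ^ 2 ∂((μ t).prod (μ t)) :=
        integral_const_mul _ _
    _ ≤ (24 * c0) * (2 * (Zf μ t + Zf μ t)) := by
        have := h.sq_int t t
        gcongr
    _ = _ := by ring

lemma Good.hz_tendsto (h : Good lw lx lv φ φM μ) (t : ℝ) :
    Tendsto (fun n : ℕ => ∫ z, hz n z ∂(μ t)) atTop (𝓝 (Zf μ t)) := by
  refine tendsto_integral_of_dominated_convergence (fun z => J z ^ 2) ?_ ?_ ?_ ?_
  · intro n; exact (h.int t (hz_contDiff n).continuous).aestronglyMeasurable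
  · exact h.int t (by fun_prop)
  · intro n
    refine Eventually.of_forall fun z => ?_
    rw [Real.norm_eq_abs, hz, abs_of_nonneg (mul_nonneg (sq_nonneg _) (cut_nonneg _ _))]
    exact hz_le n z
  · refine Eventually.of_forall fun z => ?_
    have := (cut_tendsto z).const_mul (J z ^ 2)
    simpa [hz] using this

lemma Good.hz_int_le (h : Good lw lx lv φ φM μ) (n : ℕ) (t : ℝ) :
    ∫ z, hz n z ∂(μ t) ≤ Zf μ t :=
  integral_mono (h.int t (hz_contDiff n).continuous) (h.int t (by fun_prop)) (hz_le n)

lemma Zf_nonneg (t : ℝ) : 0 ≤ Zf μ t := integral_nonneg fun _ => sq_nonneg _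

lemma Good.closed_sub (h : Good lw lx lv φ φM μ) (B : ℝ) : IsClosed {t | Zf μ t ≤ B} := by
  have : {t | Zf μ t ≤ B} = ⋂ n : ℕ, {t | ∫ z, hz n z ∂(μ t) ≤ B} := by
    ext t
    simp only [mem_ofPred_eq, mem_iInter]
    constructor
    · intro ht n; exact (h.hz_int_le n t).trans ht
    · intro ht; exact le_of_tendsto' (h.hz_tendsto t) ht
  rw [this]
  exact isClosed_iInter fun n => isClosed_le
    (h.cont_cc (hz_contDiff n).continuous (hz_compact n)) continuous_const

/-- Step size. -/
def dl (lw lx lv φM : ℝ) : ℝ := 1 / (2 * (96 * (1 + lw + lx * φM + lv * φM)))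

lemma Good.K1 (h : Good lw lx lv φ φM μ) {a b : ℝ} (ha : 0 ≤ a) (hab : b - a ≤ dl lw lx lv φM)
    {B : ℝ} (hB : ∀ t ∈ Icc a b, Zf μ t ≤ B) :
    ∀ s ∈ Icc a b, ∀ t ∈ Icc a b, Zf μ t ≤ 2 * Zf μ s := by
  intro s hs t ht
  have := h.hlw; have := h.hlx; have := h.hlv; have := h.hφM
  set C := 96 * (1 + lw + lx * φM + lv * φM) with hC
  have hCp : 0 < C := by positivity
  set S := sSup (Zf μ '' Icc a b) with hS
  have hbd : BddAbove (Zf μ '' Icc a b) := ⟨B, by rintro _ ⟨t, ht, rfl⟩; exact hB t ht⟩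
  have hle : ∀ t ∈ Icc a b, Zf μ t ≤ S := fun t ht => le_csSup hbd ⟨t, ht, rfl⟩
  have hS0 : 0 ≤ S := (Zf_nonneg s).trans (hle s hs)
  have hder : ∀ n : ℕ, ∀ x ∈ interior (Icc a b), HasDerivAt (fun t => ∫ z, hz n z ∂(μ t))
      (∫ p, kf lw lx lv φ (hz n) p ∂((μ x).prod (μ x))) x := by
    intro n x hx
    rw [interior_Icc] at hx
    refine h.hasDeriv_cc (hz_contDiff n) (hz_compact n) (ha.trans_lt hx.1) ⟨B, ?_⟩
    filter_upwards [Ioo_mem_nhds hx.1 hx.2] with y hy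
    exact hB y (Ioo_subset_Icc_self hy)
  have hderb : ∀ n : ℕ, ∀ x ∈ interior (Icc a b),
      |∫ p, kf lw lx lv φ (hz n) p ∂((μ x).prod (μ x))| ≤ C * S := by
    intro n x hx
    refine (h.khz_le n x).trans ?_
    exact mul_le_mul_of_nonneg_left (hle x (interior_subset hx)) hCp.le
  have hcont : ∀ n : ℕ, ContinuousOn (fun t => ∫ z, hz n z ∂(μ t)) (Icc a b) := fun n =>
    (h.cont_cc (hz_contDiff n).continuous (hz_compact n)).continuousOn
  have hstep : ∀ x ∈ Icc a b, ∀ y ∈ Icc a b, x ≤ y → ∀ n : ℕ,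
      |∫ z, hz n z ∂(μ y) - ∫ z, hz n z ∂(μ x)| ≤ S / 2 := by
    intro x hx y hy hxy n
    have u := (convex_Icc a b).image_sub_le_mul_sub_of_deriv_le (hcont n)
      (fun x hx => (hder n x hx).differentiableAt.differentiableWithinAt) (C := C * S)
      (fun x hx => by rw [(hder n x hx).deriv]; exact (abs_le.1 (hderb n x hx)).2) x hx y hy hxy
    have v := (convex_Icc a b).mul_sub_le_image_sub_of_le_deriv (hcont n)
      (fun x hx => (hder n x hx).differentiableAt.differentiableWithinAt) (C := -(C * S))
      (fun x hx => by rw [(hder n x hx).deriv]; exact (abs_le.1 (hderb n x hx)).1) x hx y hy hxy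
    have w : C * S * (y - x) ≤ S / 2 := by
      have : C * (y - x) ≤ 1 / 2 := by
        have : y - x ≤ 1 / (2 * C) := by
          have h1 := hx.1; have h2 := hy.2
          unfold dl at hab
          linarith
        calc C * (y - x) ≤ C * (1 / (2 * C)) := by gcongr
          _ = 1 / 2 := by field_simp
      nlinarith
    rw [abs_le]; constructor <;> linarith
  have hfin : ∀ x ∈ Icc a b, ∀ y ∈ Icc a b, Zf μ y ≤ Zf μ x + S / 2 := by
    intro x hx y hy
    refine le_of_tendsto_of_tendsto' (h.hz_tendsto y) ((h.hz_tendsto x).add_const (S/2)) ?_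
    intro n
    rcases le_total x y with hxy | hxy
    · have := (abs_le.1 (hstep x hx y hy hxy n)).2; linarith
    · have := (abs_le.1 (hstep y hy x hx hxy n)).1; linarith
  have hSle : S ≤ Zf μ s + S / 2 := by
    apply csSup_le (Set.Nonempty.image _ ⟨s, hs⟩)
    rintro _ ⟨y, hy, rfl⟩
    exact hfin s hs y hy
  linarith [hle t ht]

lemma Good.K2 (h : Good lw lx lv φ φM μ) {a b : ℝ} (ha : 0 ≤ a) (hlt : a < b)
    (hab : b - a ≤ dl lw lx lv φM) (hL : ∀ t ∈ Ioo a b, LB μ t) :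
    ∀ s ∈ Icc a b, ∀ t ∈ Icc a b, Zf μ t ≤ 2 * Zf μ s := by
  have hcomp : ∀ s t, s ∈ Ioo a b → t ∈ Ioo a b → s ≤ t → ∃ B, ∀ x ∈ Icc s t, Zf μ x ≤ B := by
    intro s t hs ht hst
    refine isCompact_Icc.induction_on (p := fun A => ∃ B, ∀ x ∈ A, Zf μ x ≤ B) ⟨0, by simp⟩ ?_ ?_ ?_
    · rintro A A' hAA ⟨B, hB⟩; exact ⟨B, fun x hx => hB x (hAA hx)⟩
    · rintro A A' ⟨B, hB⟩ ⟨B', hB'⟩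
      refine ⟨max B B', ?_⟩
      rintro x (hx | hx)
      · exact (hB x hx).trans (le_max_left _ _)
      · exact (hB' x hx).trans (le_max_right _ _)
    · intro x hx
      obtain ⟨B, hB⟩ := hL x ⟨hs.1.trans_le hx.1, hx.2.trans_lt ht.2⟩
      exact ⟨_, mem_nhdsWithin_of_mem_nhds hB, B, fun y hy => hy⟩
  have hopen : ∀ s ∈ Ioo a b, ∀ t ∈ Ioo a b, Zf μ t ≤ 2 * Zf μ s := by
    intro s hs t ht
    have hm : min s t ∈ Ioo a b := ⟨lt_min hs.1 ht.1, (min_le_left _ _).trans_lt hs.2⟩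
    have hM : max s t ∈ Ioo a b := ⟨hs.1.trans_le (le_max_left _ _), max_lt hs.2 ht.2⟩
    obtain ⟨B, hB⟩ := hcomp _ _ hm hM min_le_max
    refine h.K1 (ha.trans hm.1.le) ?_ hB s ⟨min_le_left _ _, le_max_left _ _⟩ t
      ⟨min_le_right _ _, le_max_right _ _⟩
    linarith [hm.1, hM.2]
  have hc : (a + b) / 2 ∈ Ioo a b := ⟨by linarith, by linarith⟩
  refine h.K1 ha hab (B := max (2 * Zf μ ((a + b) / 2)) (max (Zf μ a) (Zf μ b))) ?_
  intro t ht
  rcases eq_or_lt_of_le ht.1 with e | e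
  · rw [← e]; exact (le_max_left _ _).trans (le_max_right _ _)
  rcases eq_or_lt_of_le ht.2 with e' | e'
  · rw [e']; exact (le_max_right _ _).trans (le_max_right _ _)
  · exact (hopen _ hc t ⟨e, e'⟩).trans (le_max_left _ _)

lemma Good.Zf_max (h : Good lw lx lv φ φM μ) (t : ℝ) : Zf μ t = Zf μ (max t 0) := by
  rcases le_total t 0 with ht | ht
  · rw [max_eq_right ht]; unfold Zf; rw [h.neg t ht]
  · rw [max_eq_left ht]

lemma Good.allLB (h : Good lw lx lv φ φM μ) (t : ℝ) : LB μ t := by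
  by_contra hcon
  have := h.hlw; have := h.hlx; have := h.hlv; have := h.hφM
  have hdl : 0 < dl lw lx lv φM := by unfold dl; positivity
  set F : Set ℝ := {t | ¬ LB μ t} with hF
  have hFc : IsClosed F := by
    rw [← isOpen_compl_iff, isOpen_iff_mem_nhds]
    intro x hx
    simp only [hF, mem_compl_iff, mem_ofPred_eq, not_not] at hx
    obtain ⟨B, hB⟩ := hx
    filter_upwards [hB.eventually_nhds] with y hy
    simp only [hF, mem_compl_iff, mem_ofPred_eq, not_not]
    exact ⟨B, hy⟩
  have hF0 : ∀ x ∈ F, 0 ≤ x := by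
    intro x hx
    by_contra hx0
    push Not at hx0
    refine hx ⟨Zf μ 0, ?_⟩
    filter_upwards [Iio_mem_nhds hx0] with y hy
    rw [h.Zf_max, max_eq_right (le_of_lt (mem_Iio.1 hy))]
  have : CompleteSpace F := hFc.completeSpace_coe
  have : Nonempty F := ⟨⟨t, hcon⟩⟩
  obtain ⟨n, ⟨p, hpF⟩, hp⟩ := nonempty_interior_of_iUnion_of_closed (X := F)
    (f := fun n : ℕ => {x : F | Zf μ x ≤ n})
    (fun n => (h.closed_sub n).preimage continuous_subtype_val) (by
      ext x
      simp only [mem_iUnion, mem_ofPred_eq, mem_univ, iff_true]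
      exact exists_nat_ge _)
  rw [mem_interior_iff_mem_nhds, Metric.mem_nhds_iff] at hp
  obtain ⟨ε, hε, hball⟩ := hp
  have hball' : ∀ x ∈ F, |x - p| < ε → Zf μ x ≤ n := by
    intro x hx hxp
    have : (⟨x, hx⟩ : F) ∈ Metric.ball (⟨p, hpF⟩ : F) ε := by
      rw [Metric.mem_ball, Subtype.dist_eq, Real.dist_eq]; exact hxp
    exact hball this
  have hp0 := hF0 p hpF
  set η := min ε (dl lw lx lv φM) with hη
  have hηp : 0 < η := lt_min hε hdl
  have hη1 : η ≤ ε := min_le_left _ _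
  have hη2 : η ≤ dl lw lx lv φM := min_le_right _ _
  have main : ∀ x, 0 ≤ x → |x - p| < η → Zf μ x ≤ 2 * n := by
    intro x hx0 hx
    rw [abs_lt] at hx
    have hn : (0:ℝ) ≤ n := by positivity
    by_cases hxF : x ∈ F
    · have := hball' x hxF (by rw [abs_lt]; constructor <;> linarith)
      linarith
    rcases le_total p x with hpx | hpx
    · have hcomp : IsCompact (F ∩ Icc p x) := isCompact_Icc.inter_left hFc
      obtain ⟨a, ⟨haF, ha⟩, hmax⟩ := hcomp.exists_isGreatest ⟨p, hpF, le_refl _, hpx⟩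
      have hax : a < x := lt_of_le_of_ne ha.2 (fun e => hxF (e ▸ haF))
      have := h.K2 (hF0 a haF) hax (by linarith [ha.1]) (fun y hy => by
        by_contra hy'
        have := hmax ⟨hy', ha.1.trans hy.1.le, hy.2.le⟩
        linarith [hy.1]) a ⟨le_refl _, hax.le⟩ x ⟨hax.le, le_refl _⟩
      have h2 := hball' a haF (by rw [abs_lt]; constructor <;> linarith [ha.1, ha.2])
      linarith
    · have hcomp : IsCompact (F ∩ Icc x p) := isCompact_Icc.inter_left hFc
      obtain ⟨b, ⟨hbF, hb⟩, hmin⟩ := hcomp.exists_isLeast ⟨p, hpF, hpx, le_refl _⟩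
      have hxb : x < b := lt_of_le_of_ne hb.1 (fun e => hxF (e ▸ hbF))
      have := h.K2 hx0 hxb (by linarith [hb.2]) (fun y hy => by
        by_contra hy'
        have := hmin ⟨hy', hy.1.le, hy.2.le.trans hb.2⟩
        linarith [hy.2]) b ⟨hxb.le, le_refl _⟩ x ⟨le_refl _, hxb.le⟩
      have h2 := hball' b hbF (by rw [abs_lt]; constructor <;> linarith [hb.1, hb.2])
      linarith
  refine hpF ⟨2 * n, ?_⟩
  filter_upwards [Metric.ball_mem_nhds p hηp] with y hy
  rw [Metric.mem_ball, Real.dist_eq] at hy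
  rw [h.Zf_max]
  apply main _ (le_max_right _ _)
  rw [abs_lt] at hy ⊢
  constructor
  · linarith [le_max_left y 0]
  · rcases le_total y 0 with h0 | h0
    · rw [max_eq_right h0]; linarith
    · rw [max_eq_left h0]; linarith

end
end Herd

namespace Herd

open Topology

variable {d : ℕ}

section
variable {lw lx lv : ℝ} {φ : ℝ → ℝ} {φM : ℝ} {μ : ℝ → Measure (Phase d)}

lemma Good.cont2 (h : Good lw lx lv φ φM μ) {K : Phase d × Phase d → ℝ} (hK : Continuous K) {c : ℝ}
    (hc : ∀ p, |K p| ≤ c * (J p.1 + J p.2)) :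
    Continuous (fun q : ℝ × ℝ => ∫ p, K p ∂((μ q.1).prod (μ q.2))) := by
  rw [continuous_iff_continuousAt]
  rintro ⟨r, t⟩
  obtain ⟨B, hB⟩ := h.allLB r
  obtain ⟨B', hB'⟩ := h.allLB t
  have t1 : Tendsto (fun q : ℝ × ℝ => q.1) (𝓝 (r, t)) (𝓝 r) := continuous_fst.tendsto _
  have t2 : Tendsto (fun q : ℝ × ℝ => q.2) (𝓝 (r, t)) (𝓝 t) := continuous_snd.tendsto _
  refine h.tendsto2 t1 t2 (B := max B B') ?_ ?_ hK hc
  · filter_upwards [t1.eventually hB] with i hi using hi.trans (le_max_left _ _)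
  · filter_upwards [t2.eventually hB'] with i hi using hi.trans (le_max_right _ _)

lemma Good.hasDeriv_ext (h : Good lw lx lv φ φM μ) {f : Phase d → ℝ} (hf : ContDiff ℝ 1 f)
    {c : ℝ} (hc : 0 ≤ c) (hf1 : ∀ z, |f z| ≤ c * J z)
    (hf2 : ∀ z, ‖fderiv ℝ f z‖ ≤ c * (1 + ‖z‖)) {t0 : ℝ} (ht0 : 0 < t0) :
    HasDerivAt (fun t => ∫ z, f z ∂(μ t)) (∫ p, kf lw lx lv φ f p ∂((μ t0).prod (μ t0))) t0 := by
  have := h.hlw; have := h.hlx; have := h.hlv; have := h.hφM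
  set c0 := 1 + lw + lx * φM + lv * φM with hc0
  have hc0p : 0 < c0 := by positivity
  obtain ⟨ε, hε, B, hB⟩ := (h.allLB t0).open_nhds ht0
  have hB0 : 0 ≤ B := (Zf_nonneg t0).trans (hB t0 (Metric.mem_ball_self hε)).1
  let fn : ℕ → Phase d → ℝ := fun n z => f z * cut ((n:ℝ) + 1) z
  have hfn : ∀ n, ContDiff ℝ 1 (fn n) := fun n => hf.mul (cut_contDiff _)
  have hdiff : ∀ n : ℕ, ∀ p : Phase d × Phase d, |kf lw lx lv φ (fn n) p - kf lw lx lv φ f p| ≤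
      (30 * c * c0 / ((n:ℝ) + 1)) * (J p.1 + J p.2) ^ 2 := by
    intro n p
    set R : ℝ := (n:ℝ) + 1 with hR
    have hRp : 0 < R := by positivity
    have j1 := J_ge p.1
    have j2 := J_ge p.2
    have hd : HasFDerivAt (fn n) (f p.1 • fderiv ℝ (cut R) p.1 + cut R p.1 • fderiv ℝ f p.1) p.1 :=
      (hf.differentiable (by norm_num) p.1).hasFDerivAt.mul
        ((cut_contDiff R).differentiable (by norm_num) p.1).hasFDerivAt
    unfold kf
    rw [hd.fderiv, ← _root_.sub_apply, ← Real.norm_eq_abs]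
    refine (ContinuousLinearMap.le_opNorm _ _).trans ?_
    have e : f p.1 • fderiv ℝ (cut R) p.1 + cut R p.1 • fderiv ℝ f p.1 - fderiv ℝ f p.1 =
        f p.1 • fderiv ℝ (cut R) p.1 - (1 - cut R p.1) • fderiv ℝ f p.1 := by
      refine ContinuousLinearMap.ext fun b => ?_
      simp; ring
    have hn : ‖f p.1 • fderiv ℝ (cut R) p.1 + cut R p.1 • fderiv ℝ f p.1 - fderiv ℝ f p.1‖ ≤
        (10 * c / R) * J p.1 * (1 + ‖p.1‖) := by
      rw [e]
      refine (norm_sub_le _ _).trans ?_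
      rw [norm_smul, norm_smul, Real.norm_eq_abs, Real.norm_eq_abs,
        abs_of_nonneg (by linarith [cut_le_one hRp p.1] : 0 ≤ 1 - cut R p.1)]
      have a1 : |f p.1| * ‖fderiv ℝ (cut R) p.1‖ ≤ (c * J p.1) * (8 * ‖p.1‖ / R) :=
        mul_le_mul (hf1 _) (cut_fderiv_le hRp _) (norm_nonneg _) (by positivity)
      have a2 : (1 - cut R p.1) * ‖fderiv ℝ f p.1‖ ≤ (2 * J p.1 / R) * (c * (1 + ‖p.1‖)) :=
        mul_le_mul (one_sub_cut_le hRp _) (hf2 _) (norm_nonneg _) (by positivity)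
      have a3 : (c * J p.1) * (8 * ‖p.1‖ / R) ≤ (c * J p.1) * (8 * (1 + ‖p.1‖) / R) := by
        gcongr; linarith
      have a4 : (c * J p.1) * (8 * (1 + ‖p.1‖) / R) + (2 * J p.1 / R) * (c * (1 + ‖p.1‖)) =
        (10 * c / R) * J p.1 * (1 + ‖p.1‖) := by ring
      linarith
    calc _ ≤ ((10 * c / R) * J p.1 * (1 + ‖p.1‖)) * (c0 * (‖p.1‖ + ‖p.2‖)) :=
          mul_le_mul hn (h.bq_le p) (norm_nonneg _) (by positivity)
      _ = (10 * c * c0 / R) * J p.1 * ((1 + ‖p.1‖) * (‖p.1‖ + ‖p.2‖)) := by ring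
      _ ≤ (10 * c * c0 / R) * J p.1 * (3 * (J p.1 + J p.2)) := by
          refine mul_le_mul_of_nonneg_left ?_ (by positivity)
          exact arith1 (norm_nonneg _) (norm_nonneg _) j1 j2 (norm_sq_le_J _) (norm_sq_le_J _)
      _ ≤ (10 * c * c0 / R) * (J p.1 + J p.2) * (3 * (J p.1 + J p.2)) := by gcongr; linarith
      _ = _ := by ring
  have hL : ∀ n : ℕ, ∀ t ∈ Metric.ball t0 ε,
      |∫ p, kf lw lx lv φ f p ∂((μ t).prod (μ t)) - ∫ p, kf lw lx lv φ (fn n) p ∂((μ t).prod (μ t))|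
        ≤ (30 * c * c0 * (4 * B)) / ((n:ℝ) + 1) := by
    intro n t ht
    have k1 := h.kf_cont hf
    have k2 := h.kf_cont (hfn n)
    rw [abs_sub_comm, ← integral_sub (h.int2 t t k2) (h.int2 t t k1)]
    refine abs_integral_le_integral_abs.trans ?_
    calc _ ≤ ∫ p : Phase d × Phase d, (30 * c * c0 / ((n:ℝ) + 1)) * (J p.1 + J p.2) ^ 2
            ∂((μ t).prod (μ t)) :=
          integral_mono (h.int2 t t (k2.sub k1).abs) (h.int2 t t (by fun_prop)) (hdiff n)
      _ = (30 * c * c0 / ((n:ℝ) + 1)) * ∫ p : Phase d × Phase d, (J p.1 + J p.2) ^ 2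
            ∂((μ t).prod (μ t)) := integral_const_mul _ _
      _ ≤ (30 * c * c0 / ((n:ℝ) + 1)) * (4 * B) := by
          have := h.sq_int t t
          have := (hB t ht).1
          gcongr
          linarith
      _ = _ := by ring
  refine hasDerivAt_of_tendstoUniformlyOn (l := atTop) (f := fun (n : ℕ) t => ∫ z, fn n z ∂(μ t))
    (f' := fun (n : ℕ) t => ∫ p, kf lw lx lv φ (fn n) p ∂((μ t).prod (μ t)))
    (g' := fun t => ∫ p, kf lw lx lv φ f p ∂((μ t).prod (μ t)))
    (s := Metric.ball t0 ε) Metric.isOpen_ball ?_ ?_ ?_ (Metric.mem_ball_self hε)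
  · rw [Metric.tendstoUniformlyOn_iff]
    intro δ hδ
    have hlim : Tendsto (fun n : ℕ => (30 * c * c0 * (4 * B)) / ((n:ℝ) + 1)) atTop (𝓝 0) :=
      Tendsto.div_atTop tendsto_const_nhds
        (tendsto_atTop_add_const_right _ _ tendsto_natCast_atTop_atTop)
    filter_upwards [hlim.eventually (gt_mem_nhds hδ)] with n hn t ht
    rw [Real.dist_eq]
    exact (hL n t ht).trans_lt hn
  · refine Eventually.of_forall fun n t ht => ?_
    exact h.hasDeriv_cc (hfn n) (mul_cut_compact (by positivity) f) (hB t ht).2 (h.allLB t)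
  · intro t ht
    refine tendsto_integral_of_dominated_convergence (fun z => |f z|) ?_ ?_ ?_ ?_
    · intro n; exact (h.int t (hfn n).continuous).aestronglyMeasurable
    · exact h.int t hf.continuous.abs
    · intro n
      refine Eventually.of_forall fun z => ?_
      simp only [fn]
      rw [Real.norm_eq_abs, abs_mul, abs_of_nonneg (cut_nonneg _ _)]
      have := cut_le_one (R := (n:ℝ) + 1) (by positivity) z
      nlinarith [abs_nonneg (f z)]
    · refine Eventually.of_forall fun z => ?_
      have := (cut_tendsto z).const_mul (f z)
      simpa [fn] using this

/-! ### The potential -/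

def Psi (φ : ℝ → ℝ) (s : ℝ) : ℝ := (1 / 2) * ∫ u in (0:ℝ)..s, φ (Real.sqrt u)

lemma Good.Psi_deriv (h : Good lw lx lv φ φM μ) (s : ℝ) :
    HasDerivAt (Psi φ) ((1 / 2) * φ (Real.sqrt s)) s := by
  have hc : Continuous fun u => φ (Real.sqrt u) := h.hφc.comp Real.continuous_sqrt
  exact (intervalIntegral.integral_hasDerivAt_right (hc.intervalIntegrable _ _)
      (hc.stronglyMeasurableAtFilter _ _) hc.continuousAt).const_mul _

lemma Good.Psi_contDiff (h : Good lw lx lv φ φM μ) : ContDiff ℝ 1 (Psi φ) := by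
  rw [contDiff_one_iff_deriv]
  refine ⟨fun x => (h.Psi_deriv x).differentiableAt, ?_⟩
  have : deriv (Psi φ) = fun x => (1 / 2) * φ (Real.sqrt x) := funext fun x => (h.Psi_deriv x).deriv
  rw [this]
  exact continuous_const.mul (h.hφc.comp Real.continuous_sqrt)

lemma Good.Psi_nonneg (h : Good lw lx lv φ φM μ) {s : ℝ} (hs : 0 ≤ s) : 0 ≤ Psi φ s := by
  unfold Psi
  have := intervalIntegral.integral_nonneg (μ := volume) (f := fun u => φ (Real.sqrt u)) hs
    (fun u _ => (h.hφ _).1)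
  linarith

lemma Good.Psi_le (h : Good lw lx lv φ φM μ) {s : ℝ} (hs : 0 ≤ s) : |Psi φ s| ≤ φM * s := by
  have := h.hφM
  have hb : ‖∫ u in (0:ℝ)..s, φ (Real.sqrt u)‖ ≤ φM * |s - 0| :=
    intervalIntegral.norm_integral_le_of_norm_le_const fun u _ => by
      rw [Real.norm_eq_abs, abs_of_nonneg (h.hφ _).1]; exact (h.hφ _).2
  rw [sub_zero, abs_of_nonneg hs, Real.norm_eq_abs] at hb
  unfold Psi
  rw [abs_mul, abs_of_nonneg (by norm_num)]
  linarith [abs_nonneg (∫ u in (0:ℝ)..s, φ (Real.sqrt u))]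

def kk (φ : ℝ → ℝ) (p : Phase d × Phase d) : ℝ := Phifun φ ‖p.1.1 - p.2.1‖

def kap (φ : ℝ → ℝ) (p : Phase d × Phase d) : ℝ :=
  φ ‖p.1.1 - p.2.1‖ * ⟪p.1.1 - p.2.1, p.1.2⟫

lemma kk_eq (φ : ℝ → ℝ) (p : Phase d × Phase d) : kk φ p = Psi φ (‖p.1.1 - p.2.1‖ ^ 2) := rfl

lemma Good.kk_cont (h : Good lw lx lv φ φM μ) : Continuous (kk φ : Phase d × Phase d → ℝ) := by
  have : Continuous (Psi φ) := h.Psi_contDiff.continuous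
  have e : (kk φ : Phase d × Phase d → ℝ) = fun p => Psi φ (‖p.1.1 - p.2.1‖ ^ 2) := rfl
  rw [e]; fun_prop

lemma Good.kap_cont (h : Good lw lx lv φ φM μ) : Continuous (kap φ : Phase d × Phase d → ℝ) := by
  have := h.hφc
  unfold kap; fun_prop

lemma diff_sq_le (p : Phase d × Phase d) : ‖p.1.1 - p.2.1‖ ^ 2 ≤ 2 * (J p.1 + J p.2) := by
  have h1 := norm_sub_le p.1.1 p.2.1
  unfold J
  have : ‖p.1.1 - p.2.1‖ ^ 2 ≤ (‖p.1.1‖ + ‖p.2.1‖) ^ 2 := by gcongr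
  nlinarith [sq_nonneg (‖p.1.1‖ - ‖p.2.1‖), sq_nonneg ‖p.1.2‖, sq_nonneg ‖p.2.2‖]

lemma Good.kk_le (h : Good lw lx lv φ φM μ) (p : Phase d × Phase d) :
    |kk φ p| ≤ (2 * φM) * (J p.1 + J p.2) := by
  rw [kk_eq]
  refine (h.Psi_le (sq_nonneg _)).trans ?_
  have := h.hφM
  calc _ ≤ φM * (2 * (J p.1 + J p.2)) := by gcongr; exact diff_sq_le p
    _ = _ := by ring

lemma Good.kap_le (h : Good lw lx lv φ φM μ) (p : Phase d × Phase d) :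
    |kap φ p| ≤ (3 * φM) * (J p.1 + J p.2) := by
  have := h.hφM
  unfold kap
  rw [abs_mul, abs_of_nonneg (h.hφ _).1]
  have h2 : |⟪p.1.1 - p.2.1, p.1.2⟫| ≤ 3 * (J p.1 + J p.2) := by
    refine (abs_real_inner_le_norm _ _).trans ?_
    have a := diff_sq_le p
    have b : ‖p.1.2‖ ^ 2 ≤ J p.1 := by unfold J; nlinarith [sq_nonneg ‖p.1.1‖]
    have c := J_ge p.2
    have c1 := J_ge p.1
    nlinarith [sq_nonneg (‖p.1.1 - p.2.1‖ - ‖p.1.2‖)]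
  calc _ ≤ φM * (3 * (J p.1 + J p.2)) :=
        mul_le_mul (h.hφ _).2 h2 (abs_nonneg _) this.le
    _ = _ := by ring

lemma Good.kk_fderiv (h : Good lw lx lv φ φM μ) (z w : Phase d) :
    HasFDerivAt (fun z : Phase d => kk φ (z, w))
      ((φ ‖z.1 - w.1‖) • (innerSL ℝ (z.1 - w.1)).comp (ContinuousLinearMap.fst ℝ (Euc d) (Euc d))) z := by
  have h1 : HasFDerivAt (fun z : Phase d => ‖z.1 - w.1‖ ^ 2)
      (2 • (innerSL ℝ (z.1 - w.1)).comp (ContinuousLinearMap.fst ℝ (Euc d) (Euc d))) z :=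
    ((hasFDerivAt_fst (p := z)).sub_const w.1).norm_sq
  have h2 := (h.Psi_deriv (‖z.1 - w.1‖ ^ 2)).comp_hasFDerivAt z h1
  refine HasFDerivAt.congr_fderiv (f := fun z : Phase d => kk φ (z, w)) h2 ?_
  rw [Real.sqrt_sq (norm_nonneg _)]
  ext b
  · simp; ring
  · simp

lemma Good.kk_contDiff (h : Good lw lx lv φ φM μ) (w : Phase d) :
    ContDiff ℝ 1 (fun z : Phase d => kk φ (z, w)) := by
  have h1 : ContDiff ℝ 1 (fun z : Phase d => ‖z.1 - w.1‖ ^ 2) :=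
    (contDiff_fst.sub contDiff_const).norm_sq ℝ
  have e : (fun z : Phase d => kk φ (z, w)) = Psi φ ∘ (fun z : Phase d => ‖z.1 - w.1‖ ^ 2) := rfl
  rw [e]
  exact h.Psi_contDiff.comp h1

lemma Good.kk_deriv (h : Good lw lx lv φ φM μ) (w : Phase d) {t0 : ℝ} (ht0 : 0 < t0) :
    HasDerivAt (fun t => ∫ z, kk φ (z, w) ∂(μ t)) (∫ z, kap φ (z, w) ∂(μ t0)) t0 := by
  have hM := h.hφM
  have e : ∫ z, kap φ (z, w) ∂(μ t0) =
      ∫ p, kf lw lx lv φ (fun z : Phase d => kk φ (z, w)) p ∂((μ t0).prod (μ t0)) := by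
    rw [← h.int_fst t0 t0 (fun z => kap φ (z, w))]
    congr 1
    ext p
    unfold kf
    rw [(h.kk_fderiv p.1 w).fderiv]
    simp [kap, bq, inner_sub_left]
  rw [e]
  have jw := J_ge w
  have hcc : (0:ℝ) ≤ 4 * φM * (J w + ‖w‖) := by positivity
  refine h.hasDeriv_ext (h.kk_contDiff w) (c := 4 * φM * (J w + ‖w‖)) hcc ?_ ?_ ht0
  · intro z
    refine (h.kk_le (z, w)).trans ?_
    have jz := J_ge z
    simp only
    have : J z + J w ≤ 2 * (J w * J z) := by nlinarith
    calc 2 * φM * (J z + J w) ≤ 2 * φM * (2 * (J w * J z)) := by gcongr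
      _ = 4 * φM * (J w + 0) * J z := by ring
      _ ≤ _ := by gcongr; positivity
  · intro z
    rw [(h.kk_fderiv z w).fderiv]
    refine ContinuousLinearMap.opNorm_le_bound _ (by positivity) ?_
    intro b
    simp only [_root_.smul_apply, ContinuousLinearMap.comp_apply, ContinuousLinearMap.coe_fst',
      innerSL_apply_apply, smul_eq_mul]
    rw [Real.norm_eq_abs, abs_mul, abs_of_nonneg (h.hφ _).1]
    have h1 : ‖z.1 - w.1‖ ≤ ‖z‖ + ‖w‖ := (norm_sub_le _ _).trans
      (add_le_add (norm_fst_le z) (norm_fst_le w))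
    calc _ ≤ φM * ((‖z‖ + ‖w‖) * ‖b‖) := by
          refine mul_le_mul (h.hφ _).2 ((abs_real_inner_le_norm _ _).trans ?_) (abs_nonneg _) hM.le
          gcongr
          exact norm_fst_le b
      _ ≤ φM * (((J w + ‖w‖) * (1 + ‖z‖)) * ‖b‖) := by
          gcongr
          nlinarith [norm_nonneg z, norm_nonneg w, mul_nonneg (norm_nonneg w) (norm_nonneg z)]
      _ ≤ (4 * φM) * (((J w + ‖w‖) * (1 + ‖z‖)) * ‖b‖) := by gcongr; linarith
      _ = _ := by ring

def NN (φ : ℝ → ℝ) (μ : ℝ → Measure (Phase d)) (r t : ℝ) : ℝ := ∫ p, kk φ p ∂((μ r).prod (μ t))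
def nn (φ : ℝ → ℝ) (μ : ℝ → Measure (Phase d)) (r t : ℝ) : ℝ := ∫ p, kap φ p ∂((μ r).prod (μ t))

lemma Good.NN_symm (h : Good lw lx lv φ φM μ) (r t : ℝ) : NN φ μ r t = NN φ μ t r := by
  have := h.prob t; have := h.prob r
  unfold NN
  rw [← integral_prod_swap]
  congr 1
  ext p
  simp [kk, norm_sub_rev]

lemma Good.J_int_le (h : Good lw lx lv φ φM μ) (t : ℝ) : ∫ z, J z ∂(μ t) ≤ Zf μ t := by
  refine integral_mono (h.int t (by fun_prop)) (h.int t (by fun_prop)) ?_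
  intro z
  have := J_ge z
  simp only; nlinarith

lemma Good.NN_deriv (h : Good lw lx lv φ φM μ) {r0 : ℝ} (hr0 : 0 < r0) (t : ℝ) :
    HasDerivAt (fun r => NN φ μ r t) (nn φ μ r0 t) r0 := by
  have hM := h.hφM
  have := h.prob t
  obtain ⟨ε, hε, B, hB⟩ := (h.allLB r0).open_nhds hr0
  have e1 : ∀ r, NN φ μ r t = ∫ w, ∫ z, kk φ (z, w) ∂(μ r) ∂(μ t) := by
    intro r
    have := h.prob r
    exact integral_prod_symm _ (h.int2 r t h.kk_cont)
  have e2 : ∀ r, nn φ μ r t = ∫ w, ∫ z, kap φ (z, w) ∂(μ r) ∂(μ t) := by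
    intro r
    have := h.prob r
    exact integral_prod_symm _ (h.int2 r t h.kap_cont)
  rw [e2, funext e1]
  have i1 : ∀ r, Integrable (fun w => ∫ z, kk φ (z, w) ∂(μ r)) (μ t) := by
    intro r
    have := h.prob r
    exact (h.int2 r t h.kk_cont).integral_prod_right
  have i2 : ∀ r, Integrable (fun w => ∫ z, kap φ (z, w) ∂(μ r)) (μ t) := by
    intro r
    have := h.prob r
    exact (h.int2 r t h.kap_cont).integral_prod_right
  refine (hasDerivAt_integral_of_dominated_loc_of_deriv_le (s := Metric.ball r0 ε)
    (bound := fun w => 3 * φM * (B + J w)) (F := fun r w => ∫ z, kk φ (z, w) ∂(μ r))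
    (F' := fun r w => ∫ z, kap φ (z, w) ∂(μ r))
    (Metric.ball_mem_nhds _ hε) ?_ (i1 r0) (i2 r0).aestronglyMeasurable ?_ ?_ ?_).2
  · exact Eventually.of_forall fun r => (i1 r).aestronglyMeasurable
  · refine Eventually.of_forall fun w r hr => ?_
    have := h.prob r
    rw [Real.norm_eq_abs]
    refine abs_integral_le_integral_abs.trans ?_
    have hc : Continuous fun z : Phase d => kap φ (z, w) := h.kap_cont.comp (by fun_prop)
    calc _ ≤ ∫ z, 3 * φM * (J z + J w) ∂(μ r) :=
          integral_mono (h.int r hc.abs) (h.int r (by fun_prop)) (fun z => h.kap_le (z, w))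
      _ = 3 * φM * (∫ z, J z ∂(μ r) + J w) := by
          rw [integral_const_mul, integral_add (h.int r (by fun_prop)) (h.int r (by fun_prop))]
          simp
      _ ≤ _ := by
          have := (h.J_int_le r).trans (hB r hr).1
          gcongr
  · exact h.int t (by fun_prop)
  · exact Eventually.of_forall fun w r hr => h.kk_deriv w (hB r hr).2

lemma Good.M_deriv (h : Good lw lx lv φ φM μ) {t0 : ℝ} (ht0 : 0 < t0) :
    HasDerivAt (fun t => NN φ μ t t) (2 * nn φ μ t0 t0) t0 := by
  have hsplit : (fun t => NN φ μ t t) = fun t => (NN φ μ t t - NN φ μ t0 t) + NN φ μ t t0 := by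
    ext t; rw [h.NN_symm t0 t]; ring
  rw [hsplit, two_mul]
  refine HasDerivAt.add ?_ (h.NN_deriv ht0 t0)
  rw [hasDerivAt_iff_isLittleO, Asymptotics.isLittleO_iff]
  intro ε hε
  have hc := (h.cont2 h.kap_cont h.kap_le).tendsto (t0, t0)
  have hc' := hc.eventually (Metric.ball_mem_nhds _ hε)
  rw [nhds_prod_eq, (Filter.HasBasis.prod_self Metric.nhds_basis_ball).eventually_iff] at hc'
  obtain ⟨δ, hδ, hb⟩ := hc'
  set δ' := min δ t0 with hδ'
  have hδp : 0 < δ' := lt_min hδ ht0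
  filter_upwards [Metric.ball_mem_nhds t0 hδp] with t ht
  have hpos : ∀ r ∈ Metric.ball t0 δ', 0 < r := by
    intro r hr
    rw [Metric.mem_ball, Real.dist_eq, abs_lt] at hr
    linarith [min_le_right δ t0]
  have hsub : Metric.ball t0 δ' ⊆ Metric.ball t0 δ := Metric.ball_subset_ball (min_le_left _ _)
  have key := (convex_ball t0 δ').norm_image_sub_le_of_norm_hasDerivWithin_le
    (f := fun r => NN φ μ r t - r * nn φ μ t0 t0) (f' := fun r => nn φ μ r t - 1 * nn φ μ t0 t0)
    (C := ε) (fun r hr => ((h.NN_deriv (hpos r hr) t).sub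
      ((hasDerivAt_id r).mul_const _)).hasDerivWithinAt) (fun r hr => by
        have := @hb (r, t) ⟨hsub hr, hsub ht⟩
        simp only [Metric.mem_ball, dist_eq_norm] at this
        rw [one_mul]
        exact this.le) (Metric.mem_ball_self hδp) ht
  simp only [sub_self, sub_zero, smul_eq_mul]
  refine le_trans (le_of_eq ?_) key
  congr 1
  ring

end
end Herd

namespace Herd

open Topology

variable {d : ℕ}

section
variable {lw lx lv : ℝ} {φ : ℝ → ℝ} {φM : ℝ} {μ : ℝ → Measure (Phase d)}

def fE (lw : ℝ) (z : Phase d) : ℝ := lw * ‖z.1‖ ^ 2 + ‖z.2‖ ^ 2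

lemma fE_contDiff (lw : ℝ) : ContDiff ℝ 1 (fE lw : Phase d → ℝ) := by
  unfold fE
  exact (contDiff_const.mul (contDiff_fst.norm_sq ℝ)).add (contDiff_snd.norm_sq ℝ)

lemma fE_fderiv_apply (lw : ℝ) (z b : Phase d) :
    fderiv ℝ (fE lw) z b = 2 * lw * ⟪z.1, b.1⟫ + 2 * ⟪z.2, b.2⟫ := by
  have h1 : HasFDerivAt (fun z : Phase d => ‖z.1‖ ^ 2)
      (2 • (innerSL ℝ z.1).comp (ContinuousLinearMap.fst ℝ (Euc d) (Euc d))) z :=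
    (hasFDerivAt_fst (p := z)).norm_sq
  have h2 : HasFDerivAt (fun z : Phase d => ‖z.2‖ ^ 2)
      (2 • (innerSL ℝ z.2).comp (ContinuousLinearMap.snd ℝ (Euc d) (Euc d))) z :=
    (hasFDerivAt_snd (p := z)).norm_sq
  have h3 : HasFDerivAt (fE lw) _ z := (h1.const_mul lw).add h2
  rw [h3.fderiv]
  simp
  ring

lemma fE_fderiv_le {lw : ℝ} (hlw : 0 < lw) (z : Phase d) :
    ‖fderiv ℝ (fE lw) z‖ ≤ (2 * lw + 2) * (1 + ‖z‖) := by
  refine ContinuousLinearMap.opNorm_le_bound _ (by positivity) ?_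
  intro b
  rw [fE_fderiv_apply, Real.norm_eq_abs]
  have a1 := abs_real_inner_le_norm z.1 b.1
  have a2 := abs_real_inner_le_norm z.2 b.2
  have b1 : ‖z.1‖ * ‖b.1‖ ≤ (1 + ‖z‖) * ‖b‖ :=
    mul_le_mul ((norm_fst_le z).trans (by linarith)) (norm_fst_le b) (norm_nonneg _) (by positivity)
  have b2 : ‖z.2‖ * ‖b.2‖ ≤ (1 + ‖z‖) * ‖b‖ :=
    mul_le_mul ((norm_snd_le z).trans (by linarith)) (norm_snd_le b) (norm_nonneg _) (by positivity)
  calc _ ≤ |2 * lw * ⟪z.1, b.1⟫| + |2 * ⟪z.2, b.2⟫| := abs_add_le _ _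
    _ = 2 * lw * |⟪z.1, b.1⟫| + 2 * |⟪z.2, b.2⟫| := by
        rw [abs_mul, abs_mul, abs_mul, abs_of_pos hlw, abs_of_pos (two_pos : (0:ℝ) < 2)]
    _ ≤ 2 * lw * ((1 + ‖z‖) * ‖b‖) + 2 * ((1 + ‖z‖) * ‖b‖) := by
        gcongr
        · exact a1.trans b1
        · exact a2.trans b2
    _ = _ := by ring

lemma fE_le {lw : ℝ} (hlw : 0 < lw) (z : Phase d) : |fE lw z| ≤ (2 * lw + 2) * J z := by
  unfold fE J
  rw [abs_of_nonneg (by positivity)]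
  nlinarith [mul_nonneg hlw.le (sq_nonneg ‖z.1‖), mul_nonneg hlw.le (sq_nonneg ‖z.2‖),
    sq_nonneg ‖z.1‖, sq_nonneg ‖z.2‖]

def g1 (p : Phase d × Phase d) : ℝ := ⟪p.1.2, p.2.1⟫
def g2 (φ : ℝ → ℝ) (p : Phase d × Phase d) : ℝ := φ ‖p.1.1 - p.2.1‖ * ⟪p.1.2, p.2.2 - p.1.2⟫
def g3 (φ : ℝ → ℝ) (p : Phase d × Phase d) : ℝ := φ ‖p.1.1 - p.2.1‖ * ‖p.1.2 - p.2.2‖ ^ 2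

lemma kf_fE (p : Phase d × Phase d) : kf lw lx lv φ (fE lw) p =
    2 * lw * g1 p - 2 * lx * kap φ p + 2 * lv * g2 φ p := by
  unfold kf
  rw [fE_fderiv_apply]
  simp only [bq, g1, g2, kap, inner_add_right, inner_smul_right, inner_sub_right, inner_sub_left]
  rw [real_inner_comm p.1.1 p.1.2, real_inner_comm p.1.2 p.2.1]
  ring

lemma g1_cont : Continuous (g1 : Phase d × Phase d → ℝ) := by
  unfold g1; fun_prop

lemma Good.g2_cont (h : Good lw lx lv φ φM μ) : Continuous (g2 φ : Phase d × Phase d → ℝ) := by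
  have := h.hφc
  unfold g2; fun_prop

lemma Good.g3_cont (h : Good lw lx lv φ φM μ) : Continuous (g3 φ : Phase d × Phase d → ℝ) := by
  have := h.hφc
  unfold g3; fun_prop

lemma Good.g3_le (h : Good lw lx lv φ φM μ) (p : Phase d × Phase d) :
    |g3 φ p| ≤ (2 * φM) * (J p.1 + J p.2) := by
  have := h.hφM
  have h1 := norm_sub_le p.1.2 p.2.2
  have h2 : ‖p.1.2 - p.2.2‖ ^ 2 ≤ (‖p.1.2‖ + ‖p.2.2‖) ^ 2 := by gcongr
  have h3 : ‖p.1.2 - p.2.2‖ ^ 2 ≤ 2 * (J p.1 + J p.2) := by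
    unfold J
    nlinarith [sq_nonneg (‖p.1.2‖ - ‖p.2.2‖), sq_nonneg ‖p.1.1‖, sq_nonneg ‖p.2.1‖]
  unfold g3
  rw [abs_of_nonneg (mul_nonneg (h.hφ _).1 (sq_nonneg _))]
  calc _ ≤ φM * (2 * (J p.1 + J p.2)) := mul_le_mul (h.hφ _).2 h3 (sq_nonneg _) this.le
    _ = _ := by ring

lemma g2_swap (φ : ℝ → ℝ) (p : Phase d × Phase d) : g2 φ p + g2 φ p.swap = - g3 φ p := by
  simp only [g2, g3, Prod.fst_swap, Prod.snd_swap]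
  rw [norm_sub_rev p.2.1 p.1.1, ← real_inner_self_eq_norm_sq]
  simp only [inner_sub_left, inner_sub_right]
  rw [real_inner_comm p.1.2 p.2.2]
  ring

lemma Good.g2_int (h : Good lw lx lv φ φM μ) (t : ℝ) :
    2 * ∫ p, g2 φ p ∂((μ t).prod (μ t)) = - ∫ p, g3 φ p ∂((μ t).prod (μ t)) := by
  have := h.prob t
  have e : ∫ p, g2 φ p ∂((μ t).prod (μ t)) = ∫ p, g2 φ p.swap ∂((μ t).prod (μ t)) :=
    (integral_prod_swap _).symm
  have hc : Continuous fun p : Phase d × Phase d => g2 φ p.swap := h.g2_cont.comp continuous_swap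
  rw [two_mul]
  nth_rewrite 2 [e]
  rw [← integral_add (h.int2 t t h.g2_cont) (h.int2 t t hc), ← integral_neg]
  exact integral_congr_ae (Eventually.of_forall fun p => g2_swap φ p)

lemma Good.g1_int (h : Good lw lx lv φ φM μ) (t : ℝ) (hx : ∫ z, z.1 ∂(μ t) = 0) :
    ∫ p, g1 p ∂((μ t).prod (μ t)) = 0 := by
  have := h.prob t
  rw [integral_prod _ (h.int2 t t g1_cont)]
  have : ∀ z : Phase d, ∫ w, g1 (z, w) ∂(μ t) = 0 := by
    intro z
    have := integral_inner (𝕜 := ℝ) (h.int t (F := fun w : Phase d => w.1) (by fun_prop)) z.2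
    unfold g1
    simp only
    rw [this, hx, inner_zero_right]
  simp [this]

lemma Good.Vphi_eq (h : Good lw lx lv φ φM μ) (t : ℝ) :
    Vphi φ μ t = ∫ p, g3 φ p ∂((μ t).prod (μ t)) := by
  have := h.prob t
  rw [integral_prod _ (h.int2 t t h.g3_cont)]
  rfl

lemma Good.Mfun_eq (h : Good lw lx lv φ φM μ) (t : ℝ) : Mfun φ μ t = NN φ μ t t := by
  have := h.prob t
  unfold NN
  rw [integral_prod _ (h.int2 t t h.kk_cont)]
  rfl

lemma Good.XV_eq (h : Good lw lx lv φ φM μ) (t : ℝ) :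
    lw * Xfun μ t + Vfun μ t = ∫ z, fE lw z ∂(μ t) := by
  unfold fE Xfun Vfun
  rw [integral_add (h.int t (by fun_prop)) (h.int t (by fun_prop)), integral_const_mul]

def En (lw lx : ℝ) (φ : ℝ → ℝ) (μ : ℝ → Measure (Phase d)) (t : ℝ) : ℝ :=
  lw * Xfun μ t + Vfun μ t + lx * Mfun φ μ t

lemma Good.En_eq (h : Good lw lx lv φ φM μ) (t : ℝ) :
    En lw lx φ μ t = ∫ z, fE lw z ∂(μ t) + lx * NN φ μ t t := by
  unfold En
  rw [h.XV_eq, h.Mfun_eq]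

lemma Good.En_deriv (h : Good lw lx lv φ φM μ) {t : ℝ} (ht : 0 < t)
    (hx : ∫ z, z.1 ∂(μ t) = 0) :
    HasDerivAt (En lw lx φ μ) (-(lv * Vphi φ μ t)) t := by
  have hlw := h.hlw
  rw [funext h.En_eq]
  have d1 := h.hasDeriv_ext (fE_contDiff lw) (c := 2 * lw + 2) (by positivity) (fE_le hlw)
    (fE_fderiv_le hlw) ht
  have d2 := (h.M_deriv ht).const_mul lx
  refine (d1.add d2).congr_deriv ?_
  have i1 := h.int2 t t (g1_cont (d := d))
  have i2 := h.int2 t t h.kap_cont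
  have i3 := h.int2 t t h.g2_cont
  have i4 : Integrable (fun p => 2 * lw * g1 p - 2 * lx * kap φ p) ((μ t).prod (μ t)) :=
    (i1.const_mul _).sub (i2.const_mul _)
  have e : ∫ p, kf lw lx lv φ (fE lw) p ∂((μ t).prod (μ t)) =
      2 * lw * ∫ p, g1 p ∂((μ t).prod (μ t)) - 2 * lx * nn φ μ t t
        + 2 * lv * ∫ p, g2 φ p ∂((μ t).prod (μ t)) := by
    rw [integral_congr_ae (Eventually.of_forall fun p => kf_fE p)]
    rw [integral_add i4 (i3.const_mul _),
      integral_sub (i1.const_mul _) (i2.const_mul _), integral_const_mul, integral_const_mul,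
      integral_const_mul]
    rfl
  rw [e, h.g1_int t hx, h.Vphi_eq]
  linear_combination lv * h.g2_int t

lemma Good.Vphi_cont (h : Good lw lx lv φ φM μ) : Continuous (Vphi φ μ) := by
  rw [funext h.Vphi_eq]
  exact (h.cont2 h.g3_cont h.g3_le).comp (continuous_id.prodMk continuous_id)

lemma Good.En_cont (h : Good lw lx lv φ φM μ) : Continuous (En lw lx φ μ) := by
  rw [funext h.En_eq]
  have hlw := h.hlw
  have c1 : Continuous fun t => NN φ μ t t :=
    (h.cont2 h.kk_cont h.kk_le).comp (continuous_id.prodMk continuous_id)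
  have c2 : Continuous fun t => ∫ z, fE lw z ∂(μ t) := by
    have := (h.cont2 (K := fun p => fE lw p.1) (c := 2 * lw + 2)
      ((fE_contDiff lw).continuous.comp continuous_fst) (fun p => by
        refine (fE_le hlw p.1).trans ?_
        have := J_ge p.2
        gcongr
        linarith)).comp (continuous_id.prodMk continuous_id)
    refine this.congr fun t => ?_
    exact h.int_fst t t (fE lw)
  exact c2.add (continuous_const.mul c1)

lemma Good.Vphi_nonneg (h : Good lw lx lv φ φM μ) (t : ℝ) : 0 ≤ Vphi φ μ t :=
  integral_nonneg fun _ => integral_nonneg fun _ => mul_nonneg (h.hφ _).1 (sq_nonneg _)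

lemma Good.En_nonneg (h : Good lw lx lv φ φM μ) (t : ℝ) : 0 ≤ En lw lx φ μ t := by
  have a : 0 ≤ Xfun μ t := integral_nonneg fun _ => sq_nonneg _
  have b : 0 ≤ Vfun μ t := integral_nonneg fun _ => sq_nonneg _
  have c : 0 ≤ Mfun φ μ t := integral_nonneg fun z => integral_nonneg fun w =>
    h.Psi_nonneg (sq_nonneg ‖z.1 - w.1‖)
  have := h.hlw; have := h.hlx
  unfold En
  positivity

lemma Good.En_derivWithin (h : Good lw lx lv φ φM μ) (hx : ∀ t, ∫ z, z.1 ∂(μ t) = 0) {t : ℝ}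
    (ht : 0 ≤ t) : HasDerivWithinAt (En lw lx φ μ) (-(lv * Vphi φ μ t)) (Ici 0) t := by
  rcases ht.eq_or_lt with rfl | ht
  · refine hasDerivWithinAt_Ici_of_tendsto_deriv (s := Ioi 0) ?_ h.En_cont.continuousWithinAt
      self_mem_nhdsWithin ?_
    · intro s hs
      exact (h.En_deriv hs (hx s)).differentiableAt.differentiableWithinAt
    · have hc : Tendsto (fun s => -(lv * Vphi φ μ s)) (𝓝[>] 0) (𝓝 (-(lv * Vphi φ μ 0))) :=
        ((continuous_const.mul h.Vphi_cont).neg.tendsto 0).mono_left nhdsWithin_le_nhds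
      refine hc.congr' ?_
      filter_upwards [self_mem_nhdsWithin] with s hs
      exact (h.En_deriv hs (hx s)).deriv.symm
  · exact (h.En_deriv ht (hx t)).hasDerivWithinAt

lemma Good.En_anti (h : Good lw lx lv φ φM μ) (hx : ∀ t, ∫ z, z.1 ∂(μ t) = 0) :
    AntitoneOn (En lw lx φ μ) (Ici 0) := by
  refine antitoneOn_of_deriv_nonpos (convex_Ici 0) h.En_cont.continuousOn ?_ ?_
  · intro s hs
    rw [interior_Ici] at hs
    exact (h.En_deriv hs (hx s)).differentiableAt.differentiableWithinAt
  · intro s hs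
    rw [interior_Ici] at hs
    rw [(h.En_deriv hs (hx s)).deriv]
    have := mul_nonneg h.hlv.le (h.Vphi_nonneg s)
    linarith

lemma Good.En_lim (h : Good lw lx lv φ φM μ) (hx : ∀ t, ∫ z, z.1 ∂(μ t) = 0) :
    ∃ L : ℝ, 0 ≤ L ∧ Tendsto (En lw lx φ μ) atTop (𝓝 L) := by
  have ha : Antitone fun t => En lw lx φ μ (max t 0) := fun s t hst =>
    h.En_anti hx (mem_Ici.2 (le_max_right _ _)) (mem_Ici.2 (le_max_right _ _)) (max_le_max_right 0 hst)
  have hb : BddBelow (range fun t => En lw lx φ μ (max t 0)) :=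
    ⟨0, by rintro _ ⟨t, rfl⟩; exact h.En_nonneg _⟩
  refine ⟨_, le_ciInf fun t => h.En_nonneg (max t 0), (tendsto_atTop_ciInf ha hb).congr' ?_⟩
  filter_upwards [eventually_ge_atTop 0] with t ht
  rw [max_eq_left ht]

end
end Herd

/-- the herding energy `E = λ_w X + V + λ_x M` satisfies
`dE/dt = -λ_v V_φ ≤ 0`; hence `E` is nonincreasing and converges to a limit `E^∞ ≥ 0`. -/
theorem kinetic_herding_energy_dissipation
    {d : ℕ} (hd : 1 ≤ d) (lw lx lv : ℝ) (hlw : 0 < lw) (hlx : 0 < lx) (hlv : 0 < lv)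
    (φ : ℝ → ℝ) (Kφ : NNReal) (hLip : LipschitzWith Kφ φ)
    (φM : ℝ) (hφM : 0 < φM) (hφ : ∀ r, 0 ≤ φ r ∧ φ r ≤ φM)
    (μ : ℝ → Measure (Phase d))
    (hsol : IsMVSol lw lx lv φ (Set.Ici 0) μ)
    (hprob : ∀ t ∈ Set.Ici (0:ℝ), IsProbabilityMeasure (μ t))
    (hcpt : ∀ t ∈ Set.Ici (0:ℝ), MeasureCompactSupport (μ t))
    (hcent : ∀ t ∈ Set.Ici (0:ℝ), (∫ z, z.1 ∂(μ t)) = 0 ∧ (∫ z, z.2 ∂(μ t)) = 0)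
    (E : ℝ → ℝ) (hE : ∀ t, E t = lw * Xfun μ t + Vfun μ t + lx * Mfun φ μ t) :
    (∀ t ∈ Set.Ici (0:ℝ),
      HasDerivWithinAt E (-(lv * Vphi φ μ t)) (Set.Ici 0) t ∧ -(lv * Vphi φ μ t) ≤ 0) ∧
    AntitoneOn E (Set.Ici 0) ∧
    (∃ Einf : ℝ, 0 ≤ Einf ∧ Tendsto E atTop (nhds Einf)) := by
  set ν : ℝ → Measure (Phase d) := fun t => μ (max t 0) with hν
  have hm : ∀ t : ℝ, max t 0 ∈ Set.Ici (0:ℝ) := fun t => le_max_right t 0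
  have hνμ : ∀ t : ℝ, 0 ≤ t → ν t = μ t := fun t ht => by simp only [hν, max_eq_left ht]
  have hG : Herd.Good lw lx lv φ φM ν :=
    { hlw := hlw
      hlx := hlx
      hlv := hlv
      hφc := hLip.continuous
      hφM := hφM
      hφ := hφ
      prob := fun t => hprob _ (hm t)
      cpt := fun t => hcpt _ (hm t)
      neg := fun t ht => by simp only [hν, max_eq_right ht, max_self]
      cont := fun g => (hsol.2.1 g).comp_continuous (continuous_id.max continuous_const) hm
      weak := by
        intro g hg hgs t ht
        rw [hνμ t ht, hνμ 0 le_rfl, hsol.2.2 g hg hgs t ht]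
        refine intervalIntegral.integral_congr fun s hs => ?_
        rw [Set.uIcc_of_le ht] at hs
        simp only [hνμ s hs.1] }
  have hx : ∀ t, ∫ z, z.1 ∂(ν t) = 0 := fun t => (hcent _ (hm t)).1
  have hEn : ∀ t, 0 ≤ t → E t = Herd.En lw lx φ ν t := by
    intro t ht
    rw [hE]
    simp only [Herd.En, Xfun, Vfun, Mfun, hνμ t ht]
  have hV : ∀ t, 0 ≤ t → Vphi φ μ t = Vphi φ ν t := by
    intro t ht
    simp only [Vphi, hνμ t ht]
  refine ⟨fun t ht => ⟨?_, ?_⟩, ?_, ?_⟩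
  · rw [hV t ht]
    exact (hG.En_derivWithin hx ht).congr (fun s hs => hEn s hs) (hEn t ht)
  · rw [hV t ht]
    have := mul_nonneg hlv.le (hG.Vphi_nonneg t)
    linarith
  · intro s hs t ht hst
    rw [hEn s hs, hEn t ht]
    exact hG.En_anti hx hs ht hst
  · obtain ⟨L, hL, hT⟩ := hG.En_lim hx
    refine ⟨L, hL, hT.congr' ?_⟩
    filter_upwards [eventually_ge_atTop 0] with t ht
    exact (hEn t ht).symm
end
end
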